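/- arXiv:math/9909190 — 3 statements merged into one kernel-verified Lean document; each statement's English description precedes it below -/
import Mathlib

section
/- Let a₁, …, a_n be integers, let R₁, …, R_n be positive integers, and let m ≥ 2 be an integer. Then the number of tuples (r₁, …, r_n) ∈ ℤⁿ with 0 ≤ r_i ≤ R_i − 1 for each i and Σ_{i=1}^{n} r_i·a_i ≡ 0 (mod m) is at least R₁·R₂⋯R_n / 2^{m−1}. -/
open scoped BigOperators

open scoped Pointwise in
/-- **Scherk's theorem** for finite subsets of an abelian group. -/
theorem card_add_card_le_card_add_of_unique_zero {G : Type*} [AddCommGroup G] [DecidableEq G]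
    (A B : Finset G) (hA : 0 ∈ A) (hB : 0 ∈ B)
    (h : ∀ a ∈ A, ∀ b ∈ B, a + b = 0 → b = 0) :
    A.card + B.card ≤ (A + B).card + 1 := by
  induction hk : B.card using Nat.strong_induction_on generalizing A B with
  | _ k ih =>
  subst hk
  by_cases hB1 : ∀ b ∈ B, b = 0
  · have hBs : B = {0} := Finset.eq_singleton_iff_unique_mem.2 ⟨hB, hB1⟩
    subst hBs
    simp
  push Not at hB1
  obtain ⟨b, hb, hb0⟩ := hB1
  obtain ⟨e, he, c, hc, hec⟩ : ∃ e ∈ A, ∃ c ∈ B, c + e ∉ A := by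
    by_contra! hcon
    have himg : A.image (b + ·) = A := by
      apply Finset.eq_of_subset_of_card_le
      · intro x hx
        obtain ⟨y, hy, rfl⟩ := Finset.mem_image.1 hx
        exact hcon y hy b hb
      · rw [Finset.card_image_of_injective _ (add_right_injective b)]
    rw [← himg] at hA
    obtain ⟨y, hy, hy0⟩ := Finset.mem_image.1 hA
    exact hb0 (h y hy b hb (by rw [add_comm]; exact hy0))
  set C := B.image (· + e) with hC
  have hinj : Function.Injective (fun x : G => x + e) := add_left_injective e
  set B' := B.filter (fun x => x + e ∈ A) with hB'
  have hcardI : (A ∩ C).card = B'.card := by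
    have : A ∩ C = B'.image (· + e) := by
      ext x
      simp only [hC, hB', Finset.mem_inter, Finset.mem_image, Finset.mem_filter]
      constructor
      · rintro ⟨hx, y, hy, rfl⟩
        exact ⟨y, ⟨hy, hx⟩, rfl⟩
      · rintro ⟨y, ⟨hy, hy'⟩, rfl⟩
        exact ⟨hy', y, hy, rfl⟩
    rw [this, Finset.card_image_of_injective _ hinj]
  have hcardC : C.card = B.card := Finset.card_image_of_injective _ hinj
  have hlt : B'.card < B.card := by
    apply Finset.card_lt_card
    refine Finset.filter_ssubset.2 ⟨c, hc, hec⟩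
  have hunion := Finset.card_union_add_card_inter A C
  have hsub : (A ∪ C) + B' ⊆ A + B := by
    intro x hx
    obtain ⟨y, hy, z, hz, rfl⟩ := Finset.mem_add.1 hx
    obtain ⟨hz, hze⟩ := Finset.mem_filter.1 hz
    rcases Finset.mem_union.1 hy with hy | hy
    · exact Finset.add_mem_add hy hz
    · obtain ⟨w, hw, rfl⟩ := Finset.mem_image.1 hy
      exact Finset.mem_add.2 ⟨z + e, hze, w, hw, by abel⟩
  have key := ih B'.card hlt (A ∪ C) B' (Finset.mem_union_left _ hA)
    (Finset.mem_filter.2 ⟨hB, by simpa using he⟩) (by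
      intro y hy z hz hyz
      obtain ⟨hz, hze⟩ := Finset.mem_filter.1 hz
      rcases Finset.mem_union.1 hy with hy | hy
      · exact h y hy z hz hyz
      · obtain ⟨w, hw, rfl⟩ := Finset.mem_image.1 hy
        have hw0 : w = 0 := h (z + e) hze w hw (by rw [← hyz]; abel)
        subst hw0
        exact h e he z hz (by simpa using hyz)) rfl
  have := Finset.card_le_card hsub
  omega

open scoped Pointwise in
/-- If `0` is only trivially a sum of elements of the finite sets `A i ∋ 0`, then the ambient group
has at least `1 + ∑ i, (|A i| - 1)` elements. -/
theorem sum_card_sub_one_lt_card_of_unique_zero {ι G : Type*} [Fintype ι] [DecidableEq ι]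
    [AddCommGroup G] [Fintype G] [DecidableEq G] (A : ι → Finset G) (h0 : ∀ i, 0 ∈ A i)
    (h : ∀ f : ι → G, (∀ i, f i ∈ A i) → ∑ i, f i = 0 → f = 0) :
    ∑ i, ((A i).card - 1) < Fintype.card G := by
  suffices H : ∀ s : Finset ι, ∃ P : Finset G, 0 ∈ P ∧
      (∀ p ∈ P, ∃ f : ι → G, (∀ i, f i ∈ A i) ∧ (∀ i ∉ s, f i = 0) ∧ ∑ i, f i = p) ∧
      ∑ i ∈ s, ((A i).card - 1) < P.card by
    obtain ⟨P, -, -, hP⟩ := H Finset.univ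
    exact hP.trans_le P.card_le_univ
  intro s
  induction s using Finset.induction_on with
  | empty => exact ⟨{0}, by simp, fun p hp => ⟨0, by simpa using h0, by simp,
      by simpa using (Finset.mem_singleton.1 hp).symm⟩, by simp⟩
  | insert j s hj ih =>
    obtain ⟨P, hP0, hP, hcard⟩ := ih
    have ext : ∀ p ∈ P, ∀ a ∈ A j, ∃ f : ι → G, (∀ i, f i ∈ A i) ∧
        (∀ i ∉ insert j s, f i = 0) ∧ f j = a ∧ ∑ i, f i = p + a := by
      intro p hp a ha
      obtain ⟨f, hf, hfs, rfl⟩ := hP p hp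
      refine ⟨f + Pi.single j a, fun i => ?_, fun i hi => ?_, ?_, ?_⟩
      · by_cases hij : i = j
        · subst hij
          simpa [hfs i hj] using ha
        · simpa [hij] using hf i
      · simp only [Finset.mem_insert, not_or] at hi
        simp [hi.1, hfs i hi.2]
      · simp [hfs j hj]
      · simp [Finset.sum_add_distrib]
    refine ⟨P + A j, Finset.mem_add.2 ⟨0, hP0, 0, h0 j, by simp⟩, ?_, ?_⟩
    · intro q hq
      obtain ⟨p, hp, a, ha, rfl⟩ := Finset.mem_add.1 hq
      obtain ⟨f, hf, hfs, -, hsum⟩ := ext p hp a ha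
      exact ⟨f, hf, hfs, hsum⟩
    · have := card_add_card_le_card_add_of_unique_zero P (A j) hP0 (h0 j) (by
        intro p hp a ha hpa
        obtain ⟨f, hf, -, rfl, hsum⟩ := ext p hp a ha
        rw [h f hf (hsum.trans hpa), Pi.zero_apply])
      have hpos : 0 < (A j).card := Finset.card_pos.2 ⟨0, h0 j⟩
      rw [Finset.sum_insert hj]
      omega

/-- In a product of finite sets mapped injectively to a finite abelian group, a value `g` that is
attained as a sum at all is attained by at least a proportion `2 ^ (1 - |G|)` of all tuples. -/
theorem card_piFinset_le_two_pow_mul_card_filter_sum_eq {ι α G : Type*} [Fintype ι]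
    [DecidableEq ι] [DecidableEq α] [AddCommGroup G] [Fintype G] [DecidableEq G]
    (φ : ι → α → G) (g : G) (T : ι → Finset α) (hφ : ∀ i, Set.InjOn (φ i) (T i))
    (hne : ∃ r ∈ Fintype.piFinset T, ∑ i, φ i (r i) = g) :
    (Fintype.piFinset T).card ≤ 2 ^ (Fintype.card G - 1) *
      ((Fintype.piFinset T).filter (fun r => ∑ i, φ i (r i) = g)).card := by
  induction hk : (Fintype.piFinset T).card using Nat.strong_induction_on generalizing T with
  | _ k ih =>
  subst hk
  obtain ⟨r, hr, hrg⟩ := hne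
  by_cases huniq : ∀ r' ∈ Fintype.piFinset T, ∑ i, φ i (r' i) = g → r' = r
  · have hpos : 0 < ((Fintype.piFinset T).filter (fun r => ∑ i, φ i (r i) = g)).card :=
      Finset.card_pos.2 ⟨r, Finset.mem_filter.2 ⟨hr, hrg⟩⟩
    have hrT := Fintype.mem_piFinset.1 hr
    have hcard : ∀ i, ((T i).image (fun x => φ i x - φ i (r i))).card = (T i).card := fun i =>
      Finset.card_image_of_injOn fun x hx y hy hxy => hφ i hx hy (sub_left_injective hxy)
    have hlt := sum_card_sub_one_lt_card_of_unique_zero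
      (fun i => (T i).image (fun x => φ i x - φ i (r i)))
      (fun i => Finset.mem_image.2 ⟨r i, hrT i, sub_self _⟩) (by
        intro f hf hf0
        choose r' hr' hr'f using fun i => Finset.mem_image.1 (hf i)
        have hsum : ∑ i, φ i (r' i) = g := by
          rw [← hrg, ← sub_eq_zero, ← Finset.sum_sub_distrib, ← hf0]
          exact Finset.sum_congr rfl fun i _ => hr'f i
        have := huniq r' (Fintype.mem_piFinset.2 hr') hsum
        subst this
        funext i
        rw [← hr'f i, sub_self, Pi.zero_apply])
    simp only [hcard] at hlt
    calc (Fintype.piFinset T).card = ∏ i, (T i).card := Fintype.card_piFinset T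
      _ ≤ ∏ i, 2 ^ ((T i).card - 1) := by
        refine Finset.prod_le_prod' fun i _ => ?_
        have := Nat.lt_two_pow_self (n := (T i).card - 1)
        omega
      _ = 2 ^ ∑ i, ((T i).card - 1) := Finset.prod_pow_eq_pow_sum _ _ _
      _ ≤ 2 ^ (Fintype.card G - 1) := Nat.pow_le_pow_right (by norm_num) (by omega)
      _ ≤ _ := Nat.le_mul_of_pos_right _ hpos
  · push Not at huniq
    obtain ⟨r', hr', hr'g, hne⟩ := huniq
    obtain ⟨i, hi⟩ := Function.ne_iff.1 hne
    have hpi : ∀ (p : α → Prop) [DecidablePred p],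
        Fintype.piFinset (Function.update T i ((T i).filter p)) =
          (Fintype.piFinset T).filter (fun s => p (s i)) := by
      intro p _
      ext s
      simp only [Fintype.mem_piFinset, Finset.mem_filter]
      constructor
      · intro hs
        have hsi := hs i
        simp only [Function.update_self, Finset.mem_filter] at hsi
        refine ⟨fun j => ?_, hsi.2⟩
        by_cases hj : j = i
        · subst hj
          exact hsi.1
        · simpa [hj] using hs j
      · rintro ⟨hs, hp⟩ j
        by_cases hj : j = i
        · subst hj
          simpa using ⟨hs j, hp⟩
        · simpa [hj] using hs j
    have half : ∀ (p : α → Prop) [DecidablePred p] (u v : ι → α), u ∈ Fintype.piFinset T →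
        ∑ i, φ i (u i) = g → p (u i) → v ∈ Fintype.piFinset T → ¬ p (v i) →
        ((Fintype.piFinset T).filter (fun s => p (s i))).card ≤ 2 ^ (Fintype.card G - 1) *
          (((Fintype.piFinset T).filter (fun r => ∑ i, φ i (r i) = g)).filter
            (fun s => p (s i))).card := by
      intro p _ u v hu hug hpu hv hpv
      have := ih _ (Finset.card_lt_card (Finset.filter_ssubset.2 ⟨v, hv, hpv⟩))
        (Function.update T i ((T i).filter p)) (by
          intro j
          by_cases hj : j = i
          · subst hj
            simp only [Function.update_self]
            exact (hφ j).mono (Finset.coe_subset.2 (Finset.filter_subset _ _))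
          · simpa [hj] using hφ j)
        ⟨u, by rw [hpi]; exact Finset.mem_filter.2 ⟨hu, hpu⟩, hug⟩ (by rw [hpi])
      rwa [hpi, Finset.filter_comm] at this
    have h1 := half (· = r i) r r' hr hrg rfl hr' hi
    have h2 := half (fun x => ¬ x = r i) r' r hr' hr'g hi hr (by simp)
    rw [← Finset.card_filter_add_card_filter_not (s := Fintype.piFinset T) (fun s => s i = r i),
      ← Finset.card_filter_add_card_filter_not
        (s := (Fintype.piFinset T).filter (fun r => ∑ i, φ i (r i) = g)) (fun s => s i = r i),
      mul_add]
    exact add_le_add h1 h2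

/-- For a finite abelian group `G`, at least a proportion `2 ^ (1 - |G|)` of the tuples in a box
with a corner at the origin give a vanishing weighted sum. -/
theorem prod_le_two_pow_mul_card_filter_sum_nsmul_eq_zero {ι G : Type*} [Fintype ι]
    [DecidableEq ι] [AddCommGroup G] [Fintype G] [DecidableEq G] (a : ι → G) (R : ι → ℕ) :
    ∏ i, R i ≤ 2 ^ (Fintype.card G - 1) *
      ((Fintype.piFinset fun i => Finset.range (R i)).filter
        (fun r => ∑ i, r i • a i = 0)).card := by
  set B := Fintype.piFinset fun i => Finset.range (R i) with hB
  let q : (ι → ℕ) → ι → ℕ := fun r i => r i / addOrderOf (a i)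
  have hcard : ∏ i, R i = B.card := by simp [hB, Fintype.card_piFinset]
  have hmaps : ∀ S ⊆ B, Set.MapsTo q S (B.image q) := fun S hS r hr =>
    Finset.mem_coe.2 (Finset.mem_image_of_mem q (hS hr))
  rw [hcard, Finset.card_eq_sum_card_fiberwise (hmaps B subset_rfl),
    Finset.card_eq_sum_card_fiberwise (hmaps _ (Finset.filter_subset _ B)), Finset.mul_sum]
  refine Finset.sum_le_sum fun c hc => ?_
  obtain ⟨t, ht, rfl⟩ := Finset.mem_image.1 hc
  have hbox : B.filter (fun r => q r = q t) = Fintype.piFinset fun i =>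
      (Finset.range (R i)).filter (fun x => x / addOrderOf (a i) = q t i) := by
    ext r
    simp only [hB, Finset.mem_filter, Fintype.mem_piFinset, funext_iff, forall_and, q]
  rw [Finset.filter_comm, hbox]
  refine card_piFinset_le_two_pow_mul_card_filter_sum_eq (fun i x => x • a i) 0 _ ?_
    ⟨fun i => addOrderOf (a i) * q t i, ?_, ?_⟩
  · intro i x hx y hy hxy
    simp only [Finset.coe_filter, Set.mem_ofPred_eq] at hx hy
    have hmod : x % addOrderOf (a i) = y % addOrderOf (a i) := nsmul_eq_nsmul_iff_modEq.1 hxy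
    rw [← Nat.div_add_mod x (addOrderOf (a i)), ← Nat.div_add_mod y (addOrderOf (a i)),
      hx.2, hy.2, hmod]
  · rw [Fintype.mem_piFinset]
    intro i
    rw [Finset.mem_filter, Finset.mem_range]
    exact ⟨(Nat.mul_div_le _ _).trans_lt (Finset.mem_range.1 (Fintype.mem_piFinset.1 ht i)),
      Nat.mul_div_cancel_left _ (addOrderOf_pos (a i))⟩
  · exact Finset.sum_eq_zero fun i _ => by simp [mul_nsmul]

theorem count_tuples_weighted_sum_divisible
    (n m : ℕ) (hm : 2 ≤ m) (a : Fin n → ℤ) (R : Fin n → ℕ) (hR : ∀ i, 1 ≤ R i) :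
    ((∏ i, R i : ℕ) : ℝ) / 2 ^ (m - 1) ≤
      (Nat.card {r : ∀ i, Fin (R i) // (m : ℤ) ∣ ∑ i, (r i : ℤ) * a i} : ℝ) := by
  have : NeZero m := ⟨by omega⟩
  have key := prod_le_two_pow_mul_card_filter_sum_nsmul_eq_zero (fun i => (a i : ZMod m)) R
  rw [ZMod.card] at key
  have hdvd : ∀ r : Fin n → ℕ,
      ∑ i, r i • (a i : ZMod m) = 0 ↔ (m : ℤ) ∣ ∑ i, (r i : ℤ) * a i := by
    intro r
    rw [← ZMod.intCast_zmod_eq_zero_iff_dvd]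
    push_cast
    simp only [nsmul_eq_mul]
  have hcard : ((Fintype.piFinset fun i => Finset.range (R i)).filter
      (fun r => ∑ i, r i • (a i : ZMod m) = 0)).card =
      Nat.card {r : ∀ i, Fin (R i) // (m : ℤ) ∣ ∑ i, (r i : ℤ) * a i} := by
    rw [← Nat.card_eq_finsetCard]
    refine Nat.card_congr
      { toFun := fun r => ⟨fun i => ⟨r.1 i, ?_⟩, ?_⟩
        invFun := fun r => ⟨fun i => r.1 i, ?_⟩
        left_inv := fun r => rfl
        right_inv := fun r => rfl }
    · exact Finset.mem_range.1 (Fintype.mem_piFinset.1 (Finset.mem_filter.1 r.2).1 i)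
    · exact (hdvd _).1 (Finset.mem_filter.1 r.2).2
    · exact Finset.mem_filter.2 ⟨Fintype.mem_piFinset.2 fun i => Finset.mem_range.2 (r.1 i).2,
        (hdvd _).2 r.2⟩
  rw [div_le_iff₀ (by positivity), ← hcard, mul_comm]
  exact_mod_cast key
end

section
/- Let β₀ ≥ 0, let β: [0,∞) → ℝ be measurable with 0 ≤ β(u) ≤ β₀ for all u, and let α: [0,∞) → ℝ be continuous with α(u) ≥ 0 for all 0 ≤ u ≤ 1. If u·α(u) ≥ ∫_0^u α(t)·β(u−t) dt for all u ≥ 1, then α(u) ≥ 0 for all u ≥ 0. In particular, if u·α(u) ≥ ∫_0^u α(t) dt for all u ≥ 1 and α ≥ 0 on [0,1], then α(u) ≥ 0 for all u ≥ 0. -/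
open MeasureTheory

/-- The product of a continuous function with a reflected bounded measurable function is
interval integrable. -/
theorem intervalIntegrable_mul_comp_sub {α β : ℝ → ℝ} {C : ℝ} (hα : Continuous α)
    (hβ : Measurable β) (hβC : ∀ u, 0 ≤ β u ∧ β u ≤ C) (u a b : ℝ) :
    IntervalIntegrable (fun t => α t * β (u - t)) volume a b := by
  have hβi : IntervalIntegrable (fun t => β (u - t)) volume a b := by
    refine (intervalIntegrable_const (c := C)).mono_fun
      (hβ.comp (measurable_const.sub measurable_id)).aestronglyMeasurable ?_
    refine Filter.Eventually.of_forall fun t => ?_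
    simp only [Real.norm_eq_abs]
    rw [abs_of_nonneg (hβC _).1]
    exact (hβC _).2.trans (le_abs_self C)
  exact hβi.continuousOn_mul hα.continuousOn

/-- Nonnegativity of `α` on `[0, a]` propagates to `[0, a + h]` when `C * h < 1`. -/
theorem nonneg_extend_of_convolution_ineq {α β : ℝ → ℝ} {C a h : ℝ} (hα : Continuous α)
    (hC : 0 ≤ C) (hβ : Measurable β) (hβC : ∀ u, 0 ≤ β u ∧ β u ≤ C)
    (hconv : ∀ u : ℝ, 1 ≤ u → (∫ t in (0:ℝ)..u, α t * β (u - t)) ≤ u * α u)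
    (ha : 1 ≤ a) (hh : 0 ≤ h) (hCh : C * h < 1)
    (hnonneg : ∀ u, 0 ≤ u → u ≤ a → 0 ≤ α u) :
    ∀ u, 0 ≤ u → u ≤ a + h → 0 ≤ α u := by
  intro u hu0 hu
  by_contra! hneg
  have hau : a < u := by
    by_contra! hle
    exact absurd (hnonneg u hu0 hle) (not_le.mpr hneg)
  obtain ⟨v, ⟨hav, hv⟩, hmin⟩ := isCompact_Icc.exists_isMinOn
    (Set.nonempty_Icc.mpr (le_add_of_nonneg_right hh : a ≤ a + h)) hα.continuousOn
  have hmin' : ∀ t, a ≤ t → t ≤ a + h → α v ≤ α t := fun t h₁ h₂ => hmin ⟨h₁, h₂⟩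
  have hvneg : α v < 0 := (hmin' u hau.le hu).trans_lt hneg
  have hint := intervalIntegrable_mul_comp_sub hα hβ hβC v
  have hhead : 0 ≤ ∫ t in (0:ℝ)..a, α t * β (v - t) :=
    intervalIntegral.integral_nonneg (by linarith) fun t ht =>
      mul_nonneg (hnonneg t ht.1 ht.2) (hβC _).1
  have htail : (v - a) * (α v * C) ≤ ∫ t in a..v, α t * β (v - t) := by
    have := intervalIntegral.integral_mono_on hav
      (intervalIntegrable_const (c := α v * C)) (hint a v) fun t ht => by
        have h₁ := mul_le_mul_of_nonneg_right
          (hmin' t ht.1 (ht.2.trans hv)) (hβC (v - t)).1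
        have h₂ := mul_le_mul_of_nonpos_left (hβC (v - t)).2 hvneg.le
        exact h₂.trans h₁
    simpa only [intervalIntegral.integral_const, smul_eq_mul] using this
  have hsplit := intervalIntegral.integral_add_adjacent_intervals (hint 0 a) (hint a v)
  have hkey := hconv v (ha.trans hav)
  have hlength : (v - a) * C < 1 :=
    (mul_le_mul_of_nonneg_right (by linarith : v - a ≤ h) hC).trans_lt (by linarith)
  nlinarith [mul_pos (neg_pos.mpr hvneg) (by linarith : 0 < v - (v - a) * C)]

/-- A continuous function that is nonnegative on `[0, 1]` and satisfies the convolution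
inequality on `[1, ∞)` is nonnegative on `[0, ∞)`. -/
theorem nonneg_of_integral_mul_comp_sub_le {α β : ℝ → ℝ} {C : ℝ} (hα : Continuous α)
    (hinit : ∀ u, 0 ≤ u → u ≤ 1 → 0 ≤ α u)
    (hC : 0 ≤ C) (hβ : Measurable β) (hβC : ∀ u, 0 ≤ β u ∧ β u ≤ C)
    (hconv : ∀ u : ℝ, 1 ≤ u → (∫ t in (0:ℝ)..u, α t * β (u - t)) ≤ u * α u) :
    ∀ u, 0 ≤ u → 0 ≤ α u := by
  have hpos : 0 < (C + 1)⁻¹ := by positivity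
  have hlt : C * (C + 1)⁻¹ < 1 := by
    rw [← div_eq_mul_inv, div_lt_one (by positivity)]
    linarith
  have hstep : ∀ n : ℕ, ∀ u, 0 ≤ u → u ≤ 1 + n * (C + 1)⁻¹ → 0 ≤ α u := by
    intro n
    induction n with
    | zero => simpa using hinit
    | succ n ih =>
      have ha : (1 : ℝ) ≤ 1 + n * (C + 1)⁻¹ := le_add_of_nonneg_right (by positivity)
      intro u hu0 hu
      refine nonneg_extend_of_convolution_ineq hα hC hβ hβC hconv ha hpos.le hlt ih u hu0 ?_
      push_cast at hu
      linarith
  intro u hu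
  obtain ⟨n, hn⟩ := exists_nat_ge (u / (C + 1)⁻¹)
  rw [div_le_iff₀ hpos] at hn
  exact hstep n u hu (by linarith)

theorem nonneg_of_convolution_ineq
    (α : ℝ → ℝ) (hαcont : Continuous α)
    (hαinit : ∀ u : ℝ, 0 ≤ u → u ≤ 1 → 0 ≤ α u) :
    ((∀ β₀ : ℝ, 0 ≤ β₀ → ∀ β : ℝ → ℝ, Measurable β →
        (∀ u : ℝ, 0 ≤ β u ∧ β u ≤ β₀) →
        (∀ u : ℝ, 1 ≤ u → (∫ t in (0:ℝ)..u, α t * β (u - t)) ≤ u * α u) →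
        ∀ u : ℝ, 0 ≤ u → 0 ≤ α u)
      ∧
      ((∀ u : ℝ, 1 ≤ u → (∫ t in (0:ℝ)..u, α t) ≤ u * α u) →
        ∀ u : ℝ, 0 ≤ u → 0 ≤ α u)) := by
  refine ⟨fun β₀ hβ₀ β hβ hβb hconv =>
    nonneg_of_integral_mul_comp_sub_le hαcont hαinit hβ₀ hβ hβb hconv, fun hconv => ?_⟩
  refine nonneg_of_integral_mul_comp_sub_le (β := fun _ => 1) (C := 1) hαcont hαinit
    zero_le_one measurable_const (fun _ => ⟨zero_le_one, le_rfl⟩) ?_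
  simpa using hconv
end

section
/- Let χ: [0,∞) → ℝ be measurable with χ(t) ∈ [−1,1] for all t and χ(t) = 1 for 0 ≤ t ≤ 1, and let σ be the corresponding unique solution of the integral equation (1.5). Let δ₁ = 1 − 2·log(1+√e) + 4·∫_1^{√e} (log t)/(t+1) dt. (a) If ∫_1^u (1−χ(t))/t dt < 1 for all u ≥ 1, then σ(u) > 0 for all u ≥ 0. (b) If there is u₀ ≥ 1 with ∫_1^{u₀} (1−χ(t))/t dt = 1, then σ(u) ≥ 0 for all 0 ≤ u ≤ u₀ and |σ(u)| ≤ |δ₁| for all u ≥ u₀. (c) Moreover, there exist absolute constants C > 0 and ε₀ > 0 such that, in case (b), for every 0 < ε ≤ ε₀ and every u ≥ 1 with |σ(u) − δ₁| ≤ ε, one has |u/u₀ − (1 + 1/√e)| ≤ C·ε^{1/4} and ∫_1^{u/(1+√e)} (1−χ(t))/t dt + ∫_{u/(1+√e)}^{u} (1+χ(t))/t dt ≤ C·√ε. -/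
open MeasureTheory

/-- `σ` solves the integral equation (1.5) for the real-valued `χ`. -/
def IsSolutionR (χ σ : ℝ → ℝ) : Prop :=
  Measurable σ ∧ LocallyIntegrableOn σ (Set.Ici 0) volume ∧
    (∀ u : ℝ, 0 ≤ u → u ≤ 1 → σ u = 1) ∧
    ∀ u : ℝ, 1 < u → u * σ u = ∫ t in (0:ℝ)..u, σ (u - t) * χ t

/-- The constant `δ₁ = 1 − 2 log(1+√e) + 4 ∫_1^{√e} log t/(t+1) dt`. -/
noncomputable def delta1 : ℝ :=
  1 - 2 * Real.log (1 + Real.sqrt (Real.exp 1)) +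
    4 * ∫ t in (1:ℝ)..(Real.sqrt (Real.exp 1)), Real.log t / (t + 1)

/-- The convolution `∫ f(t) h(u - t) dt`. -/
noncomputable def cv (f h : ℝ → ℝ) (u : ℝ) : ℝ := ∫ t, f t * h (u - t)

/-- Integrable measurable kernels. -/
def IsKernel (f : ℝ → ℝ) : Prop := Measurable f ∧ Integrable f

/-- Bounded measurable functions. -/
def IsBddMeas (h : ℝ → ℝ) : Prop := Measurable h ∧ ∃ C, ∀ x, |h x| ≤ C

/-- The Heaviside function. -/
noncomputable def heav : ℝ → ℝ := Set.indicator (Set.Ici 0) 1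

lemma heav_of_nonneg {x : ℝ} (hx : 0 ≤ x) : heav x = 1 := by
  simp [heav, hx]

lemma heav_of_neg {x : ℝ} (hx : x < 0) : heav x = 0 := by
  simp [heav, hx]

lemma heav_nonneg (x : ℝ) : 0 ≤ heav x := by
  rcases lt_or_ge x 0 with h | h
  · rw [heav_of_neg h]
  · rw [heav_of_nonneg h]; norm_num

lemma heav_le_one (x : ℝ) : heav x ≤ 1 := by
  rcases lt_or_ge x 0 with h | h
  · rw [heav_of_neg h]; norm_num
  · rw [heav_of_nonneg h]

lemma heav_mono : Monotone heav := by
  intro x y hxy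
  rcases lt_or_ge x 0 with h | h
  · rw [heav_of_neg h]; exact heav_nonneg y
  · rw [heav_of_nonneg h, heav_of_nonneg (h.trans hxy)]

lemma isBddMeas_heav : IsBddMeas heav :=
  ⟨measurable_one.indicator measurableSet_Ici, 1, fun x => by
    rw [abs_of_nonneg (heav_nonneg x)]; exact heav_le_one x⟩

lemma IsBddMeas.add {h k : ℝ → ℝ} (hh : IsBddMeas h) (hk : IsBddMeas k) : IsBddMeas (h + k) := by
  obtain ⟨h1, C, hC⟩ := hh
  obtain ⟨k1, D, hD⟩ := hk
  exact ⟨h1.add k1, C + D, fun x => (abs_add_le _ _).trans (add_le_add (hC x) (hD x))⟩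

lemma IsBddMeas.const_mul {h : ℝ → ℝ} (hh : IsBddMeas h) (c : ℝ) :
    IsBddMeas (fun x => c * h x) := by
  obtain ⟨h1, C, hC⟩ := hh
  exact ⟨h1.const_mul c, |c| * C, fun x => by
    rw [abs_mul]; exact mul_le_mul_of_nonneg_left (hC x) (abs_nonneg c)⟩

lemma IsBddMeas.shift {h : ℝ → ℝ} (hh : IsBddMeas h) (c : ℝ) :
    IsBddMeas (fun x => h (x - c)) := by
  obtain ⟨h1, C, hC⟩ := hh
  exact ⟨h1.comp (measurable_id.sub_const c), C, fun x => hC _⟩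

lemma cv_integrable {f h : ℝ → ℝ} (hf : IsKernel f) (hh : IsBddMeas h) (u : ℝ) :
    Integrable (fun t => f t * h (u - t)) := by
  obtain ⟨h1, C, hC⟩ := hh
  exact hf.2.mul_bdd (c := C)
    ((h1.comp (measurable_const.sub measurable_id)).aestronglyMeasurable)
    (Filter.Eventually.of_forall fun t => by simpa using hC (u - t))

lemma abs_cv_le {f h : ℝ → ℝ} (hf : IsKernel f) {C : ℝ} (hC : ∀ x, |h x| ≤ C) (u : ℝ) :
    |cv f h u| ≤ (∫ t, |f t|) * C := by
  rw [← integral_mul_const]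
  show ‖∫ t, f t * h (u - t)‖ ≤ _
  refine norm_integral_le_of_norm_le (hf.2.abs.mul_const C) (Filter.Eventually.of_forall fun t => ?_)
  rw [norm_mul, Real.norm_eq_abs, Real.norm_eq_abs]
  exact mul_le_mul_of_nonneg_left (hC _) (abs_nonneg _)

lemma IsBddMeas.cv {f h : ℝ → ℝ} (hh : IsBddMeas h) (hf : IsKernel f) : IsBddMeas (cv f h) := by
  obtain ⟨h1, C, hC⟩ := hh
  refine ⟨?_, _, abs_cv_le hf hC⟩
  have : StronglyMeasurable (Function.uncurry fun u t : ℝ => f t * h (u - t)) := by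
    apply Measurable.stronglyMeasurable
    exact (hf.1.comp measurable_snd).mul (h1.comp (measurable_fst.sub measurable_snd))
  exact this.integral_prod_right.measurable

lemma cv_comm {f g h : ℝ → ℝ} (hf : IsKernel f) (hg : IsKernel g) (hh : IsBddMeas h) (u : ℝ) :
    cv f (cv g h) u = cv g (cv f h) u := by
  unfold cv
  simp_rw [← integral_const_mul]
  rw [integral_integral_swap]
  · congr 1; ext s; congr 1; ext t
    rw [show u - t - s = u - s - t by ring]; ring
  · obtain ⟨h1, C, hC⟩ := hh
    have h2 : Integrable (fun z : ℝ × ℝ => f z.1 * g z.2) (volume.prod volume) := hf.2.mul_prod hg.2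
    have h3 := h2.mul_bdd (c := C) (g := fun z : ℝ × ℝ => h (u - z.1 - z.2))
      ((h1.comp ((measurable_const.sub measurable_fst).sub measurable_snd)).aestronglyMeasurable)
      (Filter.Eventually.of_forall fun t => by simpa using hC _)
    refine h3.congr (Filter.Eventually.of_forall fun z => ?_)
    simp [Function.uncurry, mul_assoc]

lemma cv_le_cv {f f' h h' : ℝ → ℝ} (hf : IsKernel f) (hf' : IsKernel f') (hh : IsBddMeas h)
    (hh' : IsBddMeas h') {u : ℝ} (H : ∀ t, f t * h (u - t) ≤ f' t * h' (u - t)) :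
    cv f h u ≤ cv f' h' u :=
  integral_mono (cv_integrable hf hh u) (cv_integrable hf' hh' u) H

lemma cv_add_left {f g h : ℝ → ℝ} (hf : IsKernel f) (hg : IsKernel g) (hh : IsBddMeas h) (u : ℝ) :
    cv (f + g) h u = cv f h u + cv g h u := by
  unfold cv
  rw [← integral_add (cv_integrable hf hh u) (cv_integrable hg hh u)]
  simp [add_mul]

lemma cv_add_right {f h k : ℝ → ℝ} (hf : IsKernel f) (hh : IsBddMeas h) (hk : IsBddMeas k) (u : ℝ) :
    cv f (h + k) u = cv f h u + cv f k u := by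
  unfold cv
  rw [← integral_add (cv_integrable hf hh u) (cv_integrable hf hk u)]
  simp [mul_add]

lemma cv_const_mul (f h : ℝ → ℝ) (c u : ℝ) : cv f (fun x => c * h x) u = c * cv f h u := by
  unfold cv
  rw [← integral_const_mul]
  congr 1; ext t; ring

lemma cv_nonneg {f h : ℝ → ℝ} (hf : ∀ t, 0 ≤ f t) (hh : ∀ x, 0 ≤ h x) (u : ℝ) : 0 ≤ cv f h u :=
  integral_nonneg fun t => mul_nonneg (hf t) (hh _)

lemma cv_mono {f h : ℝ → ℝ} (hf : IsKernel f) (hf0 : ∀ t, 0 ≤ f t) (hh : IsBddMeas h)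
    (hm : Monotone h) : Monotone (cv f h) := by
  intro x y hxy
  exact integral_mono (cv_integrable hf hh x) (cv_integrable hf hh y)
    fun t => mul_le_mul_of_nonneg_left (hm (by linarith)) (hf0 t)

lemma cv_eq_zero {f h : ℝ → ℝ} {a b u : ℝ} (hf : ∀ t ≤ b, f t = 0) (hh : ∀ x < a, h x = 0)
    (hu : u ≤ a + b) : cv f h u = 0 := by
  unfold cv
  rw [← integral_zero ℝ ℝ]
  congr 1; ext t
  rcases le_or_gt t b with h1 | h1
  · rw [hf t h1, zero_mul]
  · rw [hh _ (by linarith), mul_zero]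

lemma cv_tsum {f : ℝ → ℝ} (hf : IsKernel f) {h : ℕ → ℝ → ℝ} (hh : ∀ n, Measurable (h n))
    {c : ℕ → ℝ} (hc : Summable c) (hb : ∀ n x, |h n x| ≤ c n) (u : ℝ) :
    HasSum (fun n => cv f (h n) u) (cv f (fun x => ∑' n, h n x) u) := by
  unfold cv
  refine hasSum_integral_of_dominated_convergence (fun n t => |f t| * c n) ?_ ?_ ?_ ?_ ?_
  · intro n
    exact (hf.1.mul ((hh n).comp (measurable_const.sub measurable_id))).aestronglyMeasurable
  · intro n
    refine Filter.Eventually.of_forall fun t => ?_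
    rw [norm_mul, Real.norm_eq_abs, Real.norm_eq_abs]
    exact mul_le_mul_of_nonneg_left (hb _ _) (abs_nonneg _)
  · exact Filter.Eventually.of_forall fun t => hc.mul_left _
  · simp_rw [tsum_mul_left]
    exact hf.2.abs.mul_const _
  · refine Filter.Eventually.of_forall fun t => ?_
    refine HasSum.mul_left _ (Summable.hasSum ?_)
    exact Summable.of_norm_bounded hc (fun n => hb n _)

lemma average_antitone {f : ℝ → ℝ} {a b : ℝ} (ha : 0 < a) (hf : IntervalIntegrable f volume 0 b)
    (h : ∀ u ∈ Set.Icc a b, u * f u ≤ ∫ t in (0:ℝ)..u, f t) {u v : ℝ} (hau : a ≤ u) (huv : u ≤ v)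
    (hvb : v ≤ b) : u * (∫ t in (0:ℝ)..v, f t) ≤ v * ∫ t in (0:ℝ)..u, f t := by
  have hu : 0 < u := ha.trans_le hau
  set F : ℝ → ℝ := fun w => ∫ t in (0:ℝ)..w, f t with hF
  have hb : 0 ≤ b := by linarith
  have hFc : ContinuousOn F (Set.Icc 0 b) := by
    have := intervalIntegral.continuousOn_primitive_interval (f := f) (μ := volume) (a := 0) (b := b)
      (by rw [Set.uIcc_of_le hb]; exact (intervalIntegrable_iff_integrableOn_Icc_of_le hb).1 hf)
    rwa [Set.uIcc_of_le hb] at this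
  have hFd : ContinuousOn (fun w => F w / w) (Set.Icc u v) := by
    refine (hFc.mono fun x hx => ⟨by linarith [hx.1], by linarith [hx.2]⟩).div continuousOn_id ?_
    exact fun x hx => (hu.trans_le hx.1).ne'
  have hsub : ∀ x ∈ Set.Icc u v, IntervalIntegrable f volume 0 x := fun x hx =>
    hf.mono_set (by
      rw [Set.uIcc_of_le hb, Set.uIcc_of_le (by linarith [hx.1])]
      exact Set.Icc_subset_Icc_right (by linarith [hx.2]))
  have hFdi : ∀ x ∈ Set.Icc u v, IntervalIntegrable (fun w => F w / w) volume u x := fun x hx => by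
    refine ContinuousOn.intervalIntegrable ?_
    rw [Set.uIcc_of_le hx.1]
    exact hFd.mono (Set.Icc_subset_Icc_right hx.2)
  set K : ℝ → ℝ := fun w => F u + ∫ s in u..w, F s / s with hK
  have hFK : ∀ w ∈ Set.Icc u v, F w ≤ K w := by
    intro w hw
    have h1 : F w = F u + ∫ s in u..w, f s := by
      simp only [hF]
      rw [intervalIntegral.integral_add_adjacent_intervals (hsub u ⟨le_rfl, huv⟩)]
      exact (hsub u ⟨le_rfl, huv⟩).symm.trans (hsub w hw)
    rw [h1]
    simp only [hK]
    have : ∫ s in u..w, f s ≤ ∫ s in u..w, F s / s := by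
      refine intervalIntegral.integral_mono_on hw.1
        ((hsub u ⟨le_rfl, huv⟩).symm.trans (hsub w hw)) (hFdi w hw) ?_
      intro x hx
      rw [le_div_iff₀ (by linarith [hx.1]), mul_comm]
      exact h x ⟨by linarith [hx.1], by linarith [hx.2, hw.2]⟩
    linarith
  have hKd : ∀ w ∈ Set.Ioo u v, HasDerivAt (fun w => K w / w) ((F w / w * w - K w * 1) / w ^ 2) w := by
    intro w hw
    have h1 : HasDerivAt K (F w / w) w := by
      refine HasDerivAt.const_add _ ?_
      refine intervalIntegral.integral_hasDerivAt_right (hFdi w ⟨hw.1.le, hw.2.le⟩) ?_ ?_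
      · exact hFd.stronglyMeasurableAtFilter_nhdsWithin measurableSet_Icc w |>.filter_mono
          (by rw [nhdsWithin_eq_nhds.2 (Icc_mem_nhds hw.1 hw.2)])
      · exact hFd.continuousAt (Icc_mem_nhds hw.1 hw.2)
    exact h1.div (hasDerivAt_id w) (hu.trans hw.1).ne'
  have hKc : ContinuousOn (fun w => K w / w) (Set.Icc u v) := by
    refine ContinuousOn.div (continuousOn_const.add ?_) continuousOn_id ?_
    · have := intervalIntegral.continuousOn_primitive_interval (f := fun w => F w / w)
        (μ := volume) (a := u) (b := v)
        (by rw [Set.uIcc_of_le huv]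
            exact (intervalIntegrable_iff_integrableOn_Icc_of_le huv).1 (hFdi v ⟨huv, le_rfl⟩))
      rwa [Set.uIcc_of_le huv] at this
    · exact fun x hx => (hu.trans_le hx.1).ne'
  have hanti : AntitoneOn (fun w => K w / w) (Set.Icc u v) := by
    refine antitoneOn_of_deriv_nonpos (convex_Icc u v) hKc ?_ ?_
    · rw [interior_Icc]
      exact fun w hw => (hKd w hw).differentiableAt.differentiableWithinAt
    · rw [interior_Icc]
      intro w hw
      rw [(hKd w hw).deriv]
      have hw0 : w ≠ 0 := by linarith [hw.1]
      rw [div_mul_cancel₀ _ hw0]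
      refine div_nonpos_of_nonpos_of_nonneg ?_ (sq_nonneg w)
      linarith [hFK w ⟨hw.1.le, hw.2.le⟩]
  have h1 := hanti ⟨le_rfl, huv⟩ ⟨huv, le_rfl⟩ huv
  simp only [hK, intervalIntegral.integral_same, add_zero] at h1
  rw [div_le_div_iff₀ (by linarith) hu] at h1
  have h2 := hFK v ⟨huv, le_rfl⟩
  simp only [hK] at h2
  nlinarith

open Nat in
/-- The exponential generating function of `a`, evaluated at `-z`. -/
noncomputable def egf (a : ℕ → ℝ) (z : ℝ) : ℝ := ∑' n, (-z) ^ n / n ! * a n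

open Nat in
lemma summable_egf {a : ℕ → ℝ} {K M : ℝ} (ha : ∀ n, |a n| ≤ K * M ^ n) (z : ℝ) :
    Summable fun n => (-z) ^ n / n ! * a n := by
  refine Summable.of_norm_bounded ((Real.summable_pow_div_factorial (|z| * M)).mul_left K)
    fun n => ?_
  rw [norm_mul, norm_div, norm_pow, norm_neg, Real.norm_eq_abs, Real.norm_eq_abs, Real.norm_eq_abs,
    abs_of_nonneg (by positivity : (0:ℝ) ≤ n !), mul_pow]
  calc |z| ^ n / n ! * |a n| ≤ |z| ^ n / n ! * (K * M ^ n) := by gcongr; exact ha n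
    _ = _ := by ring

lemma egf_zero (a : ℕ → ℝ) : egf a 0 = a 0 := by
  unfold egf
  rw [tsum_eq_single 0]
  · simp
  · intro n hn; simp [hn]

open Nat in
lemma hasDerivAt_egf {a : ℕ → ℝ} {K M : ℝ} (ha : ∀ n, |a n| ≤ K * M ^ n) (z : ℝ) :
    HasDerivAt (egf a) (-egf (fun n => a (n + 1)) z) z := by
  have hK : 0 ≤ K := by simpa using (abs_nonneg _).trans (ha 0)
  set R := |z| + 1 with hR
  have ha' : ∀ n, |a (n + 1)| ≤ (K * M) * M ^ n := fun n => (ha (n + 1)).trans_eq (by ring)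
  set g' : ℕ → ℝ → ℝ := fun n y => (n * (-y) ^ (n - 1) * -1) / n ! * a n with hg'
  have hs : ∀ n y, g' (n + 1) y = -((-y) ^ n / n ! * a (n + 1)) := by
    intro n y
    simp only [hg', Nat.factorial_succ, Nat.cast_mul, add_tsub_cancel_right]
    have h1 : (n ! : ℝ) ≠ 0 := by positivity
    have h2 : ((n + 1 : ℕ) : ℝ) ≠ 0 := by positivity
    field_simp
  have h := hasDerivAt_tsum_of_isPreconnected (𝕜 := ℝ) (F := ℝ)
    (g := fun n y => (-y) ^ n / n ! * a n) (g' := g')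
    (u := fun n => n * (R ^ (n - 1) / n ! * (K * M ^ n)))
    (t := Set.Ioo (-R) R) (y₀ := z) (y := z) ?_ isOpen_Ioo isPreconnected_Ioo ?_ ?_ ?_ ?_ ?_
  · have h2 : ∑' n, g' n z = -egf (fun n => a (n + 1)) z := by
      have hsm : Summable fun n => g' (n + 1) z := by
        simp_rw [hs]
        exact (summable_egf ha' z).neg
      have hsm' : Summable fun n => g' n z := (summable_nat_add_iff (f := fun n => g' n z) 1).1 hsm
      rw [hsm'.tsum_eq_zero_add]
      simp_rw [hs, tsum_neg]
      simp [hg', egf]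
    rw [h2] at h
    exact h
  · rw [← summable_nat_add_iff 1]
    refine ((Real.summable_pow_div_factorial (R * M)).mul_left (K * M)).congr fun n => ?_
    simp only [Nat.factorial_succ, Nat.cast_mul, add_tsub_cancel_right]
    have h1 : (n ! : ℝ) ≠ 0 := by positivity
    have h2 : ((n + 1 : ℕ) : ℝ) ≠ 0 := by positivity
    field_simp
    ring_nf
  · intro n y _
    have h1 : HasDerivAt (fun y : ℝ => (-y) ^ n) (n * (-y) ^ (n - 1) * -1) y :=
      (hasDerivAt_neg y).pow n
    exact (h1.div_const _).mul_const _
  · intro n y hy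
    have hyR : |y| ≤ R := abs_le.2 ⟨hy.1.le, hy.2.le⟩
    simp only [hg', norm_mul, norm_div, norm_pow, norm_neg, Real.norm_eq_abs, abs_one, mul_one,
      Nat.abs_cast]
    calc (n:ℝ) * |y| ^ (n - 1) / n ! * |a n| ≤ n * R ^ (n - 1) / n ! * (K * M ^ n) := by
          gcongr
          exact ha n
      _ = _ := by ring
  · exact ⟨by rw [hR]; linarith [neg_abs_le z], by rw [hR]; linarith [le_abs_self z]⟩
  · exact summable_egf ha z
  · exact ⟨by rw [hR]; linarith [neg_abs_le z], by rw [hR]; linarith [le_abs_self z]⟩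

lemma le_of_hasDerivAt_le {f g f' g' : ℝ → ℝ} (hf : ∀ x, HasDerivAt f (f' x) x)
    (hg : ∀ x, HasDerivAt g (g' x) x) (h0 : f 0 ≤ g 0) (h : ∀ x ∈ Set.Icc (0:ℝ) 1, f' x ≤ g' x)
    {x : ℝ} (hx : x ∈ Set.Icc (0:ℝ) 1) : f x ≤ g x :=
  image_le_of_deriv_right_le_deriv_boundary (a := 0) (b := 1)
    (fun x _ => (hf x).continuousAt.continuousWithinAt) (fun x _ => (hf x).hasDerivWithinAt) h0
    (fun x _ => (hg x).continuousAt.continuousWithinAt) (fun x _ => (hg x).hasDerivWithinAt)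
    (fun x hx => h x ⟨hx.1, hx.2.le⟩) hx

lemma bonferroni_one {a : ℕ → ℝ} {K M : ℝ} (ha : ∀ n, |a n| ≤ K * M ^ n)
    (hle : ∀ k, ∀ z ∈ Set.Icc (0:ℝ) 1, egf (fun n => a (n + k)) z ≤ a k) (k : ℕ) {z : ℝ} (hz : z ∈ Set.Icc (0:ℝ) 1) :
    a k - z * a (k + 1) ≤ egf (fun n => a (n + k)) z := by
  have ha' : ∀ n, |a (n + k)| ≤ (K * M ^ k) * M ^ n := fun n => (ha (n + k)).trans_eq (by ring)
  refine le_of_hasDerivAt_le (f := fun z => a k - z * a (k + 1))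
    (f' := fun _ => -a (k + 1)) ?_ (hasDerivAt_egf ha') ?_ ?_ hz
  · intro x
    simpa using ((hasDerivAt_id x).mul_const (a (k + 1))).const_sub (a k)
  · simp [egf_zero]
  · intro x hx
    have := hle (k + 1) x hx
    simp only [add_right_comm _ 1 k, ← add_assoc] at this ⊢
    linarith

lemma bonferroni_two {a : ℕ → ℝ} {K M : ℝ} (ha : ∀ n, |a n| ≤ K * M ^ n)
    (hle : ∀ k, ∀ z ∈ Set.Icc (0:ℝ) 1, egf (fun n => a (n + k)) z ≤ a k) (k : ℕ) {z : ℝ} (hz : z ∈ Set.Icc (0:ℝ) 1) :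
    egf (fun n => a (n + k)) z ≤ a k - z * a (k + 1) + z ^ 2 / 2 * a (k + 2) := by
  have ha' : ∀ n, |a (n + k)| ≤ (K * M ^ k) * M ^ n := fun n => (ha (n + k)).trans_eq (by ring)
  refine le_of_hasDerivAt_le (g := fun z => a k - z * a (k + 1) + z ^ 2 / 2 * a (k + 2))
    (g' := fun z => -a (k + 1) + z * a (k + 2)) (hasDerivAt_egf ha') ?_ ?_ ?_ hz
  · intro x
    have h1 := ((hasDerivAt_id x).mul_const (a (k + 1))).const_sub (a k)
    have h2 := (((hasDerivAt_id x).pow 2).div_const 2).mul_const (a (k + 2))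
    convert! h1.add h2 using 1
    simp
  · simp [egf_zero]
  · intro x hx
    have := bonferroni_one ha hle (k + 1) hx
    simp only [add_right_comm _ 1 k, ← add_assoc] at this ⊢
    linarith

lemma bonferroni_three {a : ℕ → ℝ} {K M : ℝ} (ha : ∀ n, |a n| ≤ K * M ^ n)
    (hle : ∀ k, ∀ z ∈ Set.Icc (0:ℝ) 1, egf (fun n => a (n + k)) z ≤ a k) (k : ℕ) {z : ℝ} (hz : z ∈ Set.Icc (0:ℝ) 1) :
    a k - z * a (k + 1) + z ^ 2 / 2 * a (k + 2) - z ^ 3 / 6 * a (k + 3) ≤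
      egf (fun n => a (n + k)) z := by
  have ha' : ∀ n, |a (n + k)| ≤ (K * M ^ k) * M ^ n := fun n => (ha (n + k)).trans_eq (by ring)
  refine le_of_hasDerivAt_le
    (f := fun z => a k - z * a (k + 1) + z ^ 2 / 2 * a (k + 2) - z ^ 3 / 6 * a (k + 3))
    (f' := fun z => -a (k + 1) + z * a (k + 2) - z ^ 2 / 2 * a (k + 3)) ?_ (hasDerivAt_egf ha')
    ?_ ?_ hz
  · intro x
    have h1 := ((hasDerivAt_id x).mul_const (a (k + 1))).const_sub (a k)
    have h2 := (((hasDerivAt_id x).pow 2).div_const 2).mul_const (a (k + 2))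
    have h3 := (((hasDerivAt_id x).pow 3).div_const 6).mul_const (a (k + 3))
    convert! (h1.add h2).sub h3 using 1
    simp only [id, Nat.cast_ofNat]
    ring_nf
  · simp [egf_zero]
  · intro x hx
    have := bonferroni_two ha hle (k + 1) hx
    simp only [add_right_comm _ 1 k, ← add_assoc] at this ⊢
    linarith

/-- `σ` solves the scaled convolution equation for `χ` on `(0, B]`, with `χ = 1` and `σ = 1` on
`[0, τ]`. -/
structure IsSol (τ B : ℝ) (χ σ : ℝ → ℝ) : Prop where
  pos : 0 < τ
  le : τ ≤ B
  meas_chi : Measurable χ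
  abs_chi : ∀ t ∈ Set.Ioc 0 B, |χ t| ≤ 1
  meas : Measurable σ
  int : IntervalIntegrable σ volume 0 B
  one : ∀ x ∈ Set.Icc 0 τ, σ x = 1
  eqn : ∀ x, 0 < x → x ≤ B → x * σ x = ∫ t in (0:ℝ)..x, σ (x - t) * χ t

lemma intervalIntegrable_of_le {f : ℝ → ℝ} {b c : ℝ} (hf : IntervalIntegrable f volume 0 b)
    (hc : 0 ≤ c) (hcb : c ≤ b) : IntervalIntegrable f volume 0 c :=
  hf.mono_set (by
    rw [Set.uIcc_of_le (hc.trans hcb), Set.uIcc_of_le hc]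
    exact Set.Icc_subset_Icc_right hcb)

lemma intervalIntegrable_comp_sub {f : ℝ → ℝ} {x : ℝ} (hf : IntervalIntegrable f volume 0 x) :
    IntervalIntegrable (fun t => f (x - t)) volume 0 x := by
  simpa using (hf.comp_sub_left x).symm

lemma intervalIntegrable_mul_bdd {f χ : ℝ → ℝ} {x : ℝ} (hx : 0 ≤ x)
    (hf : IntervalIntegrable f volume 0 x) (hχ : Measurable χ) (hb : ∀ t ∈ Set.Ioc 0 x, |χ t| ≤ 1) :
    IntervalIntegrable (fun t => f t * χ t) volume 0 x := by
  rw [intervalIntegrable_iff_integrableOn_Ioc_of_le hx] at hf ⊢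
  refine Integrable.mul_bdd (c := 1) hf hχ.aestronglyMeasurable ?_
  exact (ae_restrict_iff' measurableSet_Ioc).2 (Filter.Eventually.of_forall fun t ht => hb t ht)

lemma abs_integral_conv_le {f χ : ℝ → ℝ} {x : ℝ} (hx : 0 ≤ x)
    (hf : IntervalIntegrable f volume 0 x) (hb : ∀ t ∈ Set.Ioc 0 x, |χ t| ≤ 1) :
    |∫ t in (0:ℝ)..x, f (x - t) * χ t| ≤ ∫ t in (0:ℝ)..x, |f t| := by
  have h1 : ∫ t in (0:ℝ)..x, |f t| = ∫ t in (0:ℝ)..x, |f (x - t)| := by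
    rw [intervalIntegral.integral_comp_sub_left (fun t => |f t|) x]; simp
  rw [h1]
  show ‖∫ t in (0:ℝ)..x, f (x - t) * χ t‖ ≤ _
  refine intervalIntegral.norm_integral_le_of_norm_le hx ?_ (intervalIntegrable_comp_sub hf).abs
  refine Filter.Eventually.of_forall fun t ht => ?_
  rw [norm_mul, Real.norm_eq_abs, Real.norm_eq_abs]
  exact mul_le_of_le_one_right (abs_nonneg _) (hb t ht)

lemma le_of_average_le {f : ℝ → ℝ} {a b C : ℝ} (ha : 0 < a) (hf : IntervalIntegrable f volume 0 b)
    (h : ∀ u ∈ Set.Icc a b, u * f u ≤ ∫ t in (0:ℝ)..u, f t) (hC : ∀ x ∈ Set.Icc 0 a, f x ≤ C)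
    {x : ℝ} (hx : 0 ≤ x) (hxb : x ≤ b) : f x ≤ C := by
  rcases le_total x a with h1 | h1
  · exact hC x ⟨hx, h1⟩
  · have h2 := average_antitone ha hf h le_rfl h1 hxb
    have h3 : ∫ t in (0:ℝ)..a, f t ≤ ∫ t in (0:ℝ)..a, C :=
      intervalIntegral.integral_mono_on ha.le
        (intervalIntegrable_of_le hf ha.le (h1.trans hxb)) (by simp) hC
    simp only [intervalIntegral.integral_const, sub_zero, smul_eq_mul] at h3
    have h4 := h x ⟨h1, hxb⟩
    have h5 : a * (x * f x) ≤ x * (a * C) :=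
      (mul_le_mul_of_nonneg_left h4 ha.le).trans
        (h2.trans (mul_le_mul_of_nonneg_left h3 (ha.le.trans h1)))
    have h6 : 0 < a * x := mul_pos ha (ha.trans_le h1)
    nlinarith

namespace IsSol

variable {τ B : ℝ} {χ σ σ' : ℝ → ℝ}

lemma mul_abs_le (h : IsSol τ B χ σ) {x : ℝ} (hx : 0 ≤ x) (hxB : x ≤ B) :
    x * |σ x| ≤ ∫ t in (0:ℝ)..x, |σ t| := by
  rcases hx.eq_or_lt with rfl | hx0
  · simp
  rw [← abs_of_pos hx0, ← abs_mul, abs_of_pos hx0, h.eqn x hx0 hxB]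
  exact abs_integral_conv_le hx (intervalIntegrable_of_le h.int hx hxB)
    fun t ht => h.abs_chi t ⟨ht.1, ht.2.trans hxB⟩

lemma abs_le_one (h : IsSol τ B χ σ) {x : ℝ} (hx : 0 ≤ x) (hxB : x ≤ B) : |σ x| ≤ 1 :=
  le_of_average_le (f := fun x => |σ x|) h.pos h.int.abs
    (fun u hu => h.mul_abs_le (h.pos.le.trans hu.1) hu.2)
    (fun x hx => by simp [h.one x hx]) hx hxB

lemma unique (h : IsSol τ B χ σ) (h' : IsSol τ B χ σ') {x : ℝ} (hx : 0 ≤ x) (hxB : x ≤ B) :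
    σ x = σ' x := by
  have h1 : |σ x - σ' x| ≤ 0 := by
    refine le_of_average_le (f := fun x => |σ x - σ' x|) h.pos (h.int.sub h'.int).abs ?_ ?_ hx hxB
    · intro u hu
      have hu0 : 0 < u := h.pos.trans_le hu.1
      have hu1 := hu.2
      have e : u * (σ u - σ' u) = ∫ t in (0:ℝ)..u, (σ (u - t) - σ' (u - t)) * χ t := by
        rw [mul_sub, h.eqn u hu0 hu1, h'.eqn u hu0 hu1, ← intervalIntegral.integral_sub]
        · simp_rw [sub_mul]
        · exact intervalIntegrable_mul_bdd hu0.le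
            (intervalIntegrable_comp_sub (intervalIntegrable_of_le h.int hu0.le hu1)) h.meas_chi
            fun t ht => h.abs_chi t ⟨ht.1, ht.2.trans hu1⟩
        · exact intervalIntegrable_mul_bdd hu0.le
            (intervalIntegrable_comp_sub (intervalIntegrable_of_le h'.int hu0.le hu1)) h.meas_chi
            fun t ht => h.abs_chi t ⟨ht.1, ht.2.trans hu1⟩
      show u * |σ u - σ' u| ≤ _
      rw [← abs_of_pos hu0, ← abs_mul, abs_of_pos hu0, e]
      exact abs_integral_conv_le (f := fun t => σ t - σ' t) hu0.le
        (intervalIntegrable_of_le (h.int.sub h'.int) hu0.le hu1)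
        fun t ht => h.abs_chi t ⟨ht.1, ht.2.trans hu1⟩
    · intro y hy
      simp [h.one y hy, h'.one y hy]
  have := abs_nonpos_iff.1 h1
  linarith

end IsSol

/-- Iterated convolutions of `g` with the Heaviside function. -/
noncomputable def iter (g : ℝ → ℝ) : ℕ → ℝ → ℝ
  | 0 => heav
  | n + 1 => cv g (iter g n)

lemma isBddMeas_iter {g : ℝ → ℝ} (hg : IsKernel g) (n : ℕ) : IsBddMeas (iter g n) := by
  induction n with
  | zero => exact isBddMeas_heav
  | succ n ih => exact ih.cv hg

lemma iter_nonneg {g : ℝ → ℝ} (hg0 : ∀ t, 0 ≤ g t) (n : ℕ) (x : ℝ) : 0 ≤ iter g n x := by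
  induction n generalizing x with
  | zero => exact heav_nonneg x
  | succ n ih => exact cv_nonneg hg0 ih x

lemma abs_iter_le {g : ℝ → ℝ} (hg : IsKernel g) (n : ℕ) (x : ℝ) :
    |iter g n x| ≤ (∫ t, |g t|) ^ n := by
  induction n generalizing x with
  | zero => simpa [iter, abs_of_nonneg (heav_nonneg x)] using heav_le_one x
  | succ n ih => exact (abs_cv_le hg ih x).trans_eq (by ring)

lemma iter_of_neg {g : ℝ → ℝ} (hg : ∀ t ≤ 0, g t = 0) (n : ℕ) {x : ℝ} (hx : x < 0) :
    iter g n x = 0 := by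
  induction n generalizing x with
  | zero => exact heav_of_neg hx
  | succ n ih => exact cv_eq_zero (a := 0) (b := 0) hg (fun y hy => ih hy) (by linarith)

/-- A nonnegative kernel supported in `(τ, B]` with `t * g t ≤ 2`. -/
structure IsGap (τ B : ℝ) (g : ℝ → ℝ) : Prop where
  pos : 0 < τ
  le : τ ≤ B
  meas : Measurable g
  nonneg : ∀ t, 0 ≤ g t
  mul_le : ∀ t, t * g t ≤ 2
  left : ∀ t ≤ τ, g t = 0
  right : ∀ t, B < t → g t = 0

namespace IsGap

variable {τ B : ℝ} {g : ℝ → ℝ}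

lemma left_zero (h : IsGap τ B g) (t : ℝ) (ht : t ≤ 0) : g t = 0 := h.left t (ht.trans h.pos.le)

lemma le_div (h : IsGap τ B g) (t : ℝ) : g t ≤ 2 / τ := by
  rcases le_or_gt t τ with ht | ht
  · rw [h.left t ht]; have := h.pos; positivity
  · rw [le_div_iff₀ h.pos]
    nlinarith [h.mul_le t, h.nonneg t]

lemma isKernel (h : IsGap τ B g) : IsKernel g := by
  refine ⟨h.meas, ?_⟩
  have h1 : IntegrableOn g (Set.Icc τ B) := by
    refine Measure.integrableOn_of_bounded (M := 2 / τ) (by simp) h.meas.aestronglyMeasurable ?_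
    exact Filter.Eventually.of_forall fun t => by
      rw [Real.norm_eq_abs, abs_of_nonneg (h.nonneg t)]; exact h.le_div t
  refine (integrableOn_iff_integrable_of_support_subset ?_).1 h1
  intro t ht
  constructor
  · by_contra! h2; exact ht (h.left t h2.le)
  · by_contra! h2; exact ht (h.right t h2)

lemma isKernel_mul (h : IsGap τ B g) : IsKernel fun t => t * g t := by
  refine ⟨measurable_id.mul h.meas, ?_⟩
  refine (h.isKernel.2.const_mul B).mono' (measurable_id.mul h.meas).aestronglyMeasurable ?_
  refine Filter.Eventually.of_forall fun t => ?_
  rcases le_or_gt t τ with ht | ht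
  · simp [h.left t ht]
  · rcases le_or_gt t B with ht' | ht'
    · have h0 : 0 ≤ t := (h.pos.trans ht).le
      rw [norm_mul, Real.norm_eq_abs, Real.norm_eq_abs, abs_of_nonneg h0, abs_of_nonneg (h.nonneg t)]
      exact mul_le_mul_of_nonneg_right ht' (h.nonneg t)
    · simp [h.right t ht']

end IsGap

/-- The indicator of `(0, B]`. -/
noncomputable def box (B : ℝ) : ℝ → ℝ := Set.indicator (Set.Ioc 0 B) 1

lemma isKernel_box (B : ℝ) : IsKernel (box B) :=
  ⟨measurable_one.indicator measurableSet_Ioc,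
    (integrable_indicator_iff measurableSet_Ioc).2 (by
      show IntegrableOn (fun _ => (1:ℝ)) _ _
      simp)⟩

lemma cv_box {B u : ℝ} (h : ℝ → ℝ) (hh : ∀ x < 0, h x = 0) (hu : 0 ≤ u) (huB : u ≤ B) :
    cv (box B) h u = ∫ t in (0:ℝ)..u, h t := by
  have h1 : ∫ t in (0:ℝ)..u, h t = ∫ t in (0:ℝ)..u, h (u - t) := by
    rw [intervalIntegral.integral_comp_sub_left h u]; simp
  rw [h1, intervalIntegral.integral_of_le hu, ← integral_indicator measurableSet_Ioc]
  unfold cv box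
  congr 1; ext t
  by_cases h2 : t ∈ Set.Ioc 0 u
  · have h3 : t ∈ Set.Ioc 0 B := ⟨h2.1, h2.2.trans huB⟩
    simp [h2, h3]
  · rw [Set.indicator_of_notMem h2]
    by_cases h3 : t ∈ Set.Ioc 0 B
    · have : u < t := by
        by_contra! h4; exact h2 ⟨h3.1, h4⟩
      rw [hh _ (by linarith), mul_zero]
    · simp [h3]

lemma mul_iter {τ B : ℝ} {g : ℝ → ℝ} (h : IsGap τ B g) (n : ℕ) {u : ℝ} (huB : u ≤ B) :
    u * iter g n u = cv (box B) (iter g n) u + n * cv (fun t => t * g t) (iter g (n - 1)) u := by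
  induction n generalizing u with
  | zero =>
    rcases lt_or_ge u 0 with hu | hu
    · simp only [iter, heav_of_neg hu, CharP.cast_eq_zero, zero_mul, add_zero, mul_zero]
      refine (cv_eq_zero (a := 0) (b := 0) ?_ (fun x hx => heav_of_neg hx) (by linarith)).symm
      intro t ht
      simp [box, ht]
    · rw [cv_box _ (fun x hx => iter_of_neg h.left_zero 0 hx) hu huB]
      simp only [iter, heav_of_nonneg hu, CharP.cast_eq_zero, zero_mul, add_zero, mul_one]
      rw [intervalIntegral.integral_congr (g := fun _ => (1:ℝ))]
      · simp
      · intro t ht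
        rw [Set.uIcc_of_le hu] at ht
        exact heav_of_nonneg ht.1
  | succ n ih =>
    have hk := h.isKernel
    have hm := h.isKernel_mul
    have hJ := isKernel_box B
    have hI := isBddMeas_iter hk
    set W : ℝ → ℝ := cv (box B) (iter g n) + fun x => n * cv (fun t => t * g t) (iter g (n - 1)) x
      with hW
    have hWb : IsBddMeas W := ((hI n).cv hJ).add (((hI (n - 1)).cv hm).const_mul n)
    have h1 : u * iter g (n + 1) u = cv (fun t => t * g t) (iter g n) u + cv g W u := by
      simp only [iter]
      unfold cv
      rw [← integral_const_mul,
        ← integral_add (cv_integrable hm (hI n) u) (cv_integrable hk hWb u)]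
      congr 1; ext t
      rcases le_or_gt t 0 with ht | ht
      · simp [h.left_zero t ht]
      · have := ih (u := u - t) (by linarith)
        simp only [hW, Pi.add_apply]
        rw [← this]; ring
    rw [h1, hW, cv_add_right hk ((hI n).cv hJ) (((hI (n - 1)).cv hm).const_mul n), cv_const_mul,
      cv_comm hk hJ (hI n), cv_comm hk hm (hI (n - 1))]
    simp only [Nat.cast_add, Nat.cast_one, add_tsub_cancel_right]
    have h2 : (n:ℝ) * cv (fun t => t * g t) (cv g (iter g (n - 1))) u =
        n * cv (fun t => t * g t) (iter g n) u := by
      cases n with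
      | zero => simp
      | succ n => simp [iter]
    rw [h2]
    simp only [iter]
    ring

/-- The series solution `∑ (-z)^n / n! I_{n + k}`. -/
noncomputable def ser (g : ℝ → ℝ) (z : ℝ) (k : ℕ) (x : ℝ) : ℝ := egf (fun n => iter g (n + k) x) z

section Ser

open Nat

variable {τ B : ℝ} {g : ℝ → ℝ}

lemma ser_bound (hg : IsKernel g) (z : ℝ) (k n : ℕ) (x : ℝ) :
    |(-z) ^ n / n ! * iter g (n + k) x| ≤
      (∫ t, |g t|) ^ k * ((|z| * ∫ t, |g t|) ^ n / n !) := by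
  rw [abs_mul, abs_div, abs_pow, abs_neg, abs_of_nonneg (by positivity : (0:ℝ) ≤ n !), mul_pow]
  calc |z| ^ n / n ! * |iter g (n + k) x| ≤ |z| ^ n / n ! * (∫ t, |g t|) ^ (n + k) := by
        gcongr; exact abs_iter_le hg _ _
    _ = _ := by rw [pow_add]; ring

lemma isBddMeas_ser (hg : IsKernel g) (z : ℝ) (k : ℕ) : IsBddMeas (ser g z k) := by
  refine ⟨?_, ∑' n : ℕ, (∫ t, |g t|) ^ k * ((|z| * ∫ t, |g t|) ^ n / n !), fun x => ?_⟩
  · exact Measurable.tsum fun n => (isBddMeas_iter hg (n + k)).1.const_mul _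
  · exact tsum_of_norm_bounded (f := fun n : ℕ => (-z) ^ n / n ! * iter g (n + k) x)
      ((Real.summable_pow_div_factorial _).mul_left _).hasSum (fun n => ser_bound hg z k n x)

lemma hasSum_cv_ser (hg : IsKernel g) {f : ℝ → ℝ} (hf : IsKernel f) (z : ℝ) (k : ℕ) (u : ℝ) :
    HasSum (fun n => (-z) ^ n / n ! * cv f (iter g (n + k)) u) (cv f (ser g z k) u) := by
  have := cv_tsum hf (h := fun n x => (-z) ^ n / n ! * iter g (n + k) x)
    (fun n => (isBddMeas_iter hg (n + k)).1.const_mul _)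
    ((Real.summable_pow_div_factorial (|z| * ∫ t, |g t|)).mul_left ((∫ t, |g t|) ^ k))
    (fun n x => ser_bound hg z k n x) u
  simp_rw [cv_const_mul] at this
  exact this

lemma ser_succ (hg : IsKernel g) (z : ℝ) (k : ℕ) (u : ℝ) :
    ser g z (k + 1) u = cv g (ser g z k) u :=
  (hasSum_cv_ser hg hg z k u).tsum_eq

lemma ser_of_neg (h : IsGap τ B g) (z : ℝ) (k : ℕ) {x : ℝ} (hx : x < 0) : ser g z k x = 0 := by
  simp [ser, egf, iter_of_neg h.left_zero _ hx]

lemma mul_ser (h : IsGap τ B g) (z : ℝ) {u : ℝ} (huB : u ≤ B) :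
    u * ser g z 0 u = cv (box B) (ser g z 0) u - z * cv (fun t => t * g t) (ser g z 0) u := by
  have hk := h.isKernel
  have h1 := hasSum_cv_ser hk (isKernel_box B) z 0 u
  have h2 := hasSum_cv_ser hk h.isKernel_mul z 0 u
  have h3 : HasSum (fun n : ℕ => (-z) ^ n / n ! * (n * cv (fun t => t * g t) (iter g (n - 1)) u))
      (-z * cv (fun t => t * g t) (ser g z 0) u) := by
    rw [← hasSum_nat_add_iff' 1]
    simp only [Finset.range_one, Finset.sum_singleton, CharP.cast_eq_zero, zero_mul, mul_zero,
      sub_zero]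
    refine (h2.mul_left (-z)).congr_fun fun n => ?_
    simp only [Nat.factorial_succ, Nat.cast_mul, add_tsub_cancel_right, add_zero]
    have h1 : (n ! : ℝ) ≠ 0 := by positivity
    have h2 : ((n + 1 : ℕ) : ℝ) ≠ 0 := by positivity
    field_simp
    ring
  have h4 := h1.add h3
  have h5 : u * ser g z 0 u = ∑' n : ℕ, u * ((-z) ^ n / n ! * iter g (n + 0) u) := by
    rw [tsum_mul_left]; rfl
  rw [h5, sub_eq_add_neg, ← neg_mul, ← h4.tsum_eq]
  congr 1; ext n
  have := mul_iter h n huB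
  simp only [add_zero]
  rw [mul_left_comm, this]; ring

lemma ser_eq_one (h : IsGap τ B g) (z : ℝ) {x : ℝ} (hx : x ∈ Set.Icc 0 τ) : ser g z 0 x = 1 := by
  unfold ser egf
  rw [tsum_eq_single 0]
  · simp [iter, heav_of_nonneg hx.1]
  · intro n hn
    obtain ⟨m, rfl⟩ := Nat.exists_eq_succ_of_ne_zero hn
    have : iter g (m.succ + 0) x = 0 :=
      cv_eq_zero (a := 0) (b := τ) h.left (fun y hy => iter_of_neg h.left_zero m hy)
        (by linarith [hx.2])
    simp only
    rw [this, mul_zero]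

lemma isSol_ser (h : IsGap τ B g) {z : ℝ} (hz : z ∈ Set.Icc (0:ℝ) 1) :
    IsSol τ B (fun t => 1 - z * (t * g t)) (ser g z 0) where
  pos := h.pos
  le := h.le
  meas_chi := measurable_const.sub ((measurable_id.mul h.meas).const_mul z)
  abs_chi := fun t ht => by
    have h1 : 0 ≤ t * g t := mul_nonneg ht.1.le (h.nonneg t)
    have h2 := h.mul_le t
    rw [abs_le]
    constructor <;> nlinarith [hz.1, hz.2]
  meas := (isBddMeas_ser h.isKernel z 0).1
  int := by
    obtain ⟨h1, C, hC⟩ := isBddMeas_ser h.isKernel z 0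
    rw [intervalIntegrable_iff]
    exact Measure.integrableOn_of_bounded (M := C) (by simp)
      h1.aestronglyMeasurable (Filter.Eventually.of_forall hC)
  one := fun x hx => ser_eq_one h z hx
  eqn := fun x hx hxB => by
    have hk := h.isKernel
    have hs := isBddMeas_ser hk z 0
    rw [mul_ser h z hxB, intervalIntegral.integral_of_le hx.le, ← integral_indicator measurableSet_Ioc]
    unfold cv
    rw [← integral_const_mul, ← integral_sub (cv_integrable (isKernel_box B) hs x)
      ((cv_integrable h.isKernel_mul hs x).const_mul z)]
    congr 1; ext t
    by_cases h2 : t ∈ Set.Ioc 0 x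
    · have h3 : t ∈ Set.Ioc 0 B := ⟨h2.1, h2.2.trans hxB⟩
      simp only [box, h2, h3, Set.indicator_of_mem, Pi.one_apply]
      ring
    · rw [Set.indicator_of_notMem h2]
      rcases le_or_gt t 0 with h3 | h3
      · have : t ∉ Set.Ioc 0 B := fun h4 => absurd h4.1 (not_lt.2 h3)
        simp [box, this, h.left_zero t h3]
      · have : x < t := by
          by_contra! h4; exact h2 ⟨h3, h4⟩
        rw [ser_of_neg h z 0 (by linarith)]
        simp

lemma ser_le (h : IsGap τ B g) {z : ℝ} (hz : z ∈ Set.Icc (0:ℝ) 1) (k : ℕ) {x : ℝ}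
    (hx : x ≤ B) : ser g z k x ≤ iter g k x := by
  induction k generalizing x with
  | zero =>
    rcases lt_or_ge x 0 with h1 | h1
    · rw [ser_of_neg h z 0 h1]; exact iter_nonneg h.nonneg 0 x
    · exact ((le_abs_self _).trans ((isSol_ser h hz).abs_le_one h1 hx)).trans_eq
        (heav_of_nonneg h1).symm
  | succ k ih =>
    rw [ser_succ h.isKernel]
    refine cv_le_cv h.isKernel h.isKernel (isBddMeas_ser h.isKernel z k)
      (isBddMeas_iter h.isKernel k) fun t => ?_
    rcases le_or_gt t 0 with h1 | h1
    · simp [h.left_zero t h1]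
    · exact mul_le_mul_of_nonneg_left (ih (by linarith)) (h.nonneg t)

end Ser

section Sol

variable {τ B : ℝ} {g χ σ : ℝ → ℝ}

lemma sol_eq_ser (h : IsGap τ B g) (hs : IsSol τ B χ σ)
    (hχ : ∀ t ∈ Set.Ioc 0 B, χ t = 1 - t * g t) {x : ℝ} (hx : 0 ≤ x) (hxB : x ≤ B) :
    σ x = ser g 1 0 x := by
  refine IsSol.unique (τ := τ) (B := B) (χ := χ) hs ?_ hx hxB
  have h1 := isSol_ser h (z := 1) (by simp)
  exact ⟨h1.pos, h1.le, hs.meas_chi, hs.abs_chi, h1.meas, h1.int, h1.one, fun x hx hxB => by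
    rw [h1.eqn x hx hxB]
    refine intervalIntegral.integral_congr_ae (Filter.Eventually.of_forall fun t ht => ?_)
    rw [Set.uIoc_of_le hx.le] at ht
    rw [hχ t ⟨ht.1, ht.2.trans hxB⟩, one_mul]⟩

lemma sol_bounds (h : IsGap τ B g) (hs : IsSol τ B χ σ)
    (hχ : ∀ t ∈ Set.Ioc 0 B, χ t = 1 - t * g t) {x : ℝ} (hx : 0 ≤ x) (hxB : x ≤ B) :
    1 - iter g 1 x ≤ σ x ∧ σ x ≤ 1 - iter g 1 x + iter g 2 x / 2 ∧
      1 - iter g 1 x + iter g 2 x / 2 - iter g 3 x / 6 ≤ σ x := by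
  have ha : ∀ n, |iter g n x| ≤ 1 * (∫ t, |g t|) ^ n := fun n => by
    rw [one_mul]; exact abs_iter_le h.isKernel n x
  have hle : ∀ k, ∀ z ∈ Set.Icc (0:ℝ) 1, egf (fun n => iter g (n + k) x) z ≤ iter g k x :=
    fun k z hz => ser_le h hz k hxB
  have h1 : (1:ℝ) ∈ Set.Icc (0:ℝ) 1 := by simp
  have e : iter g 0 x = 1 := heav_of_nonneg hx
  have b1 := bonferroni_one ha hle 0 h1
  have b2 := bonferroni_two ha hle 0 h1
  have b3 := bonferroni_three ha hle 0 h1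
  rw [sol_eq_ser h hs hχ hx hxB, ser]
  simp only [zero_add, e, one_mul, one_pow] at b1 b2 b3
  refine ⟨b1, ?_, ?_⟩ <;> linarith

end Sol

/-- The constant `√e`. -/
noncomputable def rE : ℝ := Real.sqrt (Real.exp 1)

/-- The constant `1 + √e`. -/
noncomputable def uS : ℝ := 1 + rE

lemma rE_lo : 1.648 < rE := by
  rw [rE, Real.lt_sqrt (by norm_num)]
  have := Real.exp_one_gt_d9; norm_num at *; linarith

lemma rE_hi : rE < 1.649 := by
  rw [rE, Real.sqrt_lt' (by norm_num)]
  have := Real.exp_one_lt_d9; norm_num at *; linarith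

lemma rE_pos : 0 < rE := by linarith [rE_lo]

lemma log_rE : Real.log rE = 1 / 2 := by
  rw [rE, Real.log_sqrt (Real.exp_pos 1).le, Real.log_exp]

lemma uS_lo : 2.648 < uS := by rw [uS]; linarith [rE_lo]

lemma uS_hi : uS < 2.649 := by rw [uS]; linarith [rE_hi]

lemma log_div_rE {v : ℝ} (hv : 0 < v) : Real.log (v / rE) = Real.log v - 1 / 2 := by
  rw [Real.log_div hv.ne' rE_pos.ne', log_rE]

lemma log_le_half_of_le_rE {v : ℝ} (h0 : 0 < v) (hv : v ≤ rE) : Real.log v ≤ 1 / 2 := by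
  rw [← log_rE]; exact Real.log_le_log h0 hv

/-- `4 ∫_1^{v-1} log t / (t + 1) dt`. -/
noncomputable def pExt (v : ℝ) : ℝ := 4 * ∫ t in (1:ℝ)..(v - 1), Real.log t / (t + 1)

/-- The absolute value of the extremal solution beyond `√e`. -/
noncomputable def rho (v : ℝ) : ℝ := 2 * Real.log v - 1 - pExt v

lemma delta1_eq : delta1 = -rho uS := by
  have : uS - 1 = Real.sqrt (Real.exp 1) := by rw [uS, rE]; ring
  rw [delta1, rho, pExt, this, uS, rE]; ring

lemma pExt_two : pExt 2 = 0 := by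
  rw [pExt, show (2:ℝ) - 1 = 1 by norm_num]; simp

lemma hasDerivAt_pExt {v : ℝ} (hv : 1 < v) : HasDerivAt pExt (4 * Real.log (v - 1) / v) v := by
  have hc : ContinuousOn (fun t : ℝ => Real.log t / (t + 1)) (Set.Ioi 0) := by
    refine ContinuousOn.div (Real.continuousOn_log.mono fun x hx => (ne_of_gt hx))
      (by fun_prop) fun x hx => ?_
    have : (0:ℝ) < x := hx
    positivity
  have h1 : HasDerivAt (fun w => ∫ t in (1:ℝ)..w, Real.log t / (t + 1))
      (Real.log (v - 1) / (v - 1 + 1)) (v - 1) := by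
    have hv1 : (0:ℝ) < v - 1 := by linarith
    refine intervalIntegral.integral_hasDerivAt_right ?_ ?_ ?_
    · refine (hc.mono fun x hx => ?_).intervalIntegrable
      rcases Set.mem_uIcc.1 hx with h | h
      · exact lt_of_lt_of_le one_pos h.1
      · exact lt_of_lt_of_le hv1 h.1
    · exact hc.stronglyMeasurableAtFilter isOpen_Ioi _ hv1
    · exact hc.continuousAt (Ioi_mem_nhds hv1)
  have h2 := (h1.comp v ((hasDerivAt_id v).sub_const 1)).const_mul 4
  simp only [sub_add_cancel, mul_one] at h2
  rw [mul_div_assoc]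
  exact h2

lemma hasDerivAt_rho {v : ℝ} (hv : 1 < v) :
    HasDerivAt rho ((2 - 4 * Real.log (v - 1)) / v) v := by
  have h1 := (((Real.hasDerivAt_log (by linarith : v ≠ 0)).const_mul 2).sub_const 1).sub
    (hasDerivAt_pExt hv)
  convert! h1 using 1
  field_simp

lemma continuousOn_pExt : ContinuousOn pExt (Set.Ioi 1) := fun _ hv =>
  (hasDerivAt_pExt hv).continuousAt.continuousWithinAt

lemma continuousOn_rho : ContinuousOn rho (Set.Ioi 1) := fun _ hv =>
  (hasDerivAt_rho hv).continuousAt.continuousWithinAt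

lemma pExt_le_sq {v : ℝ} (hv : 2 ≤ v) : pExt v ≤ (v - 2) ^ 2 := by
  refine image_le_of_deriv_right_le_deriv_boundary (a := 2) (b := v) (f := pExt)
    (f' := fun v => 4 * Real.log (v - 1) / v) (B := fun v => (v - 2) ^ 2)
    (B' := fun v => 2 * (v - 2))
    (continuousOn_pExt.mono fun x hx => lt_of_lt_of_le one_lt_two hx.1)
    (fun x hx => (hasDerivAt_pExt (by linarith [hx.1])).hasDerivWithinAt)
    (by simp [pExt_two]) (by fun_prop) ?_ ?_ ⟨hv, le_rfl⟩
  · intro x hx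
    have := ((hasDerivAt_id x).sub_const 2).pow 2
    convert! this.hasDerivWithinAt using 1
    simp
  · intro x hx
    have h1 : 2 ≤ x := hx.1
    rw [div_le_iff₀ (by linarith)]
    have := Real.log_le_sub_one_of_pos (show 0 < x - 1 by linarith)
    nlinarith

lemma log_two_add_ge {x : ℝ} (hx : 0 ≤ x) : 0.6931471 + 2 * x / (x + 4) ≤ Real.log (2 + x) := by
  have h1 := Real.le_log_one_add_of_nonneg (x := x / 2) (by positivity)
  have h2 : Real.log (2 + x) = Real.log 2 + Real.log (1 + x / 2) := by
    rw [← Real.log_mul (by norm_num) (by positivity)]; congr 1; ring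
  have h3 : 2 * (x / 2) / (x / 2 + 2) = 2 * x / (x + 4) := by field_simp; ring
  have := Real.log_two_gt_d9
  rw [h2, ← h3]
  linarith

lemma pExt_le_log {v : ℝ} (hv : 2 ≤ v) (hvS : v ≤ uS) : pExt v ≤ Real.log (v / rE) := by
  rw [log_div_rE (by linarith)]
  have h1 := log_two_add_ge (x := v - 2) (by linarith)
  rw [add_sub_cancel] at h1
  have h2 := pExt_le_sq hv
  have h3 := uS_hi
  have h4 : (v - 2) ^ 2 ≤ 0.1931471 + 2 * (v - 2) / (v - 2 + 4) := by
    rw [← sub_le_iff_le_add', le_div_iff₀ (by linarith)]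
    nlinarith [mul_nonneg (sub_nonneg.2 hv) (sub_nonneg.2 (hvS.trans h3.le))]
  linarith

lemma rho_ge_half {v : ℝ} (hv : 2.2 ≤ v) (hvS : v ≤ uS) : 1 / 2 ≤ rho v := by
  have h1 := log_two_add_ge (x := v - 2) (by linarith)
  rw [add_sub_cancel] at h1
  have h2 := pExt_le_sq (v := v) (by linarith)
  have h3 := uS_hi
  have h4 : (v - 2) ^ 2 + 1.5 - 1.3862942 ≤ 2 * (2 * (v - 2) / (v - 2 + 4)) := by
    rw [← mul_div_assoc, le_div_iff₀ (by linarith)]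
    nlinarith [mul_nonneg (sub_nonneg.2 hv) (sub_nonneg.2 (hvS.trans h3.le))]
  rw [rho]
  linarith

lemma rho_uS_ge : 1 / 2 ≤ rho uS := rho_ge_half (by linarith [uS_lo]) le_rfl

/-- The distance of `rho` to its maximal value. -/
noncomputable def qExt (v : ℝ) : ℝ := rho uS - rho v

lemma qExt_anti {u v : ℝ} (hu : 2 ≤ u) (huv : u ≤ v) (hv : v ≤ uS) : qExt v ≤ qExt u := by
  have : rho u ≤ rho v := by
    refine monotoneOn_of_deriv_nonneg (convex_Icc 2 uS)
      (continuousOn_rho.mono fun x hx => lt_of_lt_of_le one_lt_two hx.1) ?_ ?_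
      ⟨hu, huv.trans hv⟩ ⟨hu.trans huv, hv⟩ huv
    · rw [interior_Icc]
      exact fun x hx =>
        (hasDerivAt_rho (by linarith [hx.1])).differentiableAt.differentiableWithinAt
    · rw [interior_Icc]
      intro x hx
      rw [(hasDerivAt_rho (by linarith [hx.1])).deriv]
      have h1 : Real.log (x - 1) ≤ 1 / 2 :=
        log_le_half_of_le_rE (by linarith [hx.1]) (by have := hx.2; rw [uS] at this; linarith)
      exact div_nonneg (by linarith) (by linarith [hx.1])
  rw [qExt, qExt]; linarith

lemma qExt_ge {v : ℝ} (hv : 2 ≤ v) (hvS : v ≤ uS) : 0.45 * (uS - v) ^ 2 ≤ qExt v := by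
  have hanti : AntitoneOn (fun v => qExt v - 0.45 * (uS - v) ^ 2) (Set.Icc 2 uS) := by
    have hd : ∀ x ∈ Set.Ioo 2 uS, HasDerivAt (fun v => qExt v - 0.45 * (uS - v) ^ 2)
        (-((2 - 4 * Real.log (x - 1)) / x) + 0.9 * (uS - x)) x := by
      intro x hx
      have h1 := (hasDerivAt_rho (v := x) (by linarith [hx.1])).const_sub (rho uS)
      have h2 := ((((hasDerivAt_id x).const_sub uS).pow 2).const_mul 0.45)
      convert! h1.sub h2 using 1
      simp only [id, Nat.cast_ofNat]
      ring
    refine antitoneOn_of_deriv_nonpos (convex_Icc 2 uS) ?_ ?_ ?_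
    · refine ContinuousOn.sub (continuousOn_const.sub
        (continuousOn_rho.mono fun x hx => lt_of_lt_of_le one_lt_two hx.1)) (by fun_prop)
    · rw [interior_Icc]
      exact fun x hx => (hd x hx).differentiableAt.differentiableWithinAt
    · rw [interior_Icc]
      intro x hx
      rw [(hd x hx).deriv]
      have hx1 := hx.1
      have hx2 := hx.2
      have h1 : Real.log (x - 1) ≤ 1 / 2 + ((x - 1) / rE - 1) := by
        have := Real.log_le_sub_one_of_pos (show 0 < (x - 1) / rE from
          div_pos (by linarith) rE_pos)
        rw [log_div_rE (by linarith)] at this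
        linarith
      have h2 : 0.9 * (uS - x) ≤ (2 - 4 * Real.log (x - 1)) / x := by
        rw [le_div_iff₀ (by linarith)]
        have h3 : 4 * (uS - x) / rE ≤ 2 - 4 * Real.log (x - 1) := by
          have : 4 * (uS - x) / rE = 4 - 4 * ((x - 1) / rE) := by
            rw [uS]; field_simp [rE_pos.ne']; ring
          rw [this]; linarith
        refine le_trans ?_ h3
        rw [le_div_iff₀ rE_pos]
        have h4 : x * rE ≤ 2.649 * 1.649 :=
          mul_le_mul (by linarith [uS_hi]) rE_hi.le rE_pos.le (by norm_num)
        nlinarith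
      linarith
  have := hanti ⟨hv, hvS⟩ ⟨hv.trans hvS, le_rfl⟩ hvS
  simp only [qExt, sub_self] at this
  simp only [qExt]
  norm_num at this ⊢
  linarith

lemma integral_log' {a b : ℝ} :
    ∫ t in a..b, Real.log t = b * Real.log b - a * Real.log a - b + a := integral_log

lemma integral_pExt {v : ℝ} (hv : 2 ≤ v) :
    ∫ t in (2:ℝ)..v, pExt t = v * pExt v - 4 * ∫ t in (1:ℝ)..(v - 1), Real.log t := by
  have h0 : ∫ t in (1:ℝ)..(v - 1), Real.log t = ∫ t in (2:ℝ)..v, Real.log (t - 1) := by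
    rw [intervalIntegral.integral_comp_sub_right (fun t => Real.log t) 1]; norm_num
  have hsub : ∀ x ∈ Set.uIcc 2 v, 1 < x := fun x hx => by
    rw [Set.uIcc_of_le hv] at hx; linarith [hx.1]
  have hp : IntervalIntegrable pExt volume 2 v :=
    (continuousOn_pExt.mono hsub).intervalIntegrable
  have hl : IntervalIntegrable (fun t => 4 * Real.log (t - 1)) volume 2 v := by
    refine ContinuousOn.intervalIntegrable (continuousOn_const.mul ?_)
    exact ContinuousOn.log (by fun_prop) fun x hx => by linarith [hsub x hx]
  have h1 := intervalIntegral.integral_eq_sub_of_hasDerivAt (f := fun t => t * pExt t)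
    (f' := fun t => pExt t + 4 * Real.log (t - 1)) (a := 2) (b := v) ?_ (hp.add hl)
  · rw [intervalIntegral.integral_add hp hl, intervalIntegral.integral_const_mul, pExt_two] at h1
    rw [h0]; linarith
  · intro x hx
    have h2 := (hasDerivAt_id x).mul (hasDerivAt_pExt (hsub x hx))
    have h3 : x ≠ 0 := by linarith [hsub x hx]
    convert! h2 using 1
    simp only [id]
    field_simp

lemma integral_rho {v : ℝ} (hv : 2 ≤ v) :
    ∫ t in (2:ℝ)..v, rho t = v * rho v - 2 * v - 4 * Real.log 2 + 6
      + 4 * ∫ t in (1:ℝ)..(v - 1), Real.log t := by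
  have hsub : ∀ x ∈ Set.uIcc 2 v, 1 < x := fun x hx => by
    rw [Set.uIcc_of_le hv] at hx; linarith [hx.1]
  have hp : IntervalIntegrable pExt volume 2 v :=
    (continuousOn_pExt.mono hsub).intervalIntegrable
  have hl : IntervalIntegrable (fun t => 2 * Real.log t) volume 2 v :=
    intervalIntegral.intervalIntegrable_log'.const_mul 2
  simp only [rho]
  rw [intervalIntegral.integral_sub (hl.sub (by simp)) hp, intervalIntegral.integral_sub hl (by simp),
    integral_pExt hv, intervalIntegral.integral_const_mul, integral_log']
  simp only [intervalIntegral.integral_const, smul_eq_mul]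
  ring

lemma integral_two_log :
    ∫ t in rE..2, 2 * Real.log (t / rE) = 4 * Real.log 2 - 6 + 2 * rE := by
  have : ∫ t in rE..2, 2 * Real.log (t / rE) = ∫ t in rE..2, (2 * Real.log t - 1) := by
    refine intervalIntegral.integral_congr fun t ht => ?_
    rw [Set.uIcc_of_le (by linarith [rE_hi])] at ht
    rw [log_div_rE (rE_pos.trans_le ht.1)]; ring
  rw [this, intervalIntegral.integral_sub
    (intervalIntegral.intervalIntegrable_log'.const_mul 2) (by simp),
    intervalIntegral.integral_const_mul, integral_log', log_rE]
  simp only [intervalIntegral.integral_const, smul_eq_mul]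
  ring

lemma total_mass :
    2 * (rE - 1) + (∫ t in rE..2, 2 * Real.log (t / rE)) + ∫ t in (2:ℝ)..uS, rho t = uS * rho uS := by
  rw [integral_two_log, integral_rho (by linarith [uS_lo]), integral_log',
    show uS - 1 = rE by rw [uS]; ring, log_rE, uS]
  simp
  ring

lemma intervalIntegrable_rho {a b : ℝ} (ha : 1 < a) (hb : 1 < b) :
    IntervalIntegrable rho volume a b := by
  refine (continuousOn_rho.mono fun x hx => ?_).intervalIntegrable
  rcases Set.mem_uIcc.1 hx with h | h
  · exact lt_of_lt_of_le ha h.1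
  · exact lt_of_lt_of_le hb h.1

lemma partial_mass_le {u : ℝ} (hu : 2 ≤ u) (huS : u ≤ uS) :
    2 * (rE - 1) + (∫ t in rE..2, 2 * Real.log (t / rE)) + (∫ t in (2:ℝ)..u, rho t) ≤
      u * rho uS + ∫ t in u..uS, qExt t := by
  have h1 := total_mass
  rw [← intervalIntegral.integral_add_adjacent_intervals (b := u)
    (intervalIntegrable_rho (by norm_num) (by linarith))
    (intervalIntegrable_rho (by linarith) (by linarith))] at h1
  have h2 : ∫ t in u..uS, qExt t = (uS - u) * rho uS - ∫ t in u..uS, rho t := by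
    simp only [qExt]
    rw [intervalIntegral.integral_sub (by simp) (intervalIntegrable_rho (by linarith) (by linarith))]
    simp
  rw [h2]; linarith

/-- Coefficient of the quadratic error term. -/
noncomputable def cErr (v : ℝ) : ℝ := 2 * Real.log (v - 1) / 3 + 1 / 6

lemma cErr_mono {u v : ℝ} (hu : 2 ≤ u) (huv : u ≤ v) : cErr u ≤ cErr v := by
  have := Real.log_le_log (show 0 < u - 1 by linarith) (show u - 1 ≤ v - 1 by linarith)
  rw [cErr, cErr]; linarith

lemma cErr_pos {u : ℝ} (hu : 2 ≤ u) : 0 < cErr u := by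
  have := Real.log_nonneg (show 1 ≤ u - 1 by linarith)
  rw [cErr]; linarith

lemma cErr_le_half {u : ℝ} (hu : 2 ≤ u) (huS : u ≤ uS) : cErr u ≤ 1 / 2 := by
  have := log_le_half_of_le_rE (v := u - 1) (by linarith) (by rw [uS] at huS; linarith)
  rw [cErr]; linarith

lemma intervalIntegrable_cErr {a b : ℝ} (ha : 1 < a) (hb : 1 < b) :
    IntervalIntegrable cErr volume a b := by
  refine ContinuousOn.intervalIntegrable ?_
  unfold cErr
  refine ((continuousOn_const.mul (ContinuousOn.log (by fun_prop) fun x hx => ?_)).div_const _).add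
    continuousOn_const
  rcases Set.mem_uIcc.1 hx with h | h <;> linarith [h.1]

lemma integral_cErr : ∫ t in (2:ℝ)..uS, cErr t = (3 - rE) / 6 := by
  have h0 : ∫ t in (2:ℝ)..uS, Real.log (t - 1) = ∫ t in (1:ℝ)..rE, Real.log t := by
    rw [intervalIntegral.integral_comp_sub_right (fun t => Real.log t) 1, uS]; norm_num
  have hl : IntervalIntegrable (fun t : ℝ => Real.log (t - 1)) volume 2 uS :=
    ContinuousOn.intervalIntegrable (ContinuousOn.log (by fun_prop) fun x hx => by
      rw [Set.uIcc_of_le (by linarith [uS_lo])] at hx; linarith [hx.1])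
  simp only [cErr]
  rw [intervalIntegral.integral_add ((hl.const_mul 2).div_const 3) (by simp),
    intervalIntegral.integral_div, intervalIntegral.integral_const_mul, h0, integral_log', log_rE]
  simp only [intervalIntegral.integral_const, smul_eq_mul, Real.log_one, uS]
  ring

/-- The kernel `c / t` on `(a, uS]`. -/
noncomputable def recip (a c : ℝ) : ℝ → ℝ := Set.indicator (Set.Ioc a uS) fun t => c / t

lemma isGap_recip {a c : ℝ} (ha : 1 ≤ a) (hau : a ≤ uS) (hc : 0 ≤ c) (hc2 : c ≤ 2) :
    IsGap a uS (recip a c) where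
  pos := by linarith
  le := hau
  meas := (measurable_const.div measurable_id).indicator measurableSet_Ioc
  nonneg := fun t => Set.indicator_nonneg (fun t ht => div_nonneg hc (by linarith [ht.1])) t
  mul_le := fun t => by
    by_cases h : t ∈ Set.Ioc a uS
    · have : t ≠ 0 := by linarith [h.1]
      rw [recip, Set.indicator_of_mem h, mul_div_cancel₀ _ this]; exact hc2
    · rw [recip, Set.indicator_of_notMem h]; norm_num
  left := fun t ht => Set.indicator_of_notMem (fun h => absurd h.1 (not_lt.2 ht)) _
  right := fun t ht => Set.indicator_of_notMem (fun h => absurd h.2 (not_le.2 ht)) _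

lemma cv_heav {g : ℝ → ℝ} (hg : ∀ t ≤ 0, g t = 0) {x : ℝ} (hx : 0 ≤ x) :
    cv g heav x = ∫ t in (0:ℝ)..x, g t := by
  rw [intervalIntegral.integral_of_le hx, ← integral_indicator measurableSet_Ioc]
  unfold cv
  congr 1; ext t
  by_cases h : t ∈ Set.Ioc 0 x
  · rw [Set.indicator_of_mem h, heav_of_nonneg (by linarith [h.2]), mul_one]
  · rw [Set.indicator_of_notMem h]
    rcases le_or_gt t 0 with h1 | h1
    · rw [hg t h1, zero_mul]
    · rw [heav_of_neg, mul_zero]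
      by_contra! h2; exact h ⟨h1, by linarith⟩

lemma cv_heav_of_le {g : ℝ → ℝ} {τ x : ℝ} (hg : ∀ t ≤ τ, g t = 0) (hx : x ≤ τ) : cv g heav x = 0 :=
  cv_eq_zero (a := 0) (b := τ) hg (fun _ hy => heav_of_neg hy) (by linarith)

lemma cv_recip_heav {a c x : ℝ} (ha : 1 ≤ a) (hax : a ≤ x) (hx : x ≤ uS) :
    cv (recip a c) heav x = c * Real.log (x / a) := by
  have hz : ∀ t ≤ a, recip a c t = 0 := fun t ht =>
    Set.indicator_of_notMem (fun h => absurd h.1 (not_lt.2 ht)) _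
  rw [cv_heav (fun t ht => hz t (by linarith)) (by linarith),
    intervalIntegral.integral_of_le (by linarith)]
  have h1 : ∫ t in Set.Ioc 0 x, recip a c t = ∫ t in Set.Ioc a x, c * (1 / t) := by
    rw [← integral_indicator measurableSet_Ioc, ← integral_indicator measurableSet_Ioc]
    congr 1; ext t
    by_cases h : t ∈ Set.Ioc a x
    · have h2 : t ∈ Set.Ioc 0 x := ⟨by linarith [h.1], h.2⟩
      have h3 : t ∈ Set.Ioc a uS := ⟨h.1, h.2.trans hx⟩
      rw [Set.indicator_of_mem h, Set.indicator_of_mem h2, recip, Set.indicator_of_mem h3]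
      ring
    · rw [Set.indicator_of_notMem h]
      by_cases h2 : t ∈ Set.Ioc 0 x
      · rw [Set.indicator_of_mem h2]
        refine hz t ?_
        by_contra! h3; exact h ⟨h3, h2.2⟩
      · rw [Set.indicator_of_notMem h2]
  rw [h1, ← intervalIntegral.integral_of_le hax, intervalIntegral.integral_const_mul,
    integral_one_div_of_pos (by linarith) (by linarith)]

/-- The extremal kernel. -/
noncomputable def eK : ℝ → ℝ := recip 1 2

lemma isGap_eK : IsGap 1 uS eK := isGap_recip le_rfl (by linarith [uS_lo]) (by norm_num) le_rfl

lemma cv_eK_heav {x : ℝ} (h1 : 1 ≤ x) (hx : x ≤ uS) : cv eK heav x = 2 * Real.log x := by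
  rw [eK, cv_recip_heav le_rfl h1 hx, div_one]

lemma cv_mul_eK {u : ℝ} (hu : 2 ≤ u) (huS : u ≤ uS) :
    cv (fun t => t * eK t) (iter eK 1) u = 4 * ∫ t in (1:ℝ)..(u - 1), Real.log t := by
  have h0 : ∫ t in (1:ℝ)..(u - 1), Real.log t = ∫ t in (1:ℝ)..(u - 1), Real.log (u - t) := by
    rw [intervalIntegral.integral_comp_sub_left (fun t => Real.log t) u]; norm_num
  rw [h0, ← intervalIntegral.integral_const_mul, intervalIntegral.integral_of_le (by linarith),
    ← integral_indicator measurableSet_Ioc]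
  unfold cv
  congr 1; ext t
  by_cases h : t ∈ Set.Ioc 1 (u - 1)
  · have h3 : t ∈ Set.Ioc 1 uS := ⟨h.1, by linarith [h.2]⟩
    have h4 : iter eK 1 (u - t) = 2 * Real.log (u - t) :=
      cv_eK_heav (by linarith [h.2]) (by linarith [h.1])
    have h5 : t ≠ 0 := by linarith [h.1]
    beta_reduce
    rw [Set.indicator_of_mem h, h4, eK, recip, Set.indicator_of_mem h3, mul_div_cancel₀ _ h5]
    ring
  · rw [Set.indicator_of_notMem h]
    rcases le_or_gt t 1 with h1 | h1
    · beta_reduce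
      rw [isGap_eK.left t h1]; ring
    · have h4 : iter eK 1 (u - t) = 0 := by
        refine cv_heav_of_le isGap_eK.left ?_
        by_contra! h5; exact h ⟨h1, by linarith⟩
      rw [h4, mul_zero]

lemma IsBddMeas.intervalIntegrable {f : ℝ → ℝ} (hf : IsBddMeas f) (a b : ℝ) :
    IntervalIntegrable f volume a b := by
  obtain ⟨h1, C, hC⟩ := hf
  rw [intervalIntegrable_iff]
  exact Measure.integrableOn_of_bounded (M := C) (by simp)
    h1.aestronglyMeasurable (Filter.Eventually.of_forall hC)

lemma iter_two_eq_zero {g : ℝ → ℝ} {τ v : ℝ} (hg : ∀ t ≤ τ, g t = 0) (hv : v ≤ τ + τ) :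
    cv g (cv g heav) v = 0 :=
  cv_eq_zero hg (fun _ hx => cv_heav_of_le hg hx.le) hv

lemma cv_eK_two {v : ℝ} (hv : 2 ≤ v) (hvS : v ≤ uS) : cv eK (cv eK heav) v = 2 * pExt v := by
  set f : ℝ → ℝ := fun x => iter eK 2 x - 2 * pExt (max x 2) with hf
  have hI := isBddMeas_iter isGap_eK.isKernel 2
  have hpc : Continuous fun x : ℝ => pExt (max x 2) :=
    continuousOn_pExt.comp_continuous (by fun_prop)
      fun x => lt_of_lt_of_le one_lt_two (le_max_right x 2)
  have hpi : ∀ a b, IntervalIntegrable (fun x : ℝ => 2 * pExt (max x 2)) volume a b := fun a b =>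
    (continuous_const.mul hpc).intervalIntegrable a b
  have hfi : ∀ a b, IntervalIntegrable f volume a b := fun a b =>
    (hI.intervalIntegrable a b).sub (hpi a b)
  have h1 : |f v| ≤ 0 := by
    refine le_of_average_le (f := fun x => |f x|) (a := 2) (b := uS) (by norm_num)
      (hfi 0 uS).abs ?_ ?_ (by linarith) hvS
    · intro u hu
      have hu0 : 0 < u := by linarith [hu.1]
      have h2 := mul_iter isGap_eK 2 hu.2
      have e : u * f u = ∫ t in (0:ℝ)..u, f t := by
        have h3 : ∫ t in (0:ℝ)..u, 2 * pExt (max t 2) = 2 * ∫ t in (2:ℝ)..u, pExt t := by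
          rw [← intervalIntegral.integral_add_adjacent_intervals (hpi 0 2) (hpi 2 u)]
          have h4 : ∫ t in (0:ℝ)..2, 2 * pExt (max t 2) = ∫ t in (0:ℝ)..2, (0:ℝ) := by
            refine intervalIntegral.integral_congr fun t ht => ?_
            rw [Set.uIcc_of_le (by norm_num)] at ht
            simp [max_eq_right ht.2, pExt_two]
          have h5 : ∫ t in (2:ℝ)..u, 2 * pExt (max t 2) = ∫ t in (2:ℝ)..u, 2 * pExt t := by
            refine intervalIntegral.integral_congr fun t ht => ?_
            rw [Set.uIcc_of_le hu.1] at ht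
            simp [max_eq_left ht.1]
          rw [h4, h5, intervalIntegral.integral_const_mul]
          simp
        simp only [hf]
        rw [intervalIntegral.integral_sub (hI.intervalIntegrable 0 u) (hpi 0 u), h3,
          integral_pExt hu.1, mul_sub, h2, max_eq_left hu.1,
          cv_box _ (fun x hx => iter_of_neg isGap_eK.left_zero 2 hx) hu0.le hu.2]
        simp only [Nat.add_one_sub_one]
        rw [cv_mul_eK hu.1 hu.2]
        push_cast
        ring
      show u * |f u| ≤ _
      rw [← abs_of_pos hu0, ← abs_mul, abs_of_pos hu0, e]
      exact intervalIntegral.abs_integral_le_integral_abs hu0.le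
    · intro x hx
      have : iter eK 2 x = 0 :=
        iter_two_eq_zero isGap_eK.left (by linarith [hx.2])
      simp [hf, this, max_eq_right hx.2, pExt_two]
  have h2 := abs_nonpos_iff.1 h1
  simp only [hf, max_eq_left hv, iter] at h2
  linarith

lemma cv_le_cv_of_support {f h k : ℝ → ℝ} (hf : IsKernel f) (hf0 : ∀ t, 0 ≤ f t) (hh : IsBddMeas h)
    (hk : IsBddMeas k) {u : ℝ} (H : ∀ t, f t ≠ 0 → h (u - t) ≤ k (u - t)) : cv f h u ≤ cv f k u := by
  refine cv_le_cv hf hf hh hk fun t => ?_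
  by_cases h0 : f t = 0
  · simp [h0]
  · exact mul_le_mul_of_nonneg_left (H t h0) (hf0 t)

lemma isBddMeas_const (c : ℝ) : IsBddMeas fun _ => c := ⟨measurable_const, |c|, fun _ => le_rfl⟩

lemma cv_const (f : ℝ → ℝ) (c u : ℝ) : cv f (fun _ => c) u = c * ∫ t, f t := by
  unfold cv; rw [integral_mul_const, mul_comm]

lemma cv_le_mul {f h : ℝ → ℝ} (hf : IsKernel f) (hf0 : ∀ t, 0 ≤ f t) (hh : IsBddMeas h) {u c : ℝ}
    (H : ∀ t, f t ≠ 0 → h (u - t) ≤ c) : cv f h u ≤ c * ∫ t, f t := by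
  rw [← cv_const f c u]
  exact cv_le_cv_of_support hf hf0 hh (isBddMeas_const c) H

lemma mul_le_cv {f h : ℝ → ℝ} (hf : IsKernel f) (hf0 : ∀ t, 0 ≤ f t) (hh : IsBddMeas h) {u c : ℝ}
    (H : ∀ t, f t ≠ 0 → c ≤ h (u - t)) : c * ∫ t, f t ≤ cv f h u := by
  rw [← cv_const f c u]
  exact cv_le_cv_of_support hf hf0 (isBddMeas_const c) hh H

lemma cv_eq_mul {f h : ℝ → ℝ} {u c : ℝ} (H : ∀ t, f t ≠ 0 → h (u - t) = c) :
    cv f h u = c * ∫ t, f t := by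
  rw [← cv_const f c u]
  unfold cv
  congr 1; ext t
  by_cases h0 : f t = 0
  · simp [h0]
  · rw [H t h0]

lemma cv_shift (f h : ℝ → ℝ) (c u : ℝ) : cv f (fun x => h (x - c)) u = cv f h (u - c) := by
  unfold cv
  congr 1; ext t
  rw [sub_right_comm]

lemma cv_sq_add {f k h : ℝ → ℝ} (hf : IsKernel f) (hk : IsKernel k) (hh : IsBddMeas h) :
    cv (f + k) (cv (f + k) h) =
      cv f (cv f h) + cv f (cv k h) + cv f (cv k h) + cv k (cv k h) := by
  have e : cv (f + k) h = cv f h + cv k h := funext fun x => cv_add_left hf hk hh x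
  ext u
  rw [e, cv_add_left hf hk ((hh.cv hf).add (hh.cv hk)), cv_add_right hf (hh.cv hf) (hh.cv hk),
    cv_add_right hk (hh.cv hf) (hh.cv hk), cv_comm hk hf hh]
  simp only [Pi.add_apply]
  ring

lemma cv_cube_add {f k h : ℝ → ℝ} (hf : IsKernel f) (hk : IsKernel k) (hh : IsBddMeas h) (u : ℝ) :
    cv (f + k) (cv (f + k) (cv (f + k) h)) u =
      cv f (cv f (cv f h)) u + 3 * cv f (cv f (cv k h)) u + 3 * cv f (cv k (cv k h)) u +
        cv k (cv k (cv k h)) u := by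
  have hff := (hh.cv hf).cv hf
  have hfk := (hh.cv hk).cv hf
  have hkk := (hh.cv hk).cv hk
  rw [cv_sq_add hf hk hh, cv_add_left hf hk (((hff.add hfk).add hfk).add hkk),
    cv_add_right hf ((hff.add hfk).add hfk) hkk, cv_add_right hf (hff.add hfk) hfk,
    cv_add_right hf hff hfk, cv_add_right hk ((hff.add hfk).add hfk) hkk,
    cv_add_right hk (hff.add hfk) hfk, cv_add_right hk hff hfk,
    cv_comm hk hf (hh.cv hf), cv_comm hk hf (hh.cv hk)]
  have e : cv k (cv f h) = cv f (cv k h) := funext fun x => cv_comm hk hf hh x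
  rw [e]
  ring

/-- Restriction of a kernel to `(a, b]`. -/
noncomputable def piece (g : ℝ → ℝ) (a b : ℝ) : ℝ → ℝ := Set.indicator (Set.Ioc a b) g

lemma mem_of_piece_ne_zero {g : ℝ → ℝ} {a b t : ℝ} (h : piece g a b t ≠ 0) : t ∈ Set.Ioc a b :=
  Set.mem_of_indicator_ne_zero h

lemma piece_of_mem {g : ℝ → ℝ} {a b t : ℝ} (h : t ∈ Set.Ioc a b) : piece g a b t = g t :=
  Set.indicator_of_mem h g

lemma piece_of_notMem {g : ℝ → ℝ} {a b t : ℝ} (h : t ∉ Set.Ioc a b) : piece g a b t = 0 :=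
  Set.indicator_of_notMem h g

lemma piece_left {g : ℝ → ℝ} {a b : ℝ} : ∀ t ≤ a, piece g a b t = 0 := fun _ ht =>
  piece_of_notMem fun h => absurd h.1 (not_lt.2 ht)

lemma piece_add {g : ℝ → ℝ} {a b c : ℝ} (hab : a ≤ b) (hbc : b ≤ c) :
    piece g a b + piece g b c = piece g a c := by
  ext t
  simp only [Pi.add_apply, piece]
  rw [← Set.Ioc_union_Ioc_eq_Ioc hab hbc, Set.indicator_union_of_disjoint]
  rw [Set.disjoint_left]
  exact fun x h1 h2 => absurd h1.2 (not_le.2 h2.1)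

lemma IsGap.piece {τ B : ℝ} {g : ℝ → ℝ} (h : IsGap τ B g) (a b : ℝ) : IsGap τ B (piece g a b) where
  pos := h.pos
  le := h.le
  meas := h.meas.indicator measurableSet_Ioc
  nonneg := fun t => Set.indicator_nonneg (fun t _ => h.nonneg t) t
  mul_le := fun t => by
    by_cases ht : t ∈ Set.Ioc a b
    · rw [piece_of_mem ht]; exact h.mul_le t
    · rw [piece_of_notMem ht]; norm_num
  left := fun t ht => by
    by_cases ht' : t ∈ Set.Ioc a b
    · rw [piece_of_mem ht']; exact h.left t ht
    · rw [piece_of_notMem ht']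
  right := fun t ht => by
    by_cases ht' : t ∈ Set.Ioc a b
    · rw [piece_of_mem ht']; exact h.right t ht
    · rw [piece_of_notMem ht']

lemma IsGap.piece_le_recip {τ : ℝ} {g : ℝ → ℝ} (h : IsGap τ uS g) {a b : ℝ} (ha : 0 < a)
    (hb : b ≤ uS) (t : ℝ) : _root_.piece g a b t ≤ recip a 2 t := by
  by_cases ht : t ∈ Set.Ioc a b
  · have h1 : t ∈ Set.Ioc a uS := ⟨ht.1, ht.2.trans hb⟩
    rw [piece_of_mem ht, recip, Set.indicator_of_mem h1, le_div_iff₀ (ha.trans ht.1), mul_comm]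
    exact h.mul_le t
  · rw [piece_of_notMem ht]
    exact Set.indicator_nonneg (fun t ht => div_nonneg (by norm_num) (by linarith [ht.1])) t

lemma IsGap.cv_heav_sub_le {τ B : ℝ} {g : ℝ → ℝ} (h : IsGap τ B g) {x y : ℝ} (hx : 0 < x)
    (hxy : x ≤ y) : cv g heav y - cv g heav x ≤ 2 * Real.log (y / x) := by
  have hi : ∀ a b, IntervalIntegrable g volume a b := fun a b => h.isKernel.2.intervalIntegrable
  rw [cv_heav h.left_zero hx.le, cv_heav h.left_zero (hx.le.trans hxy),
    intervalIntegral.integral_interval_sub_left (hi _ _) (hi _ _),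
    ← integral_one_div_of_pos hx (hx.trans_le hxy), ← intervalIntegral.integral_const_mul]
  refine intervalIntegral.integral_mono_on hxy (hi _ _) ?_ ?_
  · refine (ContinuousOn.intervalIntegrable ?_)
    refine continuousOn_const.mul (continuousOn_const.div continuousOn_id fun t ht => ?_)
    rw [Set.uIcc_of_le hxy] at ht
    exact (hx.trans_le ht.1).ne'
  · intro t ht
    rw [mul_one_div, le_div_iff₀ (hx.trans_le ht.1), mul_comm]
    exact h.mul_le t

/-- A gap kernel on `(τ, uS]` with unit mass on `(0, √e]`. -/
structure IsNorm (τ : ℝ) (g : ℝ → ℝ) : Prop where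
  gap : IsGap τ uS g
  le_one : τ ≤ 1
  mass : cv g heav rE = 1

/-- The mass function of the part of the kernel below `√e`. -/
noncomputable def gG (g : ℝ → ℝ) : ℝ → ℝ := cv (piece g 0 rE) heav

/-- The second iterate of the part of the kernel below `√e`. -/
noncomputable def gP (g : ℝ → ℝ) : ℝ → ℝ := cv (piece g 0 rE) (gG g)

/-- The mass of the kernel on `(0, 1]`. -/
noncomputable def gam (g : ℝ → ℝ) : ℝ := ∫ t, piece g 0 1 t

namespace IsNorm

variable {τ : ℝ} {g : ℝ → ℝ}

lemma isKernel_piece (h : IsNorm τ g) (a b : ℝ) : IsKernel (piece g a b) := (h.gap.piece a b).isKernel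

lemma piece_nonneg (h : IsNorm τ g) (a b t : ℝ) : 0 ≤ piece g a b t := (h.gap.piece a b).nonneg t

lemma low_add (_h : IsNorm τ g) : piece g 0 1 + piece g 1 rE = piece g 0 rE :=
  piece_add zero_le_one (by linarith [rE_lo])

lemma eq_add (h : IsNorm τ g) : piece g rE uS + piece g 0 rE = g := by
  rw [add_comm, piece_add rE_pos.le (by rw [uS]; linarith)]
  ext t
  by_cases ht : t ∈ Set.Ioc 0 uS
  · rw [piece_of_mem ht]
  · rw [piece_of_notMem ht]
    rcases le_or_gt t 0 with h1 | h1
    · rw [h.gap.left_zero t h1]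
    · rw [h.gap.right t]
      by_contra! h2; exact ht ⟨h1, h2⟩

lemma isBddMeas_gG (h : IsNorm τ g) : IsBddMeas (gG g) := isBddMeas_heav.cv (h.isKernel_piece _ _)

lemma isBddMeas_gP (h : IsNorm τ g) : IsBddMeas (gP g) := h.isBddMeas_gG.cv (h.isKernel_piece _ _)

lemma cv_piece_heav_of_le (a b : ℝ) {x : ℝ} (hx : b ≤ x) :
    cv (piece g a b) heav x = ∫ t, piece g a b t := by
  rw [cv_eq_mul (c := 1), one_mul]
  intro t ht
  exact heav_of_nonneg (by linarith [(mem_of_piece_ne_zero ht).2])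

lemma cv_heav_eq_gG (h : IsNorm τ g) {x : ℝ} (hx : x ≤ rE) : cv g heav x = gG g x := by
  conv_lhs => rw [← h.eq_add]
  rw [cv_add_left (h.isKernel_piece _ _) (h.isKernel_piece _ _) isBddMeas_heav,
    cv_heav_of_le piece_left hx, zero_add]
  rfl

lemma integral_low (h : IsNorm τ g) : ∫ t, piece g 0 rE t = 1 := by
  rw [← cv_piece_heav_of_le 0 rE le_rfl, ← h.mass, h.cv_heav_eq_gG le_rfl]
  rfl

lemma gG_of_ge (h : IsNorm τ g) {x : ℝ} (hx : rE ≤ x) : gG g x = 1 := by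
  rw [← h.integral_low, ← cv_piece_heav_of_le 0 rE hx]
  rfl

lemma gG_nonneg (h : IsNorm τ g) (x : ℝ) : 0 ≤ gG g x := cv_nonneg (h.piece_nonneg _ _) heav_nonneg x

lemma gG_le_one (h : IsNorm τ g) (x : ℝ) : gG g x ≤ 1 := by
  have := cv_le_mul (h.isKernel_piece 0 rE) (h.piece_nonneg _ _) isBddMeas_heav (u := x)
    fun t _ => heav_le_one _
  rwa [h.integral_low, one_mul] at this

lemma gG_le_heav (h : IsNorm τ g) (x : ℝ) : gG g x ≤ heav x := by
  rcases lt_or_ge x 0 with h1 | h1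
  · rw [gG, cv_heav_of_le piece_left h1.le]; exact heav_nonneg x
  · rw [heav_of_nonneg h1]; exact h.gG_le_one x

lemma gG_mono (h : IsNorm τ g) : Monotone (gG g) :=
  cv_mono (h.isKernel_piece _ _) (h.piece_nonneg _ _) isBddMeas_heav heav_mono

lemma gP_nonneg (h : IsNorm τ g) (x : ℝ) : 0 ≤ gP g x := cv_nonneg (h.piece_nonneg _ _) h.gG_nonneg x

lemma gP_le_gG (h : IsNorm τ g) (x : ℝ) : gP g x ≤ gG g x :=
  cv_le_cv_of_support (h.isKernel_piece _ _) (h.piece_nonneg _ _) h.isBddMeas_gG isBddMeas_heav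
    fun _ _ => h.gG_le_heav _

lemma gP_le_one (h : IsNorm τ g) (x : ℝ) : gP g x ≤ 1 := (h.gP_le_gG x).trans (h.gG_le_one x)

lemma gam_nonneg (h : IsNorm τ g) : 0 ≤ gam g := integral_nonneg (h.piece_nonneg _ _)

lemma integral_mid (h : IsNorm τ g) : ∫ t, piece g 1 rE t = 1 - gam g := by
  have := integral_add (h.isKernel_piece 0 1).2 (h.isKernel_piece 1 rE).2
  have e := h.integral_low
  rw [← h.low_add] at e
  simp only [Pi.add_apply] at e
  rw [gam]
  linarith

lemma gam_le_one (h : IsNorm τ g) : gam g ≤ 1 := by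
  have : 0 ≤ ∫ t, piece g 1 rE t := integral_nonneg (h.piece_nonneg _ _)
  rw [h.integral_mid] at this
  linarith

lemma gG_eq_add (h : IsNorm τ g) {x : ℝ} (hx : 1 ≤ x) : gG g x = gam g + cv (piece g 1 rE) heav x := by
  rw [gG, ← h.low_add, cv_add_left (h.isKernel_piece _ _) (h.isKernel_piece _ _) isBddMeas_heav,
    cv_piece_heav_of_le 0 1 hx]
  rfl

lemma two_log_le_gG (h : IsNorm τ g) {x : ℝ} (hx : 0 < x) (hxE : x ≤ rE) :
    2 * Real.log x ≤ gG g x := by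
  have := (h.gap.piece 0 rE).cv_heav_sub_le hx hxE
  rw [Real.log_div rE_pos.ne' hx.ne', log_rE] at this
  have h2 := h.gG_of_ge le_rfl
  rw [gG] at h2 ⊢
  linarith

lemma cv_mid_nonneg (h : IsNorm τ g) (x : ℝ) : 0 ≤ cv (piece g 1 rE) heav x :=
  cv_nonneg (h.piece_nonneg _ _) heav_nonneg x

lemma cv_mid_le_log (h : IsNorm τ g) {x : ℝ} (hx : 1 ≤ x) :
    cv (piece g 1 rE) heav x ≤ 2 * Real.log x := by
  have := (h.gap.piece 1 rE).cv_heav_sub_le one_pos hx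
  rwa [cv_heav_of_le piece_left le_rfl, sub_zero, div_one] at this

lemma cv_mid_le (h : IsNorm τ g) {x : ℝ} (hx : 1 ≤ x) :
    cv (piece g 1 rE) heav x ≤ 1 - gam g := by
  have := h.gG_le_one x
  rw [h.gG_eq_add hx] at this
  linarith

lemma cv_high_le_log (h : IsNorm τ g) {x : ℝ} (hx : rE ≤ x) :
    cv (piece g rE uS) heav x ≤ 2 * Real.log (x / rE) := by
  have := (h.gap.piece rE uS).cv_heav_sub_le rE_pos hx
  rwa [cv_heav_of_le piece_left le_rfl, sub_zero] at this

lemma iter_one (h : IsNorm τ g) (x : ℝ) : iter g 1 x = gG g x + cv (piece g rE uS) heav x := by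
  conv_lhs => rw [← h.eq_add]
  simp only [iter]
  rw [cv_add_left (h.isKernel_piece _ _) (h.isKernel_piece _ _) isBddMeas_heav, add_comm]
  rfl

lemma iter_two (h : IsNorm τ g) {x : ℝ} (hx : x ≤ uS) :
    iter g 2 x = gP g x + 2 * cv (piece g rE uS) (gG g) x := by
  conv_lhs => rw [← h.eq_add]
  simp only [iter]
  rw [cv_sq_add (h.isKernel_piece _ _) (h.isKernel_piece _ _) isBddMeas_heav]
  have : cv (piece g rE uS) (cv (piece g rE uS) heav) x = 0 :=
    iter_two_eq_zero piece_left (by rw [uS] at hx; linarith [rE_lo])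
  simp only [Pi.add_apply, this, gP, gG]
  ring

lemma iter_three (h : IsNorm τ g) {x : ℝ} (hx : x ≤ uS) :
    iter g 3 x = cv (piece g 0 rE) (gP g) x + 3 * cv (piece g rE uS) (gP g) x := by
  conv_lhs => rw [← h.eq_add]
  simp only [iter]
  rw [cv_cube_add (h.isKernel_piece _ _) (h.isKernel_piece _ _) isBddMeas_heav]
  have hx' : x ≤ rE + rE := by rw [uS] at hx; linarith [rE_lo]
  have e1 : cv (piece g rE uS) (cv (piece g rE uS) (cv (piece g rE uS) heav)) x = 0 :=
    cv_eq_zero piece_left (fun y hy => cv_eq_zero (a := 0) piece_left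
      (fun z hz => cv_heav_of_le piece_left (by linarith [rE_pos])) (by linarith)) hx'
  have e2 : cv (piece g rE uS) (cv (piece g rE uS) (cv (piece g 0 rE) heav)) x = 0 :=
    cv_eq_zero piece_left (fun y hy => cv_eq_zero (a := 0) piece_left
      (fun z hz => cv_heav_of_le piece_left hz.le) (by linarith)) hx'
  rw [e1, e2]
  simp only [gP, gG]
  ring

end IsNorm

section Solution

variable {τ : ℝ} {g χ σ : ℝ → ℝ}

lemma sol_ge (h : IsNorm τ g) (hs : IsSol τ uS χ σ)
    (hχ : ∀ t ∈ Set.Ioc 0 uS, χ t = 1 - t * g t) {x : ℝ} (hx : 0 ≤ x) (hxE : x ≤ rE) :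
    1 - gG g x ≤ σ x := by
  have := (sol_bounds h.gap hs hχ hx (by rw [uS]; linarith)).1
  rwa [h.iter_one, cv_heav_of_le piece_left hxE, add_zero] at this

lemma sol_nonneg (h : IsNorm τ g) (hs : IsSol τ uS χ σ)
    (hχ : ∀ t ∈ Set.Ioc 0 uS, χ t = 1 - t * g t) {x : ℝ} (hx : 0 ≤ x) (hxE : x ≤ rE) : 0 ≤ σ x :=
  (sub_nonneg.2 (h.gG_le_one x)).trans (sol_ge h hs hχ hx hxE)

lemma sol_le (h : IsNorm τ g) (hs : IsSol τ uS χ σ)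
    (hχ : ∀ t ∈ Set.Ioc 0 uS, χ t = 1 - t * g t) {x : ℝ} (hx : 0 ≤ x) (hxS : x ≤ uS) :
    σ x ≤ 1 - gG g x + gP g x / 2 := by
  have h1 := (sol_bounds h.gap hs hχ hx hxS).2.1
  rw [h.iter_one, h.iter_two hxS] at h1
  have h2 : cv (piece g rE uS) (gG g) x ≤ cv (piece g rE uS) heav x :=
    cv_le_cv_of_support (h.isKernel_piece _ _) (h.piece_nonneg _ _) h.isBddMeas_gG isBddMeas_heav
      fun _ _ => h.gG_le_heav _
  linarith

lemma neg_sol_le_of_le_two (h : IsNorm τ g) (hs : IsSol τ uS χ σ)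
    (hχ : ∀ t ∈ Set.Ioc 0 uS, χ t = 1 - t * g t) {x : ℝ} (hx : rE ≤ x) (hxS : x ≤ uS) :
    -σ x ≤ 2 * Real.log (x / rE) := by
  have h1 := (sol_bounds h.gap hs hχ (rE_pos.le.trans hx) hxS).1
  rw [h.iter_one, h.gG_of_ge hx] at h1
  linarith [h.cv_high_le_log hx]

lemma cv_mid_mid_le (h : IsNorm τ g) {x : ℝ} (hx : x ≤ uS) :
    cv (piece g 1 rE) (cv (piece g 1 rE) heav) x ≤ cv (recip rE 2) heav x := by
  have hk := h.isKernel_piece 1 rE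
  have hE := isGap_eK
  have hR : IsGap rE uS (recip rE 2) :=
    isGap_recip (by linarith [rE_lo]) (by rw [uS]; linarith) (by norm_num) le_rfl
  rcases le_or_gt x 2 with h2 | h2
  · rw [iter_two_eq_zero piece_left (by linarith)]
    exact cv_nonneg hR.nonneg heav_nonneg x
  · rw [cv_recip_heav (by linarith [rE_lo]) (by linarith [rE_hi]) hx]
    have h3 : ∀ t, piece g 1 rE t ≤ eK t := h.gap.piece_le_recip one_pos (by rw [uS]; linarith)
    have h4 : ∀ y, cv (piece g 1 rE) heav y ≤ cv eK heav y := fun y =>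
      cv_le_cv hk hE.isKernel isBddMeas_heav isBddMeas_heav
        fun t => mul_le_mul_of_nonneg_right (h3 t) (heav_nonneg _)
    have h5 : cv (piece g 1 rE) (cv (piece g 1 rE) heav) x ≤ cv eK (cv eK heav) x :=
      cv_le_cv hk hE.isKernel (isBddMeas_heav.cv hk) (isBddMeas_heav.cv hE.isKernel)
        fun t => mul_le_mul (h3 t) (h4 _) (h.cv_mid_nonneg _) (hE.nonneg t)
    rw [cv_eK_two h2.le hx] at h5
    linarith [pExt_le_log h2.le hx]

lemma two_pExt_le (h : IsNorm τ g) {u : ℝ} (hu : 2 ≤ u) (huS : u ≤ uS) :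
    2 * pExt u ≤ gam g ^ 2 + 2 * (gam g * cv (piece g 1 rE) heav (u - 1)) +
      cv (piece g 1 rE) (cv (piece g 1 rE) heav) u := by
  have huE : u - 1 ≤ rE := by rw [uS] at huS; linarith
  have hk := h.isKernel_piece 1 rE
  have hE := isGap_eK.isKernel
  have hb := isBddMeas_heav.cv hk
  have hs : IsBddMeas fun x => gam g * heav (x - 1) := (isBddMeas_heav.shift 1).const_mul _
  set Gs : ℝ → ℝ := (fun x => gam g * heav (x - 1)) + cv (piece g 1 rE) heav with hGs
  have hsb : IsBddMeas Gs := hs.add hb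
  have key : ∀ x ≤ rE, cv eK heav x ≤ Gs x := by
    intro x hx
    rcases lt_or_ge x 1 with h1 | h1
    · rw [cv_heav_of_le isGap_eK.left h1.le]
      exact add_nonneg (mul_nonneg h.gam_nonneg (heav_nonneg _)) (h.cv_mid_nonneg x)
    · rw [cv_eK_heav h1 (by rw [uS]; linarith)]
      have := h.two_log_le_gG (by linarith) hx
      rw [h.gG_eq_add h1] at this
      simpa [hGs, heav_of_nonneg (sub_nonneg.2 h1)] using this
  have expand : ∀ f, IsKernel f → cv f Gs u = gam g * cv f heav (u - 1) +
      cv f (cv (piece g 1 rE) heav) u := by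
    intro f hf
    rw [hGs, cv_add_right hf hs hb, cv_const_mul, cv_shift]
  have e1 : Gs (u - 1) = gam g + cv (piece g 1 rE) heav (u - 1) := by
    simp [hGs, heav_of_nonneg (show (0:ℝ) ≤ u - 1 - 1 by linarith)]
  have h1 := key (u - 1) huE
  rw [e1] at h1
  have h2 : cv (piece g 1 rE) (cv eK heav) u ≤ cv (piece g 1 rE) Gs u :=
    cv_le_cv_of_support hk (h.piece_nonneg _ _) (isBddMeas_heav.cv hE) hsb
      fun t ht => key _ (by linarith [(mem_of_piece_ne_zero ht).1])
  have h3 : cv eK (cv eK heav) u ≤ cv eK Gs u :=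
    cv_le_cv_of_support hE isGap_eK.nonneg (isBddMeas_heav.cv hE) hsb fun t ht => key _ (by
      by_contra! h4
      exact ht (isGap_eK.left t (by linarith)))
  rw [expand _ hk, cv_comm hk hE isBddMeas_heav] at h2
  rw [expand _ hE, cv_eK_two hu huS] at h3
  have h4 := mul_le_mul_of_nonneg_left h1 h.gam_nonneg
  nlinarith

lemma neg_sol_le (h : IsNorm τ g) (hs : IsSol τ uS χ σ)
    (hχ : ∀ t ∈ Set.Ioc 0 uS, χ t = 1 - t * g t) {u : ℝ} (hu : 2 ≤ u) (huS : u ≤ uS) :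
    -σ u ≤ rho u + cErr u * gam g ^ 2 := by
  have hA := h.isKernel_piece 0 1
  have hB := h.isKernel_piece 1 rE
  have hC := h.isKernel_piece rE uS
  have hL := h.isKernel_piece 0 rE
  have hR : IsGap rE uS (recip rE 2) :=
    isGap_recip (by linarith [rE_lo]) (by rw [uS]; linarith) (by norm_num) le_rfl
  have huE : rE ≤ u := by linarith [rE_hi]
  have hG := h.isBddMeas_gG
  have b3 := (sol_bounds h.gap hs hχ (by linarith) huS).2.2
  rw [h.iter_one, h.iter_two huS, h.iter_three huS, h.gG_of_ge huE] at b3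
  have c1 : cv (piece g rE uS) heav u - cv (piece g rE uS) (gG g) u
      + 1 / 2 * cv (piece g rE uS) (gP g) u ≤
      cv (recip rE 2) heav u - 1 / 2 * cv (recip rE 2) (gG g) u := by
    have h1 : cv (piece g rE uS) (gP g) u ≤ cv (piece g rE uS) (gG g) u :=
      cv_le_cv_of_support hC (h.piece_nonneg _ _) h.isBddMeas_gP hG fun _ _ => h.gP_le_gG _
    have h2 : cv (piece g rE uS) (heav + fun x => -(1 / 2) * gG g x) u ≤
        cv (recip rE 2) (heav + fun x => -(1 / 2) * gG g x) u := by
      refine cv_le_cv hC hR.isKernel (isBddMeas_heav.add (hG.const_mul _))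
        (isBddMeas_heav.add (hG.const_mul _)) fun t => ?_
      refine mul_le_mul_of_nonneg_right (h.gap.piece_le_recip rE_pos le_rfl t) ?_
      have := h.gG_le_heav (u - t)
      have := h.gG_nonneg (u - t)
      simp only [Pi.add_apply]
      linarith
    rw [cv_add_right hC isBddMeas_heav (hG.const_mul _), cv_const_mul,
      cv_add_right hR.isKernel isBddMeas_heav (hG.const_mul _), cv_const_mul] at h2
    linarith
  rw [cv_recip_heav (by linarith [rE_lo]) huE huS, log_div_rE (by linarith)] at c1
  have c2 : cv (piece g 0 1) (cv (recip rE 2) heav) u ≤ cv (recip rE 2) (gG g) u := by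
    have hb := isBddMeas_heav.cv hR.isKernel
    rw [gG, cv_comm hR.isKernel hL isBddMeas_heav, ← h.low_add, cv_add_left hA hB hb]
    have := cv_nonneg (h.piece_nonneg 1 rE) (cv_nonneg hR.nonneg heav_nonneg) u
    linarith
  set γ := gam g with hγ
  have hγ0 : 0 ≤ γ := h.gam_nonneg
  have hγ1 : γ ≤ 1 := h.gam_le_one
  set A := cv (piece g 1 rE) heav (u - 1) with hAdef
  set ab := cv (piece g 0 1) (cv (piece g 1 rE) heav) u with hab
  have haa_le : ∀ x, cv (piece g 0 1) (cv (piece g 0 1) heav) x ≤ γ * γ := fun x =>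
    cv_le_mul hA (h.piece_nonneg _ _) (isBddMeas_heav.cv hA) fun t _ => by
      have := cv_le_mul hA (h.piece_nonneg _ _) isBddMeas_heav (u := x - t) fun s _ => heav_le_one _
      rwa [one_mul] at this
  have haa : cv (piece g 0 1) (cv (piece g 0 1) heav) u = γ * γ :=
    cv_eq_mul fun t ht => IsNorm.cv_piece_heav_of_le 0 1 (by linarith [(mem_of_piece_ne_zero ht).2])
  have eP : gP g u = γ * γ + 2 * ab + cv (piece g 1 rE) (cv (piece g 1 rE) heav) u := by
    rw [gP, gG, ← h.low_add, cv_sq_add hA hB isBddMeas_heav]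
    simp only [Pi.add_apply, haa]
    ring
  have eLLL : cv (piece g 0 rE) (gP g) u = cv (piece g 0 1) (cv (piece g 0 1) (cv (piece g 0 1) heav)) u
      + 3 * cv (piece g 0 1) (cv (piece g 0 1) (cv (piece g 1 rE) heav)) u
      + 3 * cv (piece g 0 1) (cv (piece g 1 rE) (cv (piece g 1 rE) heav)) u := by
    have : cv (piece g 1 rE) (cv (piece g 1 rE) (cv (piece g 1 rE) heav)) u = 0 :=
      cv_eq_zero (a := 2) (b := 1) piece_left
        (fun y hy => iter_two_eq_zero piece_left (by linarith)) (by linarith [uS_hi])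
    rw [gP, gG, ← h.low_add, cv_cube_add hA hB isBddMeas_heav, this, add_zero]
  have d1 : cv (piece g 0 1) (cv (piece g 0 1) (cv (piece g 0 1) heav)) u ≤ γ * γ * γ :=
    cv_le_mul hA (h.piece_nonneg _ _) ((isBddMeas_heav.cv hA).cv hA) fun t _ => haa_le _
  have d2 : cv (piece g 0 1) (cv (piece g 0 1) (cv (piece g 1 rE) heav)) u ≤ ab * γ :=
    cv_le_mul hA (h.piece_nonneg _ _) ((isBddMeas_heav.cv hB).cv hA) fun t ht =>
      cv_mono hA (h.piece_nonneg _ _) (isBddMeas_heav.cv hB)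
        (cv_mono hB (h.piece_nonneg _ _) isBddMeas_heav heav_mono)
        (by linarith [(mem_of_piece_ne_zero ht).1])
  have d3 : cv (piece g 0 1) (cv (piece g 1 rE) (cv (piece g 1 rE) heav)) u ≤
      cv (piece g 0 1) (cv (recip rE 2) heav) u :=
    cv_le_cv_of_support hA (h.piece_nonneg _ _) ((isBddMeas_heav.cv hB).cv hB)
      (isBddMeas_heav.cv hR.isKernel) fun t ht =>
        cv_mid_mid_le h (by linarith [(mem_of_piece_ne_zero ht).1])
  have d4 : A * γ ≤ ab :=
    mul_le_cv hA (h.piece_nonneg _ _) (isBddMeas_heav.cv hB) fun t ht =>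
      cv_mono hB (h.piece_nonneg _ _) isBddMeas_heav heav_mono
        (by linarith [(mem_of_piece_ne_zero ht).2])
  have d5 := two_pExt_le h hu huS
  have d6 : A ≤ 2 * Real.log (u - 1) := h.cv_mid_le_log (by linarith)
  have d7 : A ≤ 1 - γ := h.cv_mid_le (by linarith)
  have d8 : A * γ * (1 - γ / 2) ≤ ab * (1 - γ / 2) :=
    mul_le_mul_of_nonneg_right d4 (by linarith)
  have d9 : γ ^ 2 * (A / 2 + γ / 6) ≤ γ ^ 2 * cErr u := by
    refine mul_le_mul_of_nonneg_left ?_ (sq_nonneg γ)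
    rw [cErr]; linarith
  rw [rho]
  nlinarith

lemma half_gP_le (h : IsNorm τ g) {u : ℝ} (hu : 2 ≤ u) (huS : u ≤ uS) :
    gP g u / 2 ≤ rho u + cErr u * gam g ^ 2 := by
  rcases le_or_gt 2.2 u with h1 | h1
  · have h2 := rho_ge_half h1 huS
    have h3 := h.gP_le_one u
    have h4 := mul_nonneg (cErr_pos hu).le (sq_nonneg (gam g))
    linarith
  have hA := h.isKernel_piece 0 1
  have hB := h.isKernel_piece 1 rE
  have hG := h.isBddMeas_gG
  set A := cv (piece g 1 rE) heav (u - 1) with hAdef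
  have e1 : gP g u ≤ 1 * gam g + (gam g + A) * (1 - gam g) := by
    rw [gP, ← h.low_add, cv_add_left hA hB hG]
    refine add_le_add (cv_le_mul hA (h.piece_nonneg _ _) hG fun t _ => h.gG_le_one _) ?_
    rw [← h.integral_mid]
    refine cv_le_mul hB (h.piece_nonneg _ _) hG fun t ht => ?_
    rw [← h.gG_eq_add (by linarith)]
    exact h.gG_mono (by linarith [(mem_of_piece_ne_zero ht).1])
  have d6 : A ≤ 2 * Real.log (u - 1) := h.cv_mid_le_log (by linarith)
  have hγ0 : 0 ≤ gam g := h.gam_nonneg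
  have hγ1 : gam g ≤ 1 := h.gam_le_one
  have l1 : Real.log (u - 1) ≤ u - 2 := by
    linarith [Real.log_le_sub_one_of_pos (show 0 < u - 1 by linarith)]
  have l0 : 0 ≤ Real.log (u - 1) := Real.log_nonneg (by linarith)
  have l2 := log_two_add_ge (x := u - 2) (by linarith)
  rw [add_sub_cancel] at l2
  have l3 := pExt_le_sq hu
  have l4 : 2 * (u - 2) / (u - 2 + 4) ≥ (u - 2) * 0.47 := by
    rw [ge_iff_le, le_div_iff₀ (by linarith)]
    nlinarith
  have e2 : gP g u ≤ gam g + (gam g + 2 * Real.log (u - 1)) * (1 - gam g) := by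
    have := mul_le_mul_of_nonneg_right (add_le_add_right d6 (gam g)) (sub_nonneg.2 hγ1)
    linarith
  rw [rho, cErr]
  set γ := gam g
  set m := Real.log (u - 1)
  set x := u - 2 with hx
  have hx0 : 0 ≤ x := by linarith
  have hx2 : x ≤ 0.2 := by rw [hx]; linarith
  have goal : γ - 2 / 3 * γ ^ 2 + m * (1 - γ - 2 / 3 * γ ^ 2) ≤ 0.386 + 0.94 * x - x ^ 2 := by
    rcases le_total (1 - γ - 2 / 3 * γ ^ 2) 0 with hn | hn
    · nlinarith [sq_nonneg (γ - 3 / 4), mul_nonneg l0 (neg_nonneg.2 hn)]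
    · have : m * (1 - γ - 2 / 3 * γ ^ 2) ≤ x * (1 - γ - 2 / 3 * γ ^ 2) :=
        mul_le_mul_of_nonneg_right l1 hn
      nlinarith [sq_nonneg (γ - 3 / 4), mul_nonneg hx0 hγ0, mul_nonneg hx0 (sq_nonneg (γ - 1/2))]
  nlinarith

end Solution

/-- A solution of the integral equation whose kernel is normalised to have unit mass at `√e`. -/
structure IsCfg (τ : ℝ) (g χ σ : ℝ → ℝ) : Prop where
  norm : IsNorm τ g
  sol : ∀ B, uS ≤ B → IsSol τ B χ σ
  chi : ∀ t ∈ Set.Ioc 0 uS, χ t = 1 - t * g t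

/-- The excess of the mass function over the extremal one on `[1, √e]`. -/
noncomputable def excess (g : ℝ → ℝ) : ℝ := (∫ x in (1:ℝ)..rE, gG g x) - (2 - rE)

lemma integral_one_two_log {a : ℝ} : ∫ t in (1:ℝ)..a, 2 * Real.log t = 2 * (a * Real.log a - a + 1) := by
  rw [intervalIntegral.integral_const_mul, integral_log']
  simp

lemma intervalIntegrable_two_log {a b : ℝ} (ha : 0 < a) (hb : 0 < b) :
    IntervalIntegrable (fun t => 2 * Real.log t) volume a b :=
  (intervalIntegral.intervalIntegrable_log (by
    rw [Set.mem_uIcc]; rintro (h | h) <;> linarith [h.1])).const_mul 2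

lemma intervalIntegrable_two_log_div {a b : ℝ} (ha : 0 < a) (hb : 0 < b) :
    IntervalIntegrable (fun t => 2 * Real.log (t / rE)) volume a b := by
  refine ContinuousOn.intervalIntegrable (continuousOn_const.mul
    (ContinuousOn.log (by fun_prop) fun x hx => ?_))
  have : 0 < x := by rcases Set.mem_uIcc.1 hx with h | h <;> linarith [h.1]
  exact (div_pos this rE_pos).ne'

namespace IsNorm

variable {τ : ℝ} {g : ℝ → ℝ}

lemma gG_of_neg (_h : IsNorm τ g) {x : ℝ} (hx : x < 0) : gG g x = 0 :=
  cv_heav_of_le piece_left hx.le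

lemma gP_of_neg (h : IsNorm τ g) {x : ℝ} (hx : x < 0) : gP g x = 0 :=
  le_antisymm ((h.gP_le_gG x).trans (h.gG_of_neg hx).le) (h.gP_nonneg x)

lemma integral_gP_le (h : IsNorm τ g) :
    ∫ x in (0:ℝ)..2, gP g x ≤ 2 * ∫ x in (0:ℝ)..1, gG g x := by
  have hL := h.isKernel_piece 0 rE
  have hb := isKernel_box uS
  have hS := uS_lo
  have hii : ∀ a b, IntervalIntegrable (gG g) volume a b := h.isBddMeas_gG.intervalIntegrable
  have b0 : ∀ t, 0 ≤ box uS t := fun t => Set.indicator_nonneg (fun _ _ => by simp) t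
  rw [← cv_box (B := uS) (gP g) (fun x hx => h.gP_of_neg hx) (by norm_num) (by linarith),
    ← cv_box (B := uS) (gG g) (fun x hx => h.gG_of_neg hx) (by norm_num) (by linarith)]
  have e1 : cv (box uS) (gP g) 2 = cv (piece g 0 rE) (cv (box uS) (gG g)) 2 :=
    cv_comm hb hL h.isBddMeas_gG 2
  set c := cv (box uS) (gG g) 1 with hc
  have hbh := isBddMeas_heav.cv hb
  have hsum : IsBddMeas ((fun _ => c) + fun x => cv (box uS) heav (x - 1)) :=
    (isBddMeas_const c).add (hbh.shift 1)
  have e2 : cv (piece g 0 rE) (cv (box uS) (gG g)) 2 ≤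
      cv (piece g 0 rE) ((fun _ => c) + fun x => cv (box uS) heav (x - 1)) 2 := by
    refine cv_le_cv_of_support hL (h.piece_nonneg _ _) (h.isBddMeas_gG.cv hb) hsum fun t ht => ?_
    have ht0 := (mem_of_piece_ne_zero ht).1
    simp only [Pi.add_apply]
    rcases le_or_gt (2 - t) 1 with h1 | h1
    · have := cv_mono hb b0 h.isBddMeas_gG h.gG_mono h1
      have := cv_nonneg b0 heav_nonneg (2 - t - 1)
      linarith
    · rw [hc, cv_box (B := uS) _ (fun x hx => h.gG_of_neg hx) (by linarith) (by linarith),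
        cv_box (B := uS) _ (fun x hx => h.gG_of_neg hx) (by linarith) (by linarith),
        cv_box (B := uS) _ (fun x hx => heav_of_neg hx) (by linarith) (by linarith),
        ← intervalIntegral.integral_add_adjacent_intervals (hii 0 1) (hii 1 (2 - t))]
      have h2 : ∫ x in (1:ℝ)..(2 - t), gG g x ≤ ∫ x in (1:ℝ)..(2 - t), (1:ℝ) :=
        intervalIntegral.integral_mono_on h1.le (hii _ _) (by simp) fun x _ => h.gG_le_one x
      have h3 : ∫ x in (0:ℝ)..(2 - t - 1), heav x = ∫ x in (0:ℝ)..(2 - t - 1), (1:ℝ) :=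
        intervalIntegral.integral_congr fun x hx => by
          rw [Set.uIcc_of_le (by linarith)] at hx
          exact heav_of_nonneg hx.1
      rw [h3]
      simp only [intervalIntegral.integral_const, smul_eq_mul, mul_one] at h2 ⊢
      linarith
  rw [cv_add_right hL (isBddMeas_const c) (hbh.shift 1), cv_const, h.integral_low, mul_one,
    cv_shift, show (2:ℝ) - 1 = 1 by norm_num, cv_comm hL hb isBddMeas_heav] at e2
  rw [e1]
  change _ ≤ c + c at e2
  linarith

lemma gam_le_gG (h : IsNorm τ g) {x : ℝ} (hx : 1 ≤ x) : gam g ≤ gG g x := by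
  rw [h.gG_eq_add hx]; linarith [h.cv_mid_nonneg x]

lemma sq_gam_le_excess (h : IsNorm τ g) : gam g ^ 2 / 4 ≤ excess g := by
  have hii : ∀ a b, IntervalIntegrable (gG g) volume a b := h.isBddMeas_gG.intervalIntegrable
  have h0 := h.gam_nonneg
  set a := Real.exp (gam g / 2) with ha
  have ha1 : 1 ≤ a := Real.one_le_exp (by linarith)
  have haE : a ≤ rE := by
    rw [← Real.exp_log rE_pos, log_rE]
    exact Real.exp_le_exp.2 (by linarith [h.gam_le_one])
  have hla : Real.log a = gam g / 2 := Real.log_exp _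
  have i1 : gam g * (a - 1) ≤ ∫ x in (1:ℝ)..a, gG g x := by
    have : ∫ x in (1:ℝ)..a, gam g ≤ ∫ x in (1:ℝ)..a, gG g x :=
      intervalIntegral.integral_mono_on ha1 (by simp) (hii _ _) fun x hx => h.gam_le_gG hx.1
    rw [intervalIntegral.integral_const, smul_eq_mul] at this
    linarith
  have i2 : ∫ x in a..rE, 2 * Real.log x ≤ ∫ x in a..rE, gG g x :=
    intervalIntegral.integral_mono_on haE
      (intervalIntegrable_two_log (by linarith) rE_pos) (hii _ _)
      fun x hx => h.two_log_le_gG (by linarith [hx.1]) hx.2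
  have i3 := intervalIntegral.integral_add_adjacent_intervals (a := 1) (b := a) (c := rE)
    (intervalIntegrable_two_log one_pos (by linarith)) (intervalIntegrable_two_log (by linarith) rE_pos)
  rw [integral_one_two_log, integral_one_two_log, log_rE, hla] at i3
  have i4 := intervalIntegral.integral_add_adjacent_intervals (hii 1 a) (hii a rE)
  have i5 := Real.quadratic_le_exp_of_nonneg (x := gam g / 2) (by linarith)
  rw [excess]
  rw [← ha] at i5
  nlinarith

end IsNorm

namespace IsCfg

variable {τ : ℝ} {g χ σ : ℝ → ℝ}

lemma intervalIntegrable (h : IsCfg τ g χ σ) {a b : ℝ} (ha : 0 ≤ a) (hb : 0 ≤ b) :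
    IntervalIntegrable σ volume a b := by
  have h1 := (h.sol (max uS (max a b)) (le_max_left _ _)).int
  exact (intervalIntegrable_of_le h1 ha ((le_max_left a b).trans (le_max_right _ _))).symm.trans
    (intervalIntegrable_of_le h1 hb ((le_max_right a b).trans (le_max_right _ _)))

lemma sol_ge (h : IsCfg τ g χ σ) {x : ℝ} (hx : 0 ≤ x) (hxE : x ≤ rE) : 1 - gG g x ≤ σ x :=
  _root_.sol_ge h.norm (h.sol uS le_rfl) h.chi hx hxE

lemma sol_nonneg (h : IsCfg τ g χ σ) {x : ℝ} (hx : 0 ≤ x) (hxE : x ≤ rE) : 0 ≤ σ x :=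
  _root_.sol_nonneg h.norm (h.sol uS le_rfl) h.chi hx hxE

lemma sol_le (h : IsCfg τ g χ σ) {x : ℝ} (hx : 0 ≤ x) (hxS : x ≤ uS) :
    σ x ≤ 1 - gG g x + gP g x / 2 :=
  _root_.sol_le h.norm (h.sol uS le_rfl) h.chi hx hxS

lemma sol_le_half_gP (h : IsCfg τ g χ σ) {x : ℝ} (hx : rE ≤ x) (hxS : x ≤ uS) : σ x ≤ gP g x / 2 := by
  have := h.sol_le (rE_pos.le.trans hx) hxS
  rw [h.norm.gG_of_ge hx] at this
  linarith

lemma neg_sol_le_log (h : IsCfg τ g χ σ) {x : ℝ} (hx : rE ≤ x) (hxS : x ≤ uS) :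
    -σ x ≤ 2 * Real.log (x / rE) := neg_sol_le_of_le_two h.norm (h.sol uS le_rfl) h.chi hx hxS

lemma neg_sol_le (h : IsCfg τ g χ σ) {x : ℝ} (hx : 2 ≤ x) (hxS : x ≤ uS) :
    -σ x ≤ rho x + cErr x * gam g ^ 2 := _root_.neg_sol_le h.norm (h.sol uS le_rfl) h.chi hx hxS

lemma abs_sol_mid (h : IsCfg τ g χ σ) {x : ℝ} (hx : rE ≤ x) (hxS : x ≤ uS) :
    |σ x| ≤ gP g x / 2 + 2 * Real.log (x / rE) := by
  have h1 : 0 ≤ Real.log (x / rE) := Real.log_nonneg ((one_le_div rE_pos).2 hx)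
  have h2 := h.norm.gP_nonneg x
  rw [abs_le]
  constructor <;> linarith [h.sol_le_half_gP hx hxS, h.neg_sol_le_log hx hxS]

lemma abs_sol_le (h : IsCfg τ g χ σ) {x : ℝ} (hx : 2 ≤ x) (hxS : x ≤ uS) :
    |σ x| ≤ rho x + cErr x * gam g ^ 2 := by
  rw [abs_le]
  constructor <;> linarith [h.sol_le_half_gP (by linarith [rE_hi]) hxS, h.neg_sol_le hx hxS,
    half_gP_le h.norm hx hxS]

lemma integral_low_le (h : IsCfg τ g χ σ) :
    (∫ x in (0:ℝ)..rE, |σ x|) + (∫ x in rE..2, gP g x / 2) ≤ 2 * (rE - 1) - excess g := by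
  have hG : ∀ a b, IntervalIntegrable (gG g) volume a b :=
    h.norm.isBddMeas_gG.intervalIntegrable
  have hP : ∀ a b, IntervalIntegrable (fun x => gP g x / 2) volume a b :=
    fun a b => (h.norm.isBddMeas_gP.intervalIntegrable _ _).div_const 2
  have i1 : ∫ x in (0:ℝ)..rE, |σ x| ≤ ∫ x in (0:ℝ)..rE, ((1 - gG g x) + gP g x / 2) := by
    refine intervalIntegral.integral_mono_on rE_pos.le (h.intervalIntegrable le_rfl rE_pos.le).abs
      ((intervalIntegrable_const.sub (hG _ _)).add (hP _ _)) fun x hx => ?_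
    rw [abs_of_nonneg (h.sol_nonneg hx.1 hx.2)]
    exact h.sol_le hx.1 (by rw [uS]; linarith [hx.2])
  rw [intervalIntegral.integral_add (intervalIntegrable_const.sub (hG _ _)) (hP _ _),
    intervalIntegral.integral_sub intervalIntegrable_const (hG _ _),
    intervalIntegral.integral_const, smul_eq_mul] at i1
  have i2 := intervalIntegral.integral_add_adjacent_intervals (hP 0 rE) (hP rE 2)
  have i3 := intervalIntegral.integral_add_adjacent_intervals (hG 0 1) (hG 1 rE)
  have i4 := h.norm.integral_gP_le
  rw [intervalIntegral.integral_div] at i2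
  rw [intervalIntegral.integral_div (a := 0) (b := 2)] at i2
  rw [intervalIntegral.integral_div] at i1
  rw [excess]
  linarith

lemma energy_le (h : IsCfg τ g χ σ) {u : ℝ} (hu : 2 ≤ u) (huS : u ≤ uS) :
    (∫ x in (0:ℝ)..rE, |σ x|) + (∫ x in rE..2, (gP g x / 2 + 2 * Real.log (x / rE))) +
        (∫ x in (2:ℝ)..u, |σ x|) ≤
      u * rho uS + (∫ x in u..uS, qExt x) - excess g + gam g ^ 2 * ∫ x in (2:ℝ)..u, cErr x := by
  have h1 := h.integral_low_le
  have h2 := partial_mass_le hu huS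
  have h3 : ∫ x in (2:ℝ)..u, |σ x| ≤ ∫ x in (2:ℝ)..u, (rho x + cErr x * gam g ^ 2) :=
    intervalIntegral.integral_mono_on hu (h.intervalIntegrable (by norm_num) (by linarith)).abs
      ((intervalIntegrable_rho (by norm_num) (by linarith)).add
        ((intervalIntegrable_cErr (by norm_num) (by linarith)).mul_const _))
      fun x hx => h.abs_sol_le hx.1 (hx.2.trans huS)
  rw [intervalIntegral.integral_add (intervalIntegrable_rho (by norm_num) (by linarith))
    ((intervalIntegrable_cErr (by norm_num) (by linarith)).mul_const _),
    intervalIntegral.integral_mul_const] at h3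
  rw [intervalIntegral.integral_add ((h.norm.isBddMeas_gP.intervalIntegrable _ _).div_const 2)
    (intervalIntegrable_two_log_div rE_pos (by norm_num))]
  linarith

lemma integral_abs_le (h : IsCfg τ g χ σ) {u : ℝ} (hu : 2 ≤ u) (huS : u ≤ uS) :
    ∫ x in (0:ℝ)..u, |σ x| ≤
      u * rho uS + (∫ x in u..uS, qExt x) - excess g + gam g ^ 2 * ∫ x in (2:ℝ)..u, cErr x := by
  have hi : ∀ {a b : ℝ}, 0 ≤ a → 0 ≤ b → IntervalIntegrable (fun x => |σ x|) volume a b :=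
    fun ha hb => (h.intervalIntegrable ha hb).abs
  have h1 : ∫ x in rE..2, |σ x| ≤ ∫ x in rE..2, (gP g x / 2 + 2 * Real.log (x / rE)) :=
    intervalIntegral.integral_mono_on (by linarith [rE_hi]) (hi rE_pos.le (by norm_num))
      (((h.norm.isBddMeas_gP.intervalIntegrable _ _).div_const 2).add
        (intervalIntegrable_two_log_div rE_pos (by norm_num)))
      fun x hx => h.abs_sol_mid hx.1 (by linarith [hx.2, uS_lo])
  rw [← intervalIntegral.integral_add_adjacent_intervals (hi le_rfl (by norm_num : (0:ℝ) ≤ 2))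
    (hi (by norm_num) (by linarith)), ← intervalIntegral.integral_add_adjacent_intervals
    (hi le_rfl rE_pos.le) (hi rE_pos.le (by norm_num))]
  linarith [h.energy_le hu huS]

lemma two_log_mid_le {x : ℝ} (hx : rE ≤ x) (hx2 : x ≤ 2) : 2 * Real.log (x / rE) ≤ 0.4 := by
  rw [log_div_rE (rE_pos.trans_le hx)]
  have := Real.log_le_log (rE_pos.trans_le hx) hx2
  linarith [Real.log_two_lt_d9]

lemma integral_qExt_le {u c : ℝ} (hu : 2 ≤ u) (huS : u ≤ uS) {γ : ℝ} (hq : qExt u ≤ c + cErr u * γ ^ 2) :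
    ∫ x in u..uS, qExt x ≤ (uS - u) * c + γ ^ 2 * ∫ x in u..uS, cErr x := by
  have hr : IntervalIntegrable rho volume u uS := intervalIntegrable_rho (by linarith) (by linarith)
  have hc : IntervalIntegrable cErr volume u uS := intervalIntegrable_cErr (by linarith) (by linarith)
  have : ∫ x in u..uS, qExt x ≤ ∫ x in u..uS, (c + cErr x * γ ^ 2) := by
    refine intervalIntegral.integral_mono_on huS (intervalIntegrable_const.sub hr)
      (intervalIntegrable_const.add (hc.mul_const _)) fun x hx => ?_
    have h1 := qExt_anti hu hx.1 hx.2
    have h2 := mul_le_mul_of_nonneg_right (cErr_mono hu hx.1) (sq_nonneg γ)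
    linarith
  rwa [intervalIntegral.integral_add intervalIntegrable_const (hc.mul_const _),
    intervalIntegral.integral_const, intervalIntegral.integral_mul_const, smul_eq_mul,
    mul_comm _ (γ ^ 2)] at this

lemma integral_cErr_add {u : ℝ} (hu : 2 ≤ u) (huS : u ≤ uS) :
    (∫ x in (2:ℝ)..u, cErr x) + (∫ x in u..uS, cErr x) = (3 - rE) / 6 := by
  rw [intervalIntegral.integral_add_adjacent_intervals
    (intervalIntegrable_cErr (by norm_num) (by linarith))
    (intervalIntegrable_cErr (by linarith) (by linarith)), integral_cErr]

lemma sub_excess_le (h : IsCfg τ g χ σ) : gam g ^ 2 * ((3 - rE) / 6) - excess g ≤ -0.024 * gam g ^ 2 := by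
  have := h.norm.sq_gam_le_excess
  have := mul_nonneg (sq_nonneg (gam g)) (show 0 ≤ 1 / 4 - (3 - rE) / 6 - 0.024 by linarith [rE_lo])
  linarith

lemma integral_abs_le_of_le (h : IsCfg τ g χ σ) {u ε : ℝ} (hu : 2 ≤ u) (huS : u ≤ uS)
    (hs : rho uS - ε ≤ -σ u) :
    ∫ x in (0:ℝ)..u, |σ x| ≤ u * rho uS + (uS - u) * ε - 0.024 * gam g ^ 2 := by
  have h1 := h.integral_abs_le hu huS
  have h2 := integral_qExt_le (c := ε) (γ := gam g) hu huS
    (by rw [qExt]; linarith [h.neg_sol_le hu huS])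
  have h3 := integral_cErr_add hu huS
  have h4 := h.sub_excess_le
  rw [← h3] at h4
  linarith

lemma integral_abs_uS_le (h : IsCfg τ g χ σ) :
    ∫ x in (0:ℝ)..uS, |σ x| ≤ uS * rho uS - 0.024 * gam g ^ 2 := by
  have h1 := h.integral_abs_le (by linarith [uS_lo]) le_rfl
  rw [integral_cErr, intervalIntegral.integral_same] at h1
  linarith [h.sub_excess_le]

lemma average_le (h : IsCfg τ g χ σ) {u v : ℝ} (hu : rE ≤ u) (huv : u ≤ v) :
    u * (∫ x in (0:ℝ)..v, |σ x|) ≤ v * ∫ x in (0:ℝ)..u, |σ x| := by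
  have hv : 0 ≤ v := rE_pos.le.trans (hu.trans huv)
  refine average_antitone (a := rE) (b := v) rE_pos (h.intervalIntegrable le_rfl hv).abs
    (fun x hx => ?_) hu huv le_rfl
  exact (h.sol (max uS x) (le_max_left _ _)).mul_abs_le (rE_pos.le.trans hx.1) (le_max_right _ _)

lemma mul_abs_le (h : IsCfg τ g χ σ) {u : ℝ} (hu : 0 ≤ u) : u * |σ u| ≤ ∫ x in (0:ℝ)..u, |σ x| :=
  (h.sol (max uS u) (le_max_left _ _)).mul_abs_le hu (le_max_right _ _)

/-- The main upper bound. -/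
lemma abs_le_rho (h : IsCfg τ g χ σ) {u : ℝ} (hu : rE ≤ u) : |σ u| ≤ rho uS := by
  have hD := rho_uS_ge
  rcases le_or_gt u uS with huS | huS
  · rcases le_or_gt u 2 with h2 | h2
    · have h1 := two_log_mid_le hu h2
      rw [abs_le]
      constructor <;> linarith [h.sol_le_half_gP hu huS, h.neg_sol_le_log hu huS, h.norm.gP_le_one u]
    · by_contra! hc
      have h3 : rho uS - 0 ≤ -σ u := by
        rcases le_total 0 (σ u) with h0 | h0
        · rw [abs_of_nonneg h0] at hc
          linarith [h.sol_le_half_gP hu huS, h.norm.gP_le_one u]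
        · rw [abs_of_nonpos h0] at hc
          linarith
      have h4 := h.integral_abs_le_of_le h2.le huS h3
      have h5 := h.mul_abs_le (u := u) (by linarith)
      have h6 : u * rho uS < u * |σ u| := mul_lt_mul_of_pos_left hc (by linarith)
      linarith [sq_nonneg (gam g)]
  · have hS := uS_lo
    have h1 := h.average_le (by linarith [rE_hi]) huS.le
    have h2 := h.integral_abs_uS_le
    have h3 := h.mul_abs_le (u := u) (by linarith)
    have h4 : u * ∫ x in (0:ℝ)..uS, |σ x| ≤ u * (uS * rho uS) :=
      mul_le_mul_of_nonneg_left (by linarith [sq_nonneg (gam g)]) (by linarith)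
    have h5 := mul_le_mul_of_nonneg_left h3 (show 0 ≤ uS by linarith)
    have h6 : uS * u * |σ u| ≤ uS * u * rho uS := by linarith
    exact le_of_mul_le_mul_left h6 (mul_pos (by linarith) (by linarith))

end IsCfg

namespace IsNorm

variable {τ : ℝ} {g : ℝ → ℝ}

lemma gam_eq (g : ℝ → ℝ) : gam g = ∫ t in (0:ℝ)..1, g t := by
  rw [gam, piece, integral_indicator measurableSet_Ioc, intervalIntegral.integral_of_le zero_le_one]

lemma ii (h : IsNorm τ g) (a b : ℝ) : IntervalIntegrable g volume a b :=
  h.gap.isKernel.2.intervalIntegrable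

lemma ii_two_div {a b : ℝ} (ha : 0 < a) (hb : 0 < b) :
    IntervalIntegrable (fun t : ℝ => 2 / t) volume a b := by
  refine ContinuousOn.intervalIntegrable (continuousOn_const.div continuousOn_id fun x hx => ?_)
  have : 0 < x := by rcases Set.mem_uIcc.1 hx with h | h <;> linarith [h.1]
  exact this.ne'

lemma le_two_div (h : IsNorm τ g) {t : ℝ} (ht : 0 < t) : g t ≤ 2 / t := by
  rw [le_div_iff₀ ht, mul_comm]
  exact h.gap.mul_le t

lemma integral_two_div {a b : ℝ} (ha : 0 < a) (hb : 0 < b) :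
    ∫ t in a..b, 2 / t = 2 * Real.log (b / a) := by
  simp_rw [div_eq_mul_one_div (2:ℝ)]
  rw [intervalIntegral.integral_const_mul, integral_one_div_of_pos ha hb]

lemma integral_compl_eq (h : IsNorm τ g) : ∫ t in (1:ℝ)..rE, (2 / t - g t) = gam g := by
  have h1 := h.mass
  rw [cv_heav h.gap.left_zero rE_pos.le,
    ← intervalIntegral.integral_add_adjacent_intervals (h.ii 0 1) (h.ii 1 rE), ← gam_eq] at h1
  rw [intervalIntegral.integral_sub (ii_two_div one_pos rE_pos) (h.ii _ _),
    integral_two_div one_pos rE_pos, div_one, log_rE]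
  linarith

lemma integral_compl_le (h : IsNorm τ g) {a b : ℝ} (ha : 1 ≤ a) (hab : a ≤ b) (hb : b ≤ rE) :
    ∫ t in a..b, (2 / t - g t) ≤ gam g := by
  rw [← h.integral_compl_eq]
  refine intervalIntegral.integral_mono_interval ha hab hb ?_
    ((ii_two_div one_pos rE_pos).sub (h.ii _ _))
  refine (ae_restrict_iff' measurableSet_Ioc).2 (.of_forall fun t ht => ?_)
  exact sub_nonneg.2 (h.le_two_div (one_pos.trans ht.1))

lemma gG_le (h : IsNorm τ g) {x b : ℝ} (hb : 1 ≤ b) (hx : x ≤ b) : gG g x ≤ gam g + 2 * (b - 1) := by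
  have h1 := h.gG_mono hx
  rw [h.gG_eq_add hb] at h1
  linarith [h.cv_mid_le_log hb, Real.log_le_sub_one_of_pos (show 0 < b by linarith)]

lemma gP_le_two_gam (h : IsNorm τ g) {x : ℝ} (hx : x ≤ 2) : gP g x ≤ 2 * gam g := by
  have hA := h.isKernel_piece 0 1
  have hB := h.isKernel_piece 1 rE
  have hG := h.isBddMeas_gG
  have e1 : gP g x ≤ 1 * gam g + gam g * (1 - gam g) := by
    rw [gP, ← h.low_add, cv_add_left hA hB hG]
    refine add_le_add (cv_le_mul hA (h.piece_nonneg _ _) hG fun t _ => h.gG_le_one _) ?_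
    rw [← h.integral_mid]
    refine cv_le_mul hB (h.piece_nonneg _ _) hG fun t ht => ?_
    have := h.gG_le le_rfl (show x - t ≤ 1 by linarith [(mem_of_piece_ne_zero ht).1])
    linarith
  nlinarith [h.gam_nonneg]

end IsNorm

namespace IsCfg

variable {τ : ℝ} {g χ σ : ℝ → ℝ}

lemma abs_chi (h : IsCfg τ g χ σ) {t : ℝ} (ht : 0 < t) : |χ t| ≤ 1 :=
  (h.sol (max uS t) (le_max_left _ _)).abs_chi t ⟨ht, le_max_right _ _⟩

lemma intervalIntegrable_chi (h : IsCfg τ g χ σ) {a b : ℝ} (ha : 0 ≤ a) (hb : 0 ≤ b) :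
    IntervalIntegrable χ volume a b := by
  rw [intervalIntegrable_iff]
  refine Measure.integrableOn_of_bounded (M := 1) (by simp)
    (h.sol uS le_rfl).meas_chi.aestronglyMeasurable ?_
  refine (ae_restrict_iff' measurableSet_uIoc).2 (.of_forall fun t ht => ?_)
  exact h.abs_chi ((le_min ha hb).trans_lt ht.1)

lemma sol_ge' (h : IsCfg τ g χ σ) {x b : ℝ} (hx : 0 ≤ x) (hxb : x ≤ b) (hb : 1 ≤ b) (hbE : b ≤ rE) :
    1 - gam g - 2 * (b - 1) ≤ σ x := by
  linarith [h.sol_ge hx (hxb.trans hbE), h.norm.gG_le hb hxb]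

/-- A lower bound for the integrand of the defect integrates to a lower bound for the defect. -/
lemma integral_le_defect (h : IsCfg τ g χ σ) {c : ℝ} (hc : |c| ≤ 1) {a b u : ℝ} (ha : 0 < a)
    (hab : a ≤ b) (hbu : b ≤ u) {f : ℝ → ℝ} (hf : IntervalIntegrable f volume a b)
    (hle : ∀ t ∈ Set.Icc a b, f t ≤ |σ (u - t)| + c * (σ (u - t) * χ t)) :
    ∫ t in a..b, f t ≤ (∫ t in (0:ℝ)..u, |σ t|) + c * (u * σ u) := by
  have hu : 0 < u := by linarith
  have hs := h.sol (max uS u) (le_max_left _ _)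
  have i1 := intervalIntegrable_comp_sub (h.intervalIntegrable le_rfl hu.le)
  have i2 := intervalIntegrable_mul_bdd hu.le i1 hs.meas_chi fun t ht => h.abs_chi ht.1
  have i3 := i1.abs.add (i2.const_mul c)
  have hsub : Set.uIcc a b ⊆ Set.uIcc 0 u := by
    rw [Set.uIcc_of_le hab, Set.uIcc_of_le hu.le]
    exact Set.Icc_subset_Icc ha.le hbu
  calc ∫ t in a..b, f t ≤ ∫ t in a..b, (|σ (u - t)| + c * (σ (u - t) * χ t)) :=
        intervalIntegral.integral_mono_on hab hf (i3.mono_set hsub) hle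
    _ ≤ ∫ t in (0:ℝ)..u, (|σ (u - t)| + c * (σ (u - t) * χ t)) := by
        refine intervalIntegral.integral_mono_interval ha.le hab hbu ?_ i3
        refine (ae_restrict_iff' measurableSet_Ioc).2 (.of_forall fun t ht => ?_)
        have h1 : |c * (σ (u - t) * χ t)| ≤ 1 * (|σ (u - t)| * 1) := by
          rw [abs_mul, abs_mul]
          exact mul_le_mul hc (mul_le_mul_of_nonneg_left (h.abs_chi ht.1) (abs_nonneg _))
            (by positivity) zero_le_one
        have := (abs_le.1 h1).1
        show 0 ≤ |σ (u - t)| + c * (σ (u - t) * χ t)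
        linarith
    _ = _ := by
        rw [intervalIntegral.integral_add i1.abs (i2.const_mul c),
          intervalIntegral.integral_const_mul, hs.eqn u hu (le_max_right _ _),
          intervalIntegral.integral_comp_sub_left (fun t => |σ t|) u]
        simp

lemma two_lt (h : IsCfg τ g χ σ) {u ε : ℝ} (hu : 0 ≤ u) (hε : ε ≤ 0.05) (hs : rho uS - ε ≤ -σ u) :
    2 < u := by
  by_contra! h2
  have hD := rho_uS_ge
  rcases le_total u rE with h1 | h1
  · linarith [h.sol_nonneg hu h1]
  · linarith [h.neg_sol_le_log h1 (by linarith [uS_lo]), two_log_mid_le h1 h2]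

lemma integral_abs_le_mul (h : IsCfg τ g χ σ) {u : ℝ} (hu : uS ≤ u) :
    uS * (∫ x in (0:ℝ)..u, |σ x|) ≤ u * (uS * rho uS - 0.024 * gam g ^ 2) :=
  (h.average_le (by linarith [rE_hi, uS_lo]) hu).trans
    (mul_le_mul_of_nonneg_left h.integral_abs_uS_le (by linarith [uS_lo]))

lemma sq_gam_le_of_ge (h : IsCfg τ g χ σ) {u ε : ℝ} (hu : uS ≤ u) (hs : rho uS - ε ≤ |σ u|) :
    gam g ^ 2 ≤ 111 * ε := by
  have hS := uS_lo
  have h1 := h.integral_abs_le_mul hu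
  have h2 := mul_le_mul_of_nonneg_left (h.mul_abs_le (u := u) (by linarith)) (show 0 ≤ uS by linarith)
  have h3 := mul_le_mul_of_nonneg_left hs (show 0 ≤ uS * u by nlinarith)
  have h4 : u * (0.024 * gam g ^ 2) ≤ u * (uS * ε) := by linarith
  have h5 := le_of_mul_le_mul_left h4 (by linarith)
  have h6 : 0 ≤ uS * ε := le_trans (by positivity) h5
  have h7 : 0 ≤ ε := nonneg_of_mul_nonneg_right h6 (by linarith)
  nlinarith [uS_hi]

lemma sq_gam_le (h : IsCfg τ g χ σ) {u ε : ℝ} (hu : 2 ≤ u) (hs : rho uS - ε ≤ -σ u) :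
    gam g ^ 2 ≤ 111 * ε := by
  rcases le_total uS u with h1 | h1
  · exact h.sq_gam_le_of_ge h1 (hs.trans (neg_le_abs _))
  · have h2 := h.integral_abs_le_of_le hu h1 hs
    have h3 := h.mul_abs_le (u := u) (by linarith)
    have h4 := mul_le_mul_of_nonneg_left (hs.trans (neg_le_abs (σ u))) (show 0 ≤ u by linarith)
    have h5 : 0.024 * gam g ^ 2 ≤ uS * ε := by linarith
    have h6 : 0 ≤ uS * ε := le_trans (by positivity) h5
    have h7 : 0 ≤ ε := nonneg_of_mul_nonneg_right h6 (by linarith)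
    nlinarith [uS_hi]

lemma gam_le {g : ℝ → ℝ} {ε : ℝ} (h : gam g ^ 2 ≤ 111 * ε) : gam g ≤ 11 * √ε := by
  have h0 : 0 ≤ ε := by nlinarith [sq_nonneg (gam g)]
  refine abs_le_of_sq_le_sq' ?_ (by positivity) |>.2
  rw [mul_pow, Real.sq_sqrt h0]
  linarith

lemma gam_le_of_le {g : ℝ → ℝ} {ε : ℝ} (h : gam g ^ 2 ≤ 111 * ε) (hε : ε ≤ 1 / 10 ^ 6) :
    gam g ≤ 0.011 := by
  refine abs_le_of_sq_le_sq' ?_ (by norm_num) |>.2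
  norm_num at *
  linarith

lemma integral_abs_le_add (h : IsCfg τ g χ σ) {u ε : ℝ} (hu : 2 ≤ u) (hε : 0 ≤ ε)
    (hs : rho uS - ε ≤ -σ u) : ∫ x in (0:ℝ)..u, |σ x| ≤ u * rho uS + ε := by
  rcases le_total uS u with h1 | h1
  · have h2 := h.integral_abs_le_mul h1
    have h3 : uS * (∫ x in (0:ℝ)..u, |σ x|) ≤ uS * (u * rho uS) := by
      nlinarith [mul_nonneg (show 0 ≤ u by linarith) (sq_nonneg (gam g))]
    linarith [le_of_mul_le_mul_left h3 (by linarith [uS_lo])]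
  · have h2 := h.integral_abs_le_of_le hu h1 hs
    nlinarith [uS_hi, sq_nonneg (gam g)]

lemma defect_le (h : IsCfg τ g χ σ) {u ε : ℝ} (hu : 2 ≤ u) (huS : u ≤ uS + 0.3) (hε : 0 ≤ ε)
    (hs : rho uS - ε ≤ -σ u) : (∫ x in (0:ℝ)..u, |σ x|) + 1 * (u * σ u) ≤ 4 * ε := by
  have h1 := h.integral_abs_le_add hu hε hs
  have h2 := mul_le_mul_of_nonneg_left hs (show 0 ≤ u by linarith)
  nlinarith [uS_hi]

lemma integral_one_add_chi_le (h : IsCfg τ g χ σ) {u ε : ℝ} (hu : 2 ≤ u) (huS : u ≤ uS + 0.3)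
    (hε : 0 ≤ ε) (hε1 : ε ≤ 1 / 10 ^ 6) (hs : rho uS - ε ≤ -σ u) :
    ∫ t in rE..u, (1 + χ t) ≤ 11 * ε := by
  have hγ := gam_le_of_le (h.sq_gam_le hu hs) hε1
  have hi : IntervalIntegrable (fun t => 1 + χ t) volume rE u :=
    intervalIntegrable_const.add (h.intervalIntegrable_chi rE_pos.le (by linarith))
  have h1 := h.integral_le_defect (c := 1) (by simp) rE_pos (by linarith [rE_hi]) le_rfl
    (hi.const_mul 0.38) (u := u) fun t ht => by
      have ht0 : 0 < t := rE_pos.trans_le ht.1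
      have h2 := h.sol_ge' (x := u - t) (b := 1.3) (by linarith [ht.2])
        (by rw [uS] at huS; linarith [ht.1]) (by norm_num) (by linarith [rE_lo])
      have h3 : 0.38 ≤ σ (u - t) := by linarith
      rw [abs_of_nonneg (by linarith)]
      have h4 := (abs_le.1 (h.abs_chi ht0)).1
      nlinarith
  rw [intervalIntegral.integral_const_mul] at h1
  linarith [h.defect_le hu huS hε hs]

lemma sub_le_of_le (h : IsCfg τ g χ σ) {u ε : ℝ} (hu : 2 ≤ u) (huS : u ≤ uS)
    (hs : rho uS - ε ≤ -σ u) : uS - u ≤ 45 * √ε := by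
  have hγ := h.sq_gam_le hu hs
  have h0 : 0 ≤ ε := by nlinarith [sq_nonneg (gam g)]
  have h1 := h.neg_sol_le hu huS
  have h2 := qExt_ge hu huS
  have h3 := mul_le_mul_of_nonneg_right (cErr_le_half hu huS) (sq_nonneg (gam g))
  rw [qExt] at h2
  refine abs_le_of_sq_le_sq' ?_ (by positivity) |>.2
  rw [mul_pow, Real.sq_sqrt h0]
  linarith

lemma integral_gap_le (h : IsCfg τ g χ σ) {u ε : ℝ} (huS : uS ≤ u) (hs : rho uS - ε ≤ -σ u) :
    ∫ x in rE..2, (gP g x / 2 + 2 * Real.log (x / rE) - |σ x|) ≤ uS * ε := by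
  have hS := uS_lo
  have hE := rE_pos
  have hi : ∀ {a b : ℝ}, 0 ≤ a → 0 ≤ b → IntervalIntegrable (fun x => |σ x|) volume a b :=
    fun ha hb => (h.intervalIntegrable ha hb).abs
  have h1 := h.energy_le (by linarith) le_rfl
  rw [integral_cErr, intervalIntegral.integral_same] at h1
  have h2 := h.sub_excess_le
  have h3 := h.average_le (by linarith [rE_hi]) huS
  have h4 := h.mul_abs_le (u := u) (by linarith)
  have h5 := mul_le_mul_of_nonneg_left (hs.trans (neg_le_abs (σ u))) (show 0 ≤ u by linarith)
  have h6 : u * (uS * (rho uS - ε)) ≤ u * ∫ x in (0:ℝ)..uS, |σ x| := by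
    have := mul_le_mul_of_nonneg_left (h5.trans h4) (show 0 ≤ uS by linarith)
    linarith
  have h7 := le_of_mul_le_mul_left h6 (by linarith)
  rw [← intervalIntegral.integral_add_adjacent_intervals (hi le_rfl (by norm_num : (0:ℝ) ≤ 2))
    (hi (by norm_num) (by linarith)), ← intervalIntegral.integral_add_adjacent_intervals
    (hi le_rfl hE.le) (hi hE.le (by norm_num))] at h7
  rw [intervalIntegral.integral_sub (((h.norm.isBddMeas_gP.intervalIntegrable _ _).div_const 2).add
    (intervalIntegrable_two_log_div hE (by norm_num))) (hi hE.le (by norm_num))]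
  nlinarith [sq_nonneg (gam g)]

lemma neg_sol_ge (h : IsCfg τ g χ σ) {x : ℝ} (hx : rE ≤ x) (hx2 : x ≤ 2) :
    2 * Real.log (x / rE) - (gP g x / 2 + 2 * Real.log (x / rE) - |σ x|) - gam g ≤ -σ x := by
  have h1 := h.norm.gP_le_two_gam hx2
  have h2 := h.sol_le_half_gP hx (by linarith [uS_lo])
  rcases le_total 0 (σ x) with h3 | h3
  · rw [abs_of_nonneg h3]; linarith [h.norm.gP_nonneg x]
  · rw [abs_of_nonpos h3]; linarith [h.norm.gP_nonneg x, h.norm.gam_nonneg]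

lemma sub_le_of_ge (h : IsCfg τ g χ σ) {u ε : ℝ} (hu : uS ≤ u) (huS : u ≤ uS + 0.3)
    (hε : 0 ≤ ε) (hs : rho uS - ε ≤ -σ u) : u - uS ≤ 45 * √ε := by
  have hS := uS_lo
  have hE := rE_lo
  have hE' := rE_hi
  have hγ := gam_le (h.sq_gam_le (by linarith) hs)
  have hγ0 := h.norm.gam_nonneg
  set d := u - uS with hd
  have hd0 : 0 ≤ d := by linarith
  have hud : u = 1 + d + rE := by rw [hd, uS]; ring
  set f : ℝ → ℝ := fun x => gP g x / 2 + 2 * Real.log (x / rE) - |σ x| with hf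
  have hfi : IntervalIntegrable f volume rE 2 :=
    ((((h.norm.isBddMeas_gP.intervalIntegrable _ _).div_const 2).add
    (intervalIntegrable_two_log_div rE_pos (by norm_num))).sub
      (h.intervalIntegrable rE_pos.le (by norm_num)).abs)
  have hfi' : IntervalIntegrable f volume rE (rE + d) := hfi.mono_set (by
    rw [Set.uIcc_of_le (by linarith), Set.uIcc_of_le (by linarith)]
    exact Set.Icc_subset_Icc_right (by linarith))
  have hfint : ∫ t in (1:ℝ)..(1 + d), f (u - t) ≤ uS * ε := by
    rw [intervalIntegral.integral_comp_sub_left f u, show u - (1 + d) = rE by rw [hud]; ring,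
      show u - 1 = rE + d by rw [hud]; ring]
    refine (intervalIntegral.integral_mono_interval le_rfl (by linarith) (by linarith) ?_ hfi).trans
      (h.integral_gap_le hu hs)
    refine (ae_restrict_iff' measurableSet_Ioc).2 (.of_forall fun t ht => ?_)
    exact sub_nonneg.2 (h.abs_sol_mid ht.1.le (by linarith [ht.2]))
  have hfi'' : IntervalIntegrable (fun t => f (u - t)) volume 1 (1 + d) := by
    have := hfi'.comp_sub_left u
    rw [show u - rE = 1 + d by rw [hud]; ring, show u - (rE + d) = 1 by rw [hud]; ring] at this
    exact this.symm
  have hki : IntervalIntegrable (fun t => 2 / t - g t) volume 1 (1 + d) :=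
    (IsNorm.ii_two_div one_pos (by linarith)).sub (h.norm.ii _ _)
  have hli : IntervalIntegrable (fun t => 2 * (1 + d - t)) volume 1 (1 + d) :=
    Continuous.intervalIntegrable (by fun_prop) _ _
  have key := h.integral_le_defect (c := 1) (by simp) one_pos (b := 1 + d) (by linarith)
    (u := u) (by linarith)
    (f := fun t => 2 * (1 + d - t) - 2 * d * (2 / t - g t) - 2 * f (u - t) - 2 * gam g)
    (((hli.sub (hki.const_mul _)).sub (hfi''.const_mul 2)).sub intervalIntegrable_const)
    fun t ht => by
      have ht0 : 0 < t := one_pos.trans_le ht.1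
      set v := u - t with hv
      have hvE : rE ≤ v := by rw [hv, hud]; linarith [ht.2]
      have hv2 : v ≤ 2 := by rw [hv, hud]; linarith [ht.1]
      have h1 := h.neg_sol_ge hvE hv2
      change 2 * Real.log (v / rE) - f v - gam g ≤ _ at h1
      have hc := abs_le.1 (h.abs_chi ht0)
      have hg : 1 + χ t = t * (2 / t - g t) := by
        rw [h.chi t ⟨ht0, by linarith [ht.2]⟩]; field_simp; ring
      have hk0 : 0 ≤ 2 / t - g t := sub_nonneg.2 (h.norm.le_two_div ht0)
      have hf0 : 0 ≤ f v := sub_nonneg.2 (h.abs_sol_mid hvE (by linarith))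
      have hl1 : (v - rE) / 2 ≤ Real.log (v / rE) := by
        have h2 := Real.one_sub_inv_le_log_of_pos (div_pos (rE_pos.trans_le hvE) rE_pos)
        rw [inv_div] at h2
        have h3 : (v - rE) / 2 ≤ 1 - rE / v := by
          rw [one_sub_div (rE_pos.trans_le hvE).ne']
          exact div_le_div_of_nonneg_left (by linarith) (by linarith) hv2
        linarith
      have hl2 : Real.log (v / rE) ≤ d / rE := by
        have h2 := Real.log_le_sub_one_of_pos (div_pos (rE_pos.trans_le hvE) rE_pos)
        have h3 : v / rE - 1 ≤ d / rE := by
          rw [div_sub_one rE_pos.ne']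
          exact div_le_div_of_nonneg_right (by rw [hv, hud]; linarith [ht.1]) rE_pos.le
        linarith
      have hl0 : 0 ≤ Real.log (v / rE) := le_trans (by linarith) hl1
      have h5 : Real.log (v / rE) * (1 + χ t) ≤ d * (2 / t - g t) := by
        rw [hg]
        have h6 : t ≤ rE := by linarith [ht.2]
        have h7 : Real.log (v / rE) * t ≤ d := by
          calc Real.log (v / rE) * t ≤ d / rE * rE :=
                mul_le_mul hl2 h6 ht0.le (div_nonneg hd0 rE_pos.le)
            _ = d := div_mul_cancel₀ _ rE_pos.ne'
        rw [← mul_assoc]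
        exact mul_le_mul_of_nonneg_right h7 hk0
      have h8 := mul_le_mul_of_nonneg_right h1 (show 0 ≤ 1 - χ t by linarith)
      have h9 := neg_abs_le (σ v)
      have h10 : (1 - χ t) * (f v + gam g) ≤ 2 * (f v + gam g) :=
        mul_le_mul_of_nonneg_right (by linarith) (by linarith)
      have h11 : v - rE = 1 + d - t := by rw [hv, hud]; ring
      have h12 := neg_abs_le (σ v)
      linarith
  rw [intervalIntegral.integral_sub ((hli.sub (hki.const_mul _)).sub (hfi''.const_mul 2))
    intervalIntegrable_const, intervalIntegral.integral_sub (hli.sub (hki.const_mul _))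
    (hfi''.const_mul 2), intervalIntegral.integral_sub hli (hki.const_mul _),
    intervalIntegral.integral_const_mul, intervalIntegral.integral_const_mul,
    intervalIntegral.integral_const_mul, intervalIntegral.integral_const] at key
  have hl : ∫ t in (1:ℝ)..(1 + d), (1 + d - t) = d ^ 2 / 2 := by
    rw [intervalIntegral.integral_comp_sub_left (fun t => t) (1 + d)]
    simp [integral_id]
  rw [hl, smul_eq_mul] at key
  have hk := h.norm.integral_compl_le le_rfl (show 1 ≤ 1 + d by linarith) (by linarith)
  have hdef := h.defect_le (by linarith) huS hε hs
  have hk2 := mul_le_mul_of_nonneg_left hk hd0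
  have hfin : d ^ 2 ≤ 10 * ε + 44 * √ε * d := by
    have := mul_le_mul_of_nonneg_right hγ hd0
    nlinarith [uS_hi]
  have hq := Real.sq_sqrt hε
  by_contra! hcon
  nlinarith [Real.sqrt_nonneg ε]

lemma abs_sub_le (h : IsCfg τ g χ σ) {u ε : ℝ} (hu : 2 ≤ u) (huS : u ≤ uS + 0.3) (hε : 0 ≤ ε)
    (hs : rho uS - ε ≤ -σ u) : |u - uS| ≤ 45 * √ε := by
  rw [abs_le]
  rcases le_total u uS with h1 | h1
  · constructor <;> linarith [h.sub_le_of_le hu h1 hs, Real.sqrt_nonneg ε]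
  · constructor <;> linarith [h.sub_le_of_ge h1 huS hε hs, Real.sqrt_nonneg ε]

lemma sol_lt_of_pos (h : IsCfg τ g χ σ) {w : ℝ} (hw : uS + 0.1 ≤ w) (hwS : w ≤ uS + 0.3) :
    σ w < rho uS - 1 / 10 ^ 6 := by
  by_contra! hc
  have hS := uS_lo
  have hS' := uS_hi
  have hE := rE_lo
  have hE' := rE_hi
  have hγ := gam_le_of_le (h.sq_gam_le_of_ge (by linarith) (hc.trans (le_abs_self _))) le_rfl
  have hi : IntervalIntegrable (fun t => 1 - χ t) volume (rE - 0.1) rE :=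
    intervalIntegrable_const.sub (h.intervalIntegrable_chi (by linarith) (by linarith))
  have h1 := h.integral_le_defect (c := -1) (by simp) (a := rE - 0.1) (b := rE) (by linarith)
    (by linarith) (show rE ≤ w by linarith) (hi.const_mul 0.18) fun t ht => by
      have ht0 : 0 < t := by linarith [ht.1]
      have h2 := h.sol_ge' (x := w - t) (b := 1.4) (by linarith [ht.2])
        (by rw [uS] at hwS; linarith [ht.1]) (by norm_num) (by linarith [rE_lo])
      have h3 : 0.18 ≤ σ (w - t) := by linarith
      rw [abs_of_nonneg (by linarith)]
      have h4 := (abs_le.1 (h.abs_chi ht0)).2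
      nlinarith
  rw [intervalIntegral.integral_const_mul] at h1
  have h2 : ∫ t in (rE - 0.1)..rE, (1.5 * (2 / rE) - 1.5 * (2 / t - g t)) ≤
      ∫ t in (rE - 0.1)..rE, (1 - χ t) := by
    refine intervalIntegral.integral_mono_on (by linarith) (intervalIntegrable_const.sub
      (((IsNorm.ii_two_div (by linarith) (by linarith)).sub (h.norm.ii _ _)).const_mul _)) hi
      fun t ht => ?_
    have ht0 : 0 < t := by linarith [ht.1]
    rw [h.chi t ⟨ht0, by linarith [ht.2]⟩]
    have h3 : 2 / rE ≤ 2 / t := div_le_div_of_nonneg_left (by norm_num) ht0 ht.2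
    have h4 : 1.5 * g t ≤ t * g t :=
      mul_le_mul_of_nonneg_right (by linarith [ht.1]) (h.norm.gap.nonneg t)
    linarith
  rw [intervalIntegral.integral_sub intervalIntegrable_const
      (((IsNorm.ii_two_div (by linarith) (by linarith)).sub (h.norm.ii _ _)).const_mul _),
    intervalIntegral.integral_const_mul, intervalIntegral.integral_const, smul_eq_mul] at h2
  have h3 := h.norm.integral_compl_le (show 1 ≤ rE - 0.1 by linarith) (by linarith) le_rfl
  have h4 : (1.2 : ℝ) ≤ 2 / rE := by rw [le_div_iff₀ rE_pos]; linarith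
  have h5 := h.average_le (show rE ≤ uS by linarith) (show uS ≤ w by linarith)
  have h6 := h.integral_abs_uS_le
  have h7 : uS * (∫ x in (0:ℝ)..w, |σ x|) ≤ uS * (w * rho uS) := by
    have := mul_le_mul_of_nonneg_left (h6.trans (sub_le_self _ (by positivity)))
      (show 0 ≤ w by linarith)
    linarith
  have h8 := le_of_mul_le_mul_left h7 (by linarith)
  have h9 := mul_le_mul_of_nonneg_left hc (show 0 ≤ w by linarith)
  norm_num at *
  linarith

lemma abs_lt_of_far (h : IsCfg τ g χ σ) {w : ℝ} (hw : uS + 0.1 ≤ w) (hwS : w ≤ uS + 0.3) :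
    |σ w| ≤ rho uS - 1 / 10 ^ 6 := by
  refine abs_le.2 ⟨?_, (h.sol_lt_of_pos hw hwS).le⟩
  by_contra! hc
  have h1 := h.abs_sub_le (u := w) (ε := 1 / 10 ^ 6) (by linarith [uS_lo]) hwS (by norm_num)
    (by linarith)
  rw [show √(1 / 10 ^ 6 : ℝ) = 1 / 10 ^ 3 by
    rw [Real.sqrt_eq_iff_mul_self_eq (by norm_num) (by norm_num)]; norm_num] at h1
  have := (abs_le.1 h1).2
  norm_num at *
  linarith

lemma le_of_near (h : IsCfg τ g χ σ) {u ε : ℝ} (hu : 0 ≤ u) (hε : ε ≤ 1 / 10 ^ 8)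
    (hs : rho uS - ε ≤ -σ u) : u ≤ uS + 0.3 := by
  by_contra! hc
  have hS := uS_lo
  have hS' := uS_hi
  set w := uS + 0.3 with hw
  have h1 := h.average_le (u := uS) (v := uS + 0.1) (by linarith [rE_hi]) (by linarith)
  have h2 := mul_le_mul_of_nonneg_left (h.integral_abs_uS_le.trans (sub_le_self _ (by positivity)))
    (show 0 ≤ uS + 0.1 by linarith)
  have h3 : uS * (∫ x in (0:ℝ)..(uS + 0.1), |σ x|) ≤ uS * ((uS + 0.1) * rho uS) := by linarith
  have h4 := le_of_mul_le_mul_left h3 (by linarith)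
  have h5 : ∫ x in (uS + 0.1)..w, |σ x| ≤ ∫ x in (uS + 0.1)..w, (rho uS - 1 / 10 ^ 6) :=
    intervalIntegral.integral_mono_on (by linarith)
      (h.intervalIntegrable (by linarith) (by linarith)).abs intervalIntegrable_const
      fun x hx => h.abs_lt_of_far hx.1 hx.2
  rw [intervalIntegral.integral_const, smul_eq_mul] at h5
  have h6 := intervalIntegral.integral_add_adjacent_intervals
    (h.intervalIntegrable le_rfl (show 0 ≤ uS + 0.1 by linarith)).abs
    (h.intervalIntegrable (show 0 ≤ uS + 0.1 by linarith) (show 0 ≤ w by linarith)).abs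
  have h7 := h.average_le (show rE ≤ w by linarith [rE_hi]) hc.le
  have h8 := h.mul_abs_le hu
  have h9 := mul_le_mul_of_nonneg_left (hs.trans (neg_le_abs (σ u))) hu
  have h10 := mul_le_mul_of_nonneg_left (h9.trans h8) (show 0 ≤ w by linarith)
  have h11 : u * (w * (rho uS - ε)) ≤ u * ∫ x in (0:ℝ)..w, |σ x| := by linarith
  have h12 := le_of_mul_le_mul_left h11 (by linarith)
  have h13 := mul_le_mul_of_nonneg_left hε (show 0 ≤ w by linarith)
  norm_num at *
  linarith

/-- Stability of the extremal configuration. -/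
lemma stability (h : IsCfg τ g χ σ) {u ε : ℝ} (hu : 0 ≤ u) (hε : 0 ≤ ε) (hε1 : ε ≤ 1 / 10 ^ 8)
    (hs : rho uS - ε ≤ -σ u) :
    |u - uS| ≤ 45 * √ε ∧
      (∫ t in τ..(u / uS), (1 - χ t) / t) + (∫ t in (u / uS)..u, (1 + χ t) / t) ≤ 200 * √ε := by
  have hS := uS_lo
  have hS' := uS_hi
  have hE := rE_lo
  have hE' := rE_hi
  have hε2 : ε ≤ 1 / 10 ^ 6 := hε1.trans (by norm_num)
  have hu2 := (h.two_lt hu (hε1.trans (by norm_num)) hs).le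
  have huS := h.le_of_near hu hε1 hs
  have hd := h.abs_sub_le hu2 huS hε hs
  refine ⟨hd, ?_⟩
  have hγ := gam_le (h.sq_gam_le hu2 hs)
  have hsq := Real.sq_sqrt hε
  have hs0 := Real.sqrt_nonneg ε
  have hs1 : √ε ≤ 1 / 10 ^ 4 := by
    refine abs_le_of_sq_le_sq' ?_ (by norm_num) |>.2
    rw [hsq]; norm_num at *; linarith
  set x := u / uS with hx
  have hxu : x * uS = u := div_mul_cancel₀ _ (by linarith)
  have hx1 : |x - 1| ≤ 20 * √ε := by
    have h1 : |x - 1| * uS = |u - uS| := by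
      rw [← hxu, ← sub_one_mul, abs_mul, abs_of_pos (show 0 < uS by linarith)]
    nlinarith [abs_nonneg (x - 1)]
  obtain ⟨hx2, hx3⟩ := abs_le.1 hx1
  have hx9 : 0.9 ≤ x := by linarith
  have hxE : x ≤ rE := by linarith
  have hτ := h.norm.gap.pos
  have hτ1 := h.norm.le_one
  have e1 : ∫ t in τ..x, (1 - χ t) / t = ∫ t in τ..x, g t := by
    refine intervalIntegral.integral_congr fun t ht => ?_
    have ht0 : 0 < t := by rcases Set.mem_uIcc.1 ht with h | h <;> linarith [h.1]
    have ht1 : t ≤ uS := by rcases Set.mem_uIcc.1 ht with h | h <;> linarith [h.2]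
    simp only [h.chi t ⟨ht0, ht1⟩]
    field_simp
    ring
  have e2 : ∫ t in (0:ℝ)..τ, g t = 0 := by
    rw [intervalIntegral.integral_congr (g := fun _ => 0) fun t ht => ?_]
    · simp
    · rw [Set.uIcc_of_le hτ.le] at ht
      exact h.norm.gap.left t ht.2
  have e3 := intervalIntegral.integral_add_adjacent_intervals (h.norm.ii 0 τ) (h.norm.ii τ x)
  have e4 := intervalIntegral.integral_add_adjacent_intervals (h.norm.ii 0 1) (h.norm.ii 1 x)
  have e5 : ∫ t in (1:ℝ)..x, g t ≤ 2 * |x - 1| := by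
    rcases le_total 1 x with h1 | h1
    · have h2 : ∫ t in (1:ℝ)..x, g t ≤ ∫ t in (1:ℝ)..x, 2 / t :=
        intervalIntegral.integral_mono_on h1 (h.norm.ii _ _)
          (IsNorm.ii_two_div one_pos (by linarith)) fun t ht => h.norm.le_two_div (by linarith [ht.1])
      rw [IsNorm.integral_two_div one_pos (by linarith), div_one] at h2
      linarith [Real.log_le_sub_one_of_pos (show 0 < x by linarith), le_abs_self (x - 1)]
    · rw [intervalIntegral.integral_symm]
      have := intervalIntegral.integral_nonneg h1 (μ := volume) fun t _ => h.norm.gap.nonneg t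
      linarith [abs_nonneg (x - 1)]
  have hci : ∀ {a b : ℝ}, 0 < a → 0 < b → IntervalIntegrable (fun t => (1 + χ t) / t) volume a b := by
    intro a b ha hb
    simp_rw [div_eq_mul_inv]
    refine (intervalIntegrable_const.add (h.intervalIntegrable_chi ha.le hb.le)).mul_continuousOn
      (continuousOn_id.inv₀ fun t ht => ?_)
    have : 0 < t := by rcases Set.mem_uIcc.1 ht with h | h <;> linarith [h.1]
    exact this.ne'
  have hc0 : ∀ {t : ℝ}, 0 < t → 0 ≤ (1 + χ t) / t := fun {t} ht =>
    div_nonneg (by linarith [(abs_le.1 (h.abs_chi ht)).1]) ht.le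
  have f1 := intervalIntegral.integral_add_adjacent_intervals
    (hci (show 0 < x by linarith) one_pos) (hci one_pos (show 0 < u by linarith))
  have f2 := intervalIntegral.integral_add_adjacent_intervals
    (hci one_pos rE_pos) (hci rE_pos (show 0 < u by linarith))
  have f3 : ∫ t in x..1, (1 + χ t) / t ≤ 3 * |x - 1| := by
    rcases le_total x 1 with h1 | h1
    · have h2 : ∫ t in x..1, (1 + χ t) / t ≤ ∫ t in x..1, (3:ℝ) :=
        intervalIntegral.integral_mono_on h1 (hci (by linarith) one_pos) (by simp) fun t ht => by
          have ht0 : 0 < t := by linarith [ht.1]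
          rw [div_le_iff₀ ht0]
          linarith [(abs_le.1 (h.abs_chi ht0)).2, ht.1]
      rw [intervalIntegral.integral_const, smul_eq_mul] at h2
      linarith [neg_abs_le (x - 1)]
    · rw [intervalIntegral.integral_symm]
      have := intervalIntegral.integral_nonneg h1 (μ := volume)
        fun t ht => hc0 (show 0 < t by linarith [ht.1])
      linarith [abs_nonneg (x - 1)]
  have f4 : ∫ t in (1:ℝ)..rE, (1 + χ t) / t = gam g := by
    rw [← h.norm.integral_compl_eq]
    refine intervalIntegral.integral_congr fun t ht => ?_
    rw [Set.uIcc_of_le (by linarith)] at ht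
    have ht0 : 0 < t := by linarith [ht.1]
    simp only [h.chi t ⟨ht0, by linarith [ht.2]⟩]
    field_simp
    ring
  have f5 : ∫ t in rE..u, (1 + χ t) / t ≤ 11 * ε := by
    refine le_trans (intervalIntegral.integral_mono_on (by linarith) (hci rE_pos (by linarith))
      (intervalIntegrable_const.add (h.intervalIntegrable_chi rE_pos.le hu)) fun t ht => ?_)
      (h.integral_one_add_chi_le hu2 huS hε hε2 hs)
    have ht0 : 0 < t := by linarith [ht.1]
    refine div_le_self ?_ (by linarith [ht.1])
    linarith [(abs_le.1 (h.abs_chi ht0)).1]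
  rw [IsNorm.gam_eq] at hγ f4
  nlinarith

end IsCfg

lemma integral_comp_mul_left_div (F : ℝ → ℝ) {T : ℝ} (hT : T ≠ 0) (a b : ℝ) :
    ∫ t in a..b, F (T * t) / t = ∫ t in (T * a)..(T * b), F t / t := by
  have h1 : (fun t => F (T * t) / t) = fun t => T * (F (T * t) / (T * t)) := by
    ext t
    rcases eq_or_ne t 0 with rfl | ht
    · simp
    · field_simp
  rw [h1, intervalIntegral.integral_const_mul,
    intervalIntegral.integral_comp_mul_left (fun t => F t / t) hT, smul_eq_mul,
    mul_inv_cancel_left₀ hT]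

lemma IsSolutionR.isSol {χ σ : ℝ → ℝ} (hs : IsSolutionR χ σ) (hm : Measurable χ)
    (hb : ∀ t, χ t ∈ Set.Icc (-1 : ℝ) 1) (h1 : ∀ t, 0 ≤ t → t ≤ 1 → χ t = 1) {T B : ℝ}
    (hT : 0 < T) (hB : 1 / T ≤ B) :
    IsSol (1 / T) B (fun t => χ (T * t)) (fun t => σ (T * t)) := by
  obtain ⟨hσ, hloc, hone, heqn⟩ := hs
  have hB0 : 0 ≤ B := (one_div_pos.2 hT).le.trans hB
  have heq : ∀ u, 0 < u → u * σ u = ∫ t in (0:ℝ)..u, σ (u - t) * χ t := fun u hu => by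
    rcases le_or_gt u 1 with hu1 | hu1
    · have : ∫ t in (0:ℝ)..u, σ (u - t) * χ t = ∫ _ in (0:ℝ)..u, (1:ℝ) := by
        refine intervalIntegral.integral_congr fun t ht => ?_
        rw [Set.uIcc_of_le hu.le] at ht
        simp only [hone (u - t) (by linarith [ht.2]) (by linarith [ht.1]),
          h1 t ht.1 (ht.2.trans hu1), mul_one]
      rw [this, hone u hu.le hu1]; simp
    · exact heqn u hu1
  refine ⟨one_div_pos.2 hT, hB, hm.comp (measurable_const_mul T), fun t _ => abs_le.2 (hb _),
    hσ.comp (measurable_const_mul T), ?_, fun x hx => ?_, fun x hx _ => ?_⟩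
  · have h2 : IntervalIntegrable σ volume 0 (T * B) := by
      rw [intervalIntegrable_iff_integrableOn_Icc_of_le (by positivity)]
      exact hloc.integrableOn_compact_subset Set.Icc_subset_Ici_self isCompact_Icc
    have h3 := h2.comp_mul_left (c := T)
    rwa [zero_div, mul_div_cancel_left₀ _ hT.ne'] at h3
  · exact hone _ (mul_nonneg hT.le hx.1) ((mul_le_mul_of_nonneg_left hx.2 hT.le).trans
      (mul_one_div_cancel hT.ne').le)
  · have h2 := heq (T * x) (mul_pos hT hx)
    have h3 := intervalIntegral.integral_comp_mul_left (a := 0) (b := x)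
      (fun s => σ (T * x - s) * χ s) hT.ne'
    rw [mul_zero, ← h2, smul_eq_mul, mul_assoc, inv_mul_cancel_left₀ hT.ne'] at h3
    rw [← h3]
    exact intervalIntegral.integral_congr fun t _ => by simp only [mul_sub]

/-- The kernel `(1 - χ(t)) / t` on `(0, B]`. -/
noncomputable def gapOf (χ : ℝ → ℝ) (B : ℝ) : ℝ → ℝ :=
  Set.indicator (Set.Ioc 0 B) fun t => (1 - χ t) / t

lemma gapOf_of_nonpos (χ : ℝ → ℝ) (B : ℝ) {t : ℝ} (ht : t ≤ 0) : gapOf χ B t = 0 :=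
  Set.indicator_of_notMem (fun h => absurd h.1 (not_lt.2 ht)) _

lemma eq_one_sub_mul_gapOf (χ : ℝ → ℝ) {B : ℝ} : ∀ t ∈ Set.Ioc 0 B, χ t = 1 - t * gapOf χ B t := by
  intro t ht
  rw [gapOf, Set.indicator_of_mem ht, mul_div_cancel₀ _ ht.1.ne']; ring

lemma isGap_gapOf {χ : ℝ → ℝ} (hm : Measurable χ) (hb : ∀ t, χ t ∈ Set.Icc (-1 : ℝ) 1) {τ B : ℝ}
    (hτ : 0 < τ) (hB : τ ≤ B) (h1 : ∀ t, 0 < t → t ≤ τ → χ t = 1) : IsGap τ B (gapOf χ B) where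
  pos := hτ
  le := hB
  meas := ((measurable_const.sub hm).div measurable_id).indicator measurableSet_Ioc
  nonneg := fun t => Set.indicator_nonneg
    (fun t ht => div_nonneg (by linarith [(hb t).2]) ht.1.le) t
  mul_le := fun t => by
    by_cases ht : t ∈ Set.Ioc 0 B
    · linarith [eq_one_sub_mul_gapOf χ t ht, (hb t).1]
    · rw [gapOf, Set.indicator_of_notMem ht]; norm_num
  left := fun t ht => by
    rcases le_or_gt t 0 with h0 | h0
    · exact gapOf_of_nonpos χ B h0
    · have h2 : t ∈ Set.Ioc 0 B := ⟨h0, ht.trans hB⟩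
      rw [gapOf, Set.indicator_of_mem h2, h1 t h0 ht]; simp
  right := fun t ht => Set.indicator_of_notMem (fun h => absurd h.2 (not_le.2 ht)) _

lemma cv_gapOf_heav {χ : ℝ → ℝ} (hm : Measurable χ) (hb : ∀ t, χ t ∈ Set.Icc (-1 : ℝ) 1) {τ B x : ℝ}
    (hτ : 0 < τ) (h1 : ∀ t, 0 < t → t ≤ τ → χ t = 1) (hx : τ ≤ x) (hxB : x ≤ B) :
    cv (gapOf χ B) heav x = ∫ t in τ..x, (1 - χ t) / t := by
  have hg := isGap_gapOf hm hb hτ (hx.trans hxB) h1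
  have hi : ∀ a b, IntervalIntegrable (gapOf χ B) volume a b := fun a b =>
    hg.isKernel.2.intervalIntegrable
  have h0 : ∫ t in (0:ℝ)..τ, gapOf χ B t = 0 := by
    rw [← cv_heav hg.left_zero hτ.le, cv_heav_of_le hg.left le_rfl]
  rw [cv_heav hg.left_zero (hτ.le.trans hx),
    ← intervalIntegral.integral_add_adjacent_intervals (hi 0 τ) (hi τ x), h0, zero_add]
  refine intervalIntegral.integral_congr fun t ht => ?_
  rw [Set.uIcc_of_le hx] at ht
  have h2 : t ∈ Set.Ioc 0 B := ⟨hτ.trans_le ht.1, ht.2.trans hxB⟩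
  exact Set.indicator_of_mem h2 _

/-- Rescaling by `u₀ / √e` puts a solution whose kernel has mass one on `[1, u₀]` in normal form. -/
lemma IsSolutionR.isCfg {χ σ : ℝ → ℝ} (hs : IsSolutionR χ σ) (hm : Measurable χ)
    (hb : ∀ t, χ t ∈ Set.Icc (-1 : ℝ) 1) (h1 : ∀ t, 0 ≤ t → t ≤ 1 → χ t = 1) {u₀ : ℝ}
    (hu₀ : 1 ≤ u₀) (hI : ∫ t in (1:ℝ)..u₀, (1 - χ t) / t = 1) :
    IsCfg (1 / (u₀ / rE)) (gapOf (fun t => χ (u₀ / rE * t)) uS) (fun t => χ (u₀ / rE * t))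
      (fun t => σ (u₀ / rE * t)) := by
  have hE := rE_pos
  set T := u₀ / rE with hTdef
  have hT : 0 < T := div_pos (by linarith) hE
  have hτ : 0 < 1 / T := one_div_pos.2 hT
  have hτE : 1 / T ≤ rE := by
    rw [hTdef, one_div_div]
    exact div_le_self hE.le hu₀
  have hES : rE ≤ uS := by rw [uS]; linarith
  have hm' : Measurable fun t => χ (T * t) := hm.comp (measurable_const_mul T)
  have hb' : ∀ t, χ (T * t) ∈ Set.Icc (-1 : ℝ) 1 := fun t => hb _
  have h1' : ∀ t, 0 < t → t ≤ 1 / T → χ (T * t) = 1 := fun t ht htT =>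
    h1 _ (mul_pos hT ht).le ((mul_le_mul_of_nonneg_left htT hT.le).trans
      (mul_one_div_cancel hT.ne').le)
  have hgap := isGap_gapOf hm' hb' hτ (hτE.trans hES) h1'
  have hmass : cv (gapOf (fun t => χ (T * t)) uS) heav rE = 1 := by
    rw [cv_gapOf_heav hm' hb' hτ h1' hτE hES,
      integral_comp_mul_left_div (fun t => 1 - χ t) hT.ne', mul_one_div_cancel hT.ne',
      show T * rE = u₀ from div_mul_cancel₀ _ hE.ne', hI]
  refine ⟨⟨hgap, ?_, hmass⟩, fun B hB => hs.isSol hm hb h1 hT (hτE.trans (hES.trans hB)),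
    eq_one_sub_mul_gapOf _⟩
  have h2 := hgap.cv_heav_sub_le hτ hτE
  rw [hmass, cv_heav_of_le hgap.left le_rfl, Real.log_div hE.ne' hτ.ne', log_rE] at h2
  exact (Real.log_nonpos_iff hτ.le).1 (by linarith)

lemma IsSolutionR.pos {χ σ : ℝ → ℝ} (hs : IsSolutionR χ σ) (hm : Measurable χ)
    (hb : ∀ t, χ t ∈ Set.Icc (-1 : ℝ) 1) (h1 : ∀ t, 0 ≤ t → t ≤ 1 → χ t = 1) {u : ℝ} (hu : 1 ≤ u)
    (hI : ∫ t in (1:ℝ)..u, (1 - χ t) / t < 1) : 0 < σ u := by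
  have h1' : ∀ t, 0 < t → t ≤ 1 → χ t = 1 := fun t ht => h1 t ht.le
  have h2 : IsSol 1 u χ σ := by
    simpa using hs.isSol hm hb h1 one_pos (B := u) (by simpa using hu)
  have h3 := (sol_bounds (isGap_gapOf hm hb one_pos hu h1') h2 (eq_one_sub_mul_gapOf χ)
    (by linarith) le_rfl).1
  have h4 : iter (gapOf χ u) 1 u = cv (gapOf χ u) heav u := by simp [iter]
  rw [h4, cv_gapOf_heav hm hb one_pos h1' hu le_rfl] at h3
  linarith

theorem theorem_five_point_one :
    ∃ C : ℝ, 0 < C ∧ ∃ ε₀ : ℝ, 0 < ε₀ ∧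
      ∀ χ σ : ℝ → ℝ, Measurable χ → (∀ t : ℝ, χ t ∈ Set.Icc (-1 : ℝ) 1) →
        (∀ t : ℝ, 0 ≤ t → t ≤ 1 → χ t = 1) → IsSolutionR χ σ →
        -- (a)
        ((∀ u : ℝ, 1 ≤ u → (∫ t in (1:ℝ)..u, (1 - χ t) / t) < 1) →
            ∀ u : ℝ, 0 ≤ u → 0 < σ u) ∧
        -- (b)
        (∀ u₀ : ℝ, 1 ≤ u₀ → (∫ t in (1:ℝ)..u₀, (1 - χ t) / t) = 1 →
            (∀ u : ℝ, 0 ≤ u → u ≤ u₀ → 0 ≤ σ u) ∧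
            (∀ u : ℝ, u₀ ≤ u → |σ u| ≤ |delta1|)) ∧
        -- (c)
        (∀ u₀ : ℝ, 1 ≤ u₀ → (∫ t in (1:ℝ)..u₀, (1 - χ t) / t) = 1 →
            ∀ ε : ℝ, 0 < ε → ε ≤ ε₀ → ∀ u : ℝ, 1 ≤ u → |σ u - delta1| ≤ ε →
              |u / u₀ - (1 + 1 / Real.sqrt (Real.exp 1))| ≤ C * ε ^ ((1:ℝ)/4) ∧
              (∫ t in (1:ℝ)..(u / (1 + Real.sqrt (Real.exp 1))), (1 - χ t) / t) +
                (∫ t in (u / (1 + Real.sqrt (Real.exp 1)))..u, (1 + χ t) / t) ≤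
                C * Real.sqrt ε) := by
  have hE := rE_pos
  have hEE := rE_lo
  refine ⟨200, by norm_num, 1 / 10 ^ 8, by norm_num, fun χ σ hm hb h1 hs =>
    ⟨fun hI u hu => ?_, fun u₀ hu₀ hI => ?_, fun u₀ hu₀ hI ε hε hε1 u hu hσ => ?_⟩⟩
  · rcases le_or_gt u 1 with h | h
    · rw [hs.2.2.1 u hu h]; exact one_pos
    · exact hs.pos hm hb h1 h.le (hI u h.le)
  · have hc := hs.isCfg hm hb h1 hu₀ hI
    have hT : 0 < u₀ / rE := div_pos (by linarith) hE
    have key : ∀ u, u₀ / rE * (u / (u₀ / rE)) = u := fun u => mul_div_cancel₀ u hT.ne'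
    refine ⟨fun u hu huu => ?_, fun u hu => ?_⟩
    · have h2 := hc.sol_nonneg (x := u / (u₀ / rE)) (by positivity) (by
        rw [div_le_iff₀ hT, mul_div_cancel₀ _ hE.ne']; exact huu)
      simpa only [key] using h2
    · have h2 := hc.abs_le_rho (u := u / (u₀ / rE)) (by
        rw [le_div_iff₀ hT, mul_div_cancel₀ _ hE.ne']; exact hu)
      simp only [key] at h2
      have h3 := rho_uS_ge
      rwa [delta1_eq, abs_neg, abs_of_nonneg (a := rho uS) (by linarith)]
  · have hc := hs.isCfg hm hb h1 hu₀ hI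
    have hT : 0 < u₀ / rE := div_pos (by linarith) hE
    have key : ∀ u, u₀ / rE * (u / (u₀ / rE)) = u := fun u => mul_div_cancel₀ u hT.ne'
    rw [delta1_eq, abs_le] at hσ
    obtain ⟨h2, h3⟩ := hc.stability (u := u / (u₀ / rE)) (div_nonneg (by linarith) hT.le) hε.le hε1
      (by simp only [key]; linarith [hσ.2])
    rw [integral_comp_mul_left_div (fun t => 1 - χ t) hT.ne',
      integral_comp_mul_left_div (fun t => 1 + χ t) hT.ne', mul_one_div_cancel hT.ne',
      key, mul_div_assoc', key, uS] at h3
    refine ⟨?_, h3⟩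
    have h4 : u / u₀ - (1 + 1 / rE) = (u / (u₀ / rE) - uS) / rE := by
      rw [uS]; field_simp; ring
    have h5 : √ε ≤ ε ^ ((1:ℝ) / 4) := by
      rw [Real.sqrt_eq_rpow]
      exact Real.rpow_le_rpow_of_exponent_ge hε (hε1.trans (by norm_num)) (by norm_num)
    have h6 := Real.sqrt_nonneg ε
    change |u / u₀ - (1 + 1 / rE)| ≤ _
    rw [h4, abs_div, abs_of_pos hE, div_le_iff₀ hE]
    nlinarith
end
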